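/- Let W be a vector space over ℂ, let S be a quasi compatible subset of ℰ(W), and let Γ be a subgroup of ℂˣ. Then there exists a unique smallest closed quasi compatible subspace ⟨S⟩_Γ of ℰ(W) which contains S ∪ {1_W} and is closed under the actions of R_α for α ∈ Γ. The triple (⟨S⟩_Γ, Y_ℰ, 1_W) carries the structure of a nonlocal vertex algebra with W as a faithful quasi module via Y_W(ψ(x), x₀) = ψ(x₀). Furthermore, ⟨S⟩_Γ = span{ a⁽¹⁾(x)_{n₁} ⋯ a⁽ʳ⁾(x)_{n_r} 1_W : r ≥ 0, a⁽ⁱ⁾(x) ∈ R_Γ(S), n_i ∈ ℤ }, where R_Γ(S) = { a(αx) : α ∈ Γ, a(x) ∈ S }; and for a(x), b(x) ∈ ⟨S⟩_Γ, α ∈ Γ, n ∈ ℤ one has a(x)_{(α,n)} b(x) ∈ ⟨S⟩_Γ, Y_ℰ^{(α)}(a(x),x₀)b(x) = R_α Y_ℰ(a(x),x₀) R_{α⁻¹} b(x), and R_α Y_ℰ(a(x),x₀) R_{α⁻¹} b(x) = Y_ℰ(R_α a(x), α⁻¹x₀) b(x). -/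

import Mathlib

noncomputable section

open Classical

namespace NVA

/-! ### The space ℰ(W) = Hom(W, W((x))), coefficient-indexed by modes:
`a w n` is the mode `a_n` applied to `w`, where `a(x)w = ∑ (a_n w) x^{-n-1}`.
Lower truncation of `a(x)w` in powers of `x` means `a_n w = 0` for `n` large. -/

variable (W : Type*) [AddCommGroup W] [Module ℂ W]

/-- `ℰ(W) = Hom(W, W((x)))` as a submodule of `Hom(W, W[[x^{±1}]])`. -/
def EWsub : Submodule ℂ (W →ₗ[ℂ] (ℤ → W)) where
  carrier := {a | ∀ w : W, ∃ N : ℤ, ∀ n : ℤ, N ≤ n → a w n = 0}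
  add_mem' := by
    intro a b ha hb w
    obtain ⟨N, hN⟩ := ha w
    obtain ⟨M, hM⟩ := hb w
    refine ⟨max N M, fun n hn => ?_⟩
    simp only [LinearMap.add_apply, Pi.add_apply,
      hN n (le_trans (le_max_left _ _) hn), hM n (le_trans (le_max_right _ _) hn), add_zero]
  zero_mem' := by intro w; exact ⟨0, fun n _ => rfl⟩
  smul_mem' := by
    intro c a ha w
    obtain ⟨N, hN⟩ := ha w
    exact ⟨N, fun n hn => by
      simp only [LinearMap.smul_apply, Pi.smul_apply, hN n hn, smul_zero]⟩

/-- The type `ℰ(W)`. -/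
abbrev EW := ↥(EWsub W)

variable {W}

/-- The mode function of an element of `ℰ(W)`. -/
def mf (a : EW W) : W → ℤ → W := fun w n => (a : W →ₗ[ℂ] (ℤ → W)) w n

/-- The identity operator `1_W`, as an element of `ℰ(W)`. -/
def oneE : EW W :=
  ⟨{ toFun := fun w n => if n = -1 then w else 0
     map_add' := by
       intro w w'; funext n; by_cases h : n = -1 <;> simp [h]
     map_smul' := by
       intro c w; funext n; by_cases h : n = -1 <;> simp [h] },
   fun w => ⟨0, fun n hn => if_neg (by omega)⟩⟩

/-- The generalized binomial coefficient `C(m, j)` for `m ∈ ℤ`, as a complex number. -/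
def binom (m : ℤ) (j : ℕ) : ℂ :=
  (∏ i ∈ Finset.range j, ((m : ℂ) - (i : ℂ))) / (j.factorial : ℂ)

/-- The coefficient of `x₁^m x₂^t` in `a(x₁) b(x₂) w`. -/
def Fab (a b : EW W) (w : W) (m t : ℤ) : W := mf a (mf b w (-t - 1)) (-m - 1)

/-- Multiplication of a two-variable family by a polynomial `p(x₁,x₂)`. -/
def mulPoly (p : MvPolynomial (Fin 2) ℂ) (F : ℤ → ℤ → W) : ℤ → ℤ → W :=
  fun m t => ∑ d ∈ p.support, MvPolynomial.coeff d p • F (m - d 0) (t - d 1)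

/-- A two-variable family lies in `W((x₁,x₂))` (jointly lower truncated). -/
def IsLaurent2 (F : ℤ → ℤ → W) : Prop :=
  ∃ N : ℤ, ∀ m t : ℤ, (m < N ∨ t < N) → F m t = 0

/-- Quasi compatibility of an ordered pair `(a(x), b(x))` in `ℰ(W)`:
`p(x₁,x₂) a(x₁) b(x₂) ∈ Hom(W, W((x₁,x₂)))` for some nonzero polynomial `p`. -/
def QCPair (a b : EW W) : Prop :=
  ∃ p : MvPolynomial (Fin 2) ℂ, p ≠ 0 ∧ ∀ w, IsLaurent2 (mulPoly p (Fab a b w))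

/-! ### Sequences -/

/-- The coefficient of `x₁^{k 1} ⋯ x_r^{k r}` in `ψ₁(x₁) ⋯ ψ_r(x_r) w`. -/
def seqCoeff : {r : ℕ} → (Fin r → EW W) → W → (Fin r → ℤ) → W
  | 0, _, w, _ => w
  | _ + 1, ψ, w, k => mf (ψ 0) (seqCoeff (Fin.tail ψ) w (Fin.tail k)) (-(k 0) - 1)

/-- The polynomial `∏_{1 ≤ i < j ≤ r} p(x_i, x_j)`. -/
def pairPoly (p : MvPolynomial (Fin 2) ℂ) (r : ℕ) : MvPolynomial (Fin r) ℂ :=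
  ∏ ij ∈ Finset.univ.filter (fun ij : Fin r × Fin r => ij.1 < ij.2),
    MvPolynomial.rename ![ij.1, ij.2] p

/-- Multiplication of an `r`-variable family by a polynomial in `r` variables. -/
def mulPolyN {r : ℕ} (P : MvPolynomial (Fin r) ℂ) (F : (Fin r → ℤ) → W) :
    (Fin r → ℤ) → W :=
  fun k => ∑ d ∈ P.support, MvPolynomial.coeff d P • F (fun i => k i - d i)

/-- An `r`-variable family lies in `W((x₁,…,x_r))`. -/
def IsLaurentN {r : ℕ} (F : (Fin r → ℤ) → W) : Prop :=
  ∃ N : ℤ, ∀ k : Fin r → ℤ, (∃ i, k i < N) → F k = 0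

/-- Quasi compatibility of an ordered sequence in `ℰ(W)`. -/
def QCSeq {r : ℕ} (ψ : Fin r → EW W) : Prop :=
  ∃ p : MvPolynomial (Fin 2) ℂ, p ≠ 0 ∧
    ∀ w, IsLaurentN (mulPolyN (pairPoly p r) (seqCoeff ψ w))

/-- Quasi compatibility of a subset of `ℰ(W)`. -/
def QCSet (S : Set (EW W)) : Prop :=
  ∀ (r : ℕ) (ψ : Fin r → EW W), (∀ i, ψ i ∈ S) → QCSeq ψ

/-! ### The vertex operation `Y_ℰ^{(α)}` -/

/-- `ℂ((x))`. -/
abbrev LC : Type := LaurentSeries ℂ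

/-- An iterated Laurent series field, e.g. `ℂ((x))((x₀))` (outer variable the second one). -/
abbrev K2 : Type := HahnSeries ℤ LC

/-- The outer variable of `K2`. -/
def xOuter : K2 := HahnSeries.single 1 1

/-- The inner variable of `K2`. -/
def xInner : K2 := HahnSeries.single 0 (HahnSeries.single 1 1)

/-- `α` times the inner variable of `K2`. -/
def xInnerC (c : ℂ) : K2 := HahnSeries.single 0 (HahnSeries.single 1 c)

/-- The polynomial `p(x₀ + α x, x)` as an element of `ℂ((x))((x₀))`
(outer variable `x₀`). -/
def qK (p : MvPolynomial (Fin 2) ℂ) (α : ℂ) : K2 :=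
  MvPolynomial.aeval ![xOuter + xInnerC α, xInner] p

/-- The expansion `ι_{x,x₀} (p(x₀ + α x, x)^{-1}) ∈ ℂ((x))((x₀))`. -/
def qInv (p : MvPolynomial (Fin 2) ℂ) (α : ℂ) : K2 := (qK p α)⁻¹

/-- The coefficient of `x₀^j x^t` in `(p(x₁,x) a(x₁) b(x) w)|_{x₁ = αx + x₀}`,
expanding via `(αx+x₀)^m = ∑_{j≥0} C(m,j) α^{m-j} x^{m-j} x₀^j`. -/
def substYE (α : ℂ) (p : MvPolynomial (Fin 2) ℂ) (a b : EW W) (w : W)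
    (j : ℕ) (t : ℤ) : W :=
  ∑ᶠ m : ℤ, (binom m j * α ^ (m - (j : ℤ))) • mulPoly p (Fab a b w) m (t - m + j)

/-- The coefficient of `x₀^J x^T` in
`ι_{x,x₀}(p(x₀+αx,x)^{-1}) ⬝ (p(x₁,x)a(x₁)b(x)w)|_{x₁ = αx+x₀}`. -/
def fullYE (α : ℂ) (p : MvPolynomial (Fin 2) ℂ) (a b : EW W) (w : W)
    (J T : ℤ) : W :=
  ∑ᶠ s : ℤ × ℤ, (((qInv p α).coeff s.1).coeff s.2) •
    (if 0 ≤ J - s.1 then substYE α p a b w (J - s.1).toNat (T - s.2) else 0)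

/-- The raw mode family of `Y_ℰ^{(α)}(a(x), x₀) b(x)`; `rawYE α a b n w m` is the mode
`m` of the element `a(x)_{(α,n)} b(x)` applied to `w`.  (Defined using a choice of
polynomial from quasi compatibility; by the general theory the value does not depend
on the choice.) -/
def rawYE (α : ℂ) (a b : EW W) (n : ℤ) (w : W) (m : ℤ) : W :=
  if h : QCPair a b then fullYE α h.choose a b w (-n - 1) (-m - 1) else 0

/-- `a(x)_{(α,n)} b(x)`, as an element of `ℰ(W)` whenever the raw family is realized
by one (which is the case for any quasi compatible pair). -/
def YEa (α : ℂˣ) (a b : EW W) (n : ℤ) : EW W :=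
  if h : ∃ c : EW W, ∀ w m, mf c w m = rawYE (α : ℂ) a b n w m then h.choose else 0

/-- `a(x)_n b(x) = a(x)_{(1,n)} b(x)`. -/
def YE (a b : EW W) (n : ℤ) : EW W := YEa 1 a b n

end NVA

namespace NVA

variable {W : Type*} [AddCommGroup W] [Module ℂ W]

/-- Submodules of `ℰ(W)` are `ℂ`-vector spaces (registered explicitly to assist
instance resolution). -/
noncomputable instance (V : Submodule ℂ (EW W)) : AddCommGroup ↥V :=
  @Submodule.addCommGroup ℂ (EW W) _ inferInstance inferInstance V

noncomputable instance (V : Submodule ℂ (EW W)) : Module ℂ ↥V :=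
  @Submodule.module ℂ (EW W) _ inferInstance inferInstance V

/-! ### Derivative and scaling operators on ℰ(W) -/

/-- `D = d/dx` on `ℰ(W)`: `(Da)_m = -m • a_{m-1}`. -/
def Dop (a : EW W) : EW W :=
  ⟨{ toFun := fun w m => (-m : ℂ) • mf a w (m - 1)
     map_add' := by intro w w'; funext m; simp [mf, map_add]
     map_smul' := by
       intro c w; funext m
       simp only [mf, map_smul, Pi.smul_apply, RingHom.id_apply]
       exact smul_comm _ _ _ },
   by
     intro w
     obtain ⟨N, hN⟩ := a.2 w
     exact ⟨N + 1, fun m hm => by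
       have : (a : W →ₗ[ℂ] (ℤ → W)) w (m - 1) = 0 := hN _ (by omega)
       simp [mf, this]⟩⟩

/-- `R_α : a(x) ↦ a(αx)`, on modes `(R_α a)_m = α^{-m-1} a_m`. -/
def RaE (α : ℂˣ) (a : EW W) : EW W :=
  ⟨{ toFun := fun w m => ((α : ℂ) ^ (-m - 1 : ℤ)) • mf a w m
     map_add' := by intro w w'; funext m; simp [mf, map_add]
     map_smul' := by
       intro c w; funext m
       simp only [mf, map_smul, Pi.smul_apply, RingHom.id_apply]
       exact smul_comm _ _ _ },
   by
     intro w
     obtain ⟨N, hN⟩ := a.2 w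
     exact ⟨N, fun m hm => by simp [mf, hN m hm]⟩⟩

/-! ### Nonlocal vertex algebras, modules and quasi modules -/

/-- The coefficient of `x₀^a x₂^b` in `Y₁(u, x₀+x₂) (Y₂(v,x₂) w)`, where
`(x₀+x₂)^m` is expanded in nonnegative powers of `x₂`. -/
def prodCE {V : Type*} (Yo Yi : V → W → ℤ → W) (u v : V) (w : W) (a b : ℤ) : W :=
  ∑ᶠ m : ℤ, if a ≤ m then
    binom m (m - a).toNat • Yo u (Yi v w (-(b - (m - a)) - 1)) (-m - 1) else 0

/-- The coefficient of `x₀^a x₂^b` in `Y₂(Y₁(u,x₀)v, x₂) w`. -/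
def assocCE {V : Type*} (Y1 : V → V → ℤ → V) (Y2 : V → W → ℤ → W)
    (u v : V) (w : W) (a b : ℤ) : W :=
  Y2 (Y1 u v (-a - 1)) w (-b - 1)

/-- Multiplication of a two-variable family (in `x₀, x₂`) by `f(x₀+x₂, x₂)` for a
polynomial `f`, expanding `(x₀+x₂)^d` in nonnegative powers of `x₂`. -/
def mulSubPoly (f : MvPolynomial (Fin 2) ℂ) (A : ℤ → ℤ → W) (a b : ℤ) : W :=
  ∑ d ∈ f.support, ∑ i ∈ Finset.range (d 0 + 1),
    (MvPolynomial.coeff d f * ((d 0).choose i : ℂ)) •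
      A (a - ((d 0 : ℤ) - i)) (b - i - (d 1 : ℤ))

/-- A nonlocal vertex algebra structure on a ℂ-vector space `V`:
a linear map `Y : V → ℰ(V) = Hom(V, V((x)))` and a vacuum vector `1` such that
`Y(1,x)v = v`, `Y(v,x)1 ∈ V[[x]]` with constant term `v`, and weak associativity
holds. -/
structure NLVA (V : Type*) [AddCommGroup V] [Module ℂ V] where
  Y : V →ₗ[ℂ] EW V
  one : V
  vac : ∀ (v : V) (n : ℤ), mf (Y one) v n = if n = -1 then v else 0
  creation0 : ∀ (v : V) (n : ℤ), 0 ≤ n → mf (Y v) one n = 0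
  creation1 : ∀ v : V, mf (Y v) one (-1) = v
  wassoc : ∀ u v w : V, ∃ l : ℕ, ∀ a b : ℤ,
    mulSubPoly (MvPolynomial.X 0 ^ l)
      (prodCE (fun x => mf (Y x)) (fun x => mf (Y x)) u v w) a b =
    mulSubPoly (MvPolynomial.X 0 ^ l)
      (assocCE (fun x y n => mf (Y x) y n) (fun x => mf (Y x)) u v w) a b

/-- The mode maps of a nonlocal vertex algebra: `Yf A u v n = u_n v`. -/
def Yf {V : Type*} [AddCommGroup V] [Module ℂ V] (A : NLVA V) : V → V → ℤ → V :=
  fun u v n => mf (A.Y u) v n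

/-- Mode maps of a linear map `V → ℰ(W)`. -/
def YWf {V : Type*} [AddCommGroup V] [Module ℂ V] (YW : V →ₗ[ℂ] EW W) :
    V → W → ℤ → W := fun v w n => mf (YW v) w n

/-- `(W, Y_W)` is a quasi module for the nonlocal vertex algebra `A` on `V`. -/
def IsQuasiModule {V : Type*} [AddCommGroup V] [Module ℂ V] (A : NLVA V)
    (YW : V →ₗ[ℂ] EW W) : Prop :=
  (∀ (w : W) (n : ℤ), mf (YW A.one) w n = if n = -1 then w else 0) ∧
  ∀ (u v : V) (w : W), ∃ f : MvPolynomial (Fin 2) ℂ, f ≠ 0 ∧ ∀ a b : ℤ,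
    mulSubPoly f (prodCE (YWf YW) (YWf YW) u v w) a b =
    mulSubPoly f (assocCE (Yf A) (YWf YW) u v w) a b

/-- `(W, Y_W)` is a module for the nonlocal vertex algebra `A` on `V`. -/
def IsModule {V : Type*} [AddCommGroup V] [Module ℂ V] (A : NLVA V)
    (YW : V →ₗ[ℂ] EW W) : Prop :=
  (∀ (w : W) (n : ℤ), mf (YW A.one) w n = if n = -1 then w else 0) ∧
  ∀ (u v : V) (w : W), ∃ l : ℕ, ∀ a b : ℤ,
    mulSubPoly (MvPolynomial.X 0 ^ l) (prodCE (YWf YW) (YWf YW) u v w) a b =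
    mulSubPoly (MvPolynomial.X 0 ^ l) (assocCE (Yf A) (YWf YW) u v w) a b

end NVA

namespace NVA

variable {W : Type*} [AddCommGroup W] [Module ℂ W]

/-- The monomial `a⁽¹⁾(x)_{n₁} ⋯ a⁽ʳ⁾(x)_{n_r} 1_W ∈ ℰ(W)`. -/
def monomialE : {r : ℕ} → (Fin r → EW W) → (Fin r → ℤ) → EW W
  | 0, _, _ => oneE
  | _ + 1, a, n => YE (a 0) (monomialE (Fin.tail a) (Fin.tail n)) (n 0)

/-- `R_Γ(S) = { a(αx) | α ∈ Γ, a(x) ∈ S }`. -/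
def RGamma (Γ : Subgroup ℂˣ) (S : Set (EW W)) : Set (EW W) :=
  {c | ∃ α ∈ Γ, ∃ a ∈ S, c = RaE α a}

/-- `U` is a closed quasi compatible subspace of `ℰ(W)` containing `S ∪ {1_W}` and
stable under `R_α` for `α ∈ Γ`, and is the smallest such. -/
def IsGenGamma (Γ : Subgroup ℂˣ) (S : Set (EW W)) (U : Submodule ℂ (EW W)) : Prop :=
  (QCSet (U : Set (EW W)) ∧ (∀ a ∈ U, ∀ b ∈ U, ∀ n : ℤ, YE a b n ∈ U) ∧
    oneE ∈ U ∧ S ⊆ (U : Set (EW W)) ∧ (∀ α ∈ Γ, ∀ a ∈ U, RaE α a ∈ U)) ∧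
  ∀ U' : Submodule ℂ (EW W),
    (QCSet (U' : Set (EW W)) ∧ (∀ a ∈ U', ∀ b ∈ U', ∀ n : ℤ, YE a b n ∈ U') ∧
      oneE ∈ U' ∧ S ⊆ (U' : Set (EW W)) ∧ (∀ α ∈ Γ, ∀ a ∈ U', RaE α a ∈ U')) →
    U ≤ U'

set_option linter.unusedSectionVars false

/-! ### Polynomial action on multi-indexed families -/

section Action

variable {ι : Type*}

/-- Shift of a family, i.e. multiplication by the monomial `x^d`. -/
def shiftFam (d : ι → ℤ) : ((ι → ℤ) → W) →ₗ[ℂ] ((ι → ℤ) → W) :=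
  LinearMap.funLeft ℂ W (fun k => k - d)

/-- The ring homomorphism defining the action of polynomials on families. -/
def actHom : MvPolynomial ι ℂ →ₐ[ℂ] Module.End ℂ ((ι → ℤ) → W) :=
  AddMonoidAlgebra.lift ℂ (Module.End ℂ ((ι → ℤ) → W)) (ι →₀ ℕ)
    { toFun := fun d => shiftFam (fun l => (d.toAdd l : ℤ))
      map_one' := by
        ext F k
        simp [shiftFam, LinearMap.funLeft_apply, Pi.sub_def]
      map_mul' := by
        intro d e
        ext F k
        simp only [shiftFam, LinearMap.funLeft_apply, Module.End.mul_apply, toAdd_mul,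
          Finsupp.add_apply, Nat.cast_add]
        congr 1
        funext l
        simp only [Pi.sub_apply]
        ring }

/-- Multiplication of a family, seen as a formal series, by a polynomial. -/
def act (P : MvPolynomial ι ℂ) (F : (ι → ℤ) → W) : (ι → ℤ) → W := actHom P F

lemma act_apply (P : MvPolynomial ι ℂ) (F : (ι → ℤ) → W) (k : ι → ℤ) :
    act P F k = ∑ d ∈ P.support, MvPolynomial.coeff d P • F (fun l => k l - d l) := by
  have h : actHom (W := W) P = Finsupp.sum (AddMonoidAlgebra.coeff P) fun d c =>
      c • shiftFam (W := W) (fun l => (d l : ℤ)) := by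
    exact AddMonoidAlgebra.lift_apply _ _
  rw [act, h]
  unfold Finsupp.sum
  simp only [LinearMap.sum_apply, Finset.sum_apply, LinearMap.smul_apply, Pi.smul_apply]
  rfl

lemma act_monomial (d : ι →₀ ℕ) (c : ℂ) (F : (ι → ℤ) → W) (k : ι → ℤ) :
    act (MvPolynomial.monomial d c) F k = c • F (fun l => k l - d l) := by
  have h : actHom (W := W) (MvPolynomial.monomial d c) =
      c • shiftFam (W := W) (fun l => (d l : ℤ)) := by
    exact AddMonoidAlgebra.lift_single _ _ _
  rw [act, h]
  rfl

lemma act_X (i : ι) [DecidableEq ι] (F : (ι → ℤ) → W) (k : ι → ℤ) :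
    act (MvPolynomial.X i) F k = F (k - Pi.single i 1) := by
  rw [MvPolynomial.X, act_monomial, one_smul]
  congr 1
  funext l
  by_cases h : l = i
  · subst h; simp
  · simp [h]

lemma act_C (c : ℂ) (F : (ι → ℤ) → W) : act (MvPolynomial.C c) F = c • F := by
  funext k
  rw [MvPolynomial.C_apply, act_monomial]
  simp

lemma act_mul (P Q : MvPolynomial ι ℂ) (F : (ι → ℤ) → W) :
    act (P * Q) F = act P (act Q F) := by
  simp only [act, map_mul, Module.End.mul_apply]

lemma act_add (P Q : MvPolynomial ι ℂ) (F : (ι → ℤ) → W) :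
    act (P + Q) F = act P F + act Q F := by
  simp only [act, map_add, LinearMap.add_apply]

lemma act_comm (P Q : MvPolynomial ι ℂ) (F : (ι → ℤ) → W) :
    act P (act Q F) = act Q (act P F) := by
  rw [← act_mul, mul_comm, act_mul]

lemma act_one (F : (ι → ℤ) → W) : act (1 : MvPolynomial ι ℂ) F = F := by
  simp only [act, map_one, Module.End.one_apply]

lemma act_zero (F : (ι → ℤ) → W) : act (0 : MvPolynomial ι ℂ) F = 0 := by
  simp only [act, map_zero, LinearMap.zero_apply]

lemma act_zero_right (P : MvPolynomial ι ℂ) : act P (0 : (ι → ℤ) → W) = 0 := by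
  simp only [act, map_zero]

lemma act_add_right (P : MvPolynomial ι ℂ) (F G : (ι → ℤ) → W) :
    act P (F + G) = act P F + act P G := by
  simp only [act, map_add]

lemma act_sub_right (P : MvPolynomial ι ℂ) (F G : (ι → ℤ) → W) :
    act P (F - G) = act P F - act P G := by
  simp only [act, map_sub]

lemma act_smul_right (P : MvPolynomial ι ℂ) (a : ℂ) (F : (ι → ℤ) → W) :
    act P (a • F) = a • act P F := by
  simp only [act, map_smul]

lemma act_rename {κ : Type*} (f : κ → ι) (hf : Function.Injective f)
    (P : MvPolynomial κ ℂ) (F : (κ → ℤ) → W) (k : ι → ℤ) :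
    act (MvPolynomial.rename f P) (fun k => F (k ∘ f)) k = act P F (k ∘ f) := by
  induction P using MvPolynomial.induction_on generalizing F k with
  | C c => rw [MvPolynomial.rename_C, act_C, act_C]; rfl
  | add p q hp hq => rw [map_add, act_add, act_add]; simp [hp, hq]
  | mul_X p i hp =>
    rw [map_mul, MvPolynomial.rename_X, act_mul, act_mul, ← hp]
    refine congrFun (congrArg _ ?_) k
    funext k
    rw [act_X, act_X]
    congr 1
    funext l
    by_cases h : l = i
    · subst h; simp
    · simp [h, hf.ne h]

end Action

/-! ### Binomial expansions -/

lemma binom_zero (m : ℤ) : binom m 0 = 1 := by simp [binom]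

lemma binom_succ_mul (m : ℤ) (j : ℕ) :
    binom m (j + 1) * (j + 1) = binom m j * (m - j) := by
  have h : ((j.factorial : ℕ) : ℂ) ≠ 0 := by exact_mod_cast j.factorial_ne_zero
  have h' : ((j : ℂ) + 1) ≠ 0 := by exact_mod_cast j.succ_ne_zero
  simp only [binom, Finset.prod_range_succ, Nat.factorial_succ]
  push_cast
  field_simp

lemma binom_pascal (m : ℤ) (j : ℕ) :
    binom (m + 1) (j + 1) = binom m j + binom m (j + 1) := by
  have h' : ((j : ℂ) + 1) ≠ 0 := by exact_mod_cast j.succ_ne_zero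
  have e : binom (m + 1) (j + 1) * (j + 1) = (m + 1) * binom m j := by
    have h : ((j.factorial : ℕ) : ℂ) ≠ 0 := by exact_mod_cast j.factorial_ne_zero
    simp only [binom, Finset.prod_range_succ', Nat.factorial_succ]
    push_cast
    have : ∀ i : ℕ, ((m : ℂ) + 1 - (i + 1)) = m - i := fun i => by ring
    simp only [this]
    field_simp
    ring
  apply mul_right_cancel₀ h'
  rw [e, add_mul (binom m j), binom_succ_mul]
  ring

lemma binom_natCast (m j : ℕ) : binom (m : ℤ) j = (m.choose j : ℂ) := by
  induction m generalizing j with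
  | zero =>
    cases j with
    | zero => simp [binom]
    | succ j => simp [binom, Finset.prod_range_succ']
  | succ m ih =>
    cases j with
    | zero => simp [binom]
    | succ j =>
      push_cast
      rw [binom_pascal, ih, ih, Nat.choose_succ_succ]
      push_cast
      rfl

/-- A binomial expansion rule: `c m n` is the coefficient of `x^n y^(m-n)` in an expansion
of `(x + α y)^m`. -/
def IsExpansion (α : ℂ) (c : ℤ → ℤ → ℂ) : Prop :=
  ∀ m n, c (m + 1) n = c m (n - 1) + α * c m n

/-- Expansion of `(x + α y)^m` in nonnegative powers of `x`. -/
def expL (α : ℂ) (m n : ℤ) : ℂ :=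
  if 0 ≤ n then binom m n.toNat * α ^ (m - n) else 0

/-- Expansion of `(x + y)^m` in nonnegative powers of `y`. -/
def expR (m n : ℤ) : ℂ := if n ≤ m then binom m (m - n).toNat else 0

lemma isExpansion_expL (α : ℂ) (hα : α ≠ 0) : IsExpansion α (expL α) := by
  intro m n
  simp only [expL]
  rcases lt_trichotomy n 0 with h | h | h
  · rw [if_neg (by omega), if_neg (by omega), if_neg (by omega)]; ring
  · subst h
    simp only [le_refl, if_true, Int.toNat_zero, binom_zero]
    rw [if_neg (by omega)]
    simp only [sub_zero, zpow_add_one₀ hα]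
    ring
  · obtain ⟨j, rfl⟩ : ∃ j : ℕ, n = j + 1 := ⟨(n - 1).toNat, by omega⟩
    rw [if_pos (by omega), if_pos (by omega), if_pos (by omega)]
    have e1 : ((j : ℤ) + 1).toNat = j + 1 := by omega
    have e2 : ((j : ℤ) + 1 - 1).toNat = j := by omega
    rw [e1, e2, binom_pascal]
    have e3 : m + 1 - ((j : ℤ) + 1) = m - (j + 1) + 1 := by ring
    have e4 : m - ((j : ℤ) + 1 - 1) = m - (j + 1) + 1 := by ring
    rw [e3, e4, zpow_add_one₀ hα]
    ring

lemma isExpansion_expR : IsExpansion 1 expR := by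
  intro m n
  simp only [expR]
  rcases lt_trichotomy n (m + 1) with h | h | h
  · obtain ⟨j, rfl⟩ : ∃ j : ℕ, m = n + j := ⟨(m - n).toNat, by omega⟩
    rw [if_pos (by omega), if_pos (by omega), if_pos (by omega)]
    have e1 : (n + (j : ℤ) + 1 - n).toNat = j + 1 := by omega
    have e2 : (n + (j : ℤ) - (n - 1)).toNat = j + 1 := by omega
    have e3 : (n + (j : ℤ) - n).toNat = j := by omega
    rw [e1, e2, e3, binom_pascal]
    ring
  · subst h
    simp [binom_zero]
  · rw [if_neg (by omega), if_neg (by omega), if_neg (by omega)]; ring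

lemma expL_eq_expR (m n : ℤ) (hm : 0 ≤ m) : expL 1 m n = expR m n := by
  obtain ⟨M, rfl⟩ := Int.eq_ofNat_of_zero_le hm
  simp only [expL, expR, one_zpow, mul_one]
  by_cases h0 : 0 ≤ n
  · obtain ⟨N, rfl⟩ := Int.eq_ofNat_of_zero_le h0
    by_cases h1 : N ≤ M
    · rw [if_pos h0, if_pos (by omega), binom_natCast, binom_natCast]
      have : ((M : ℤ) - N).toNat = M - N := by omega
      rw [this, Int.toNat_natCast, Nat.choose_symm h1]
    · rw [if_pos h0, if_neg (by omega), binom_natCast, Nat.choose_eq_zero_of_lt]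
      · simp
      · omega
  · rw [if_neg h0, if_pos (by omega), binom_natCast, Nat.choose_eq_zero_of_lt]
    · simp
    · omega

/-! ### Substitution of variables -/

section Subst

variable {ι : Type*} [DecidableEq ι]

/-- The exponent vector of `x_i / x_j`. -/
def quot (i j : ι) : ι → ℤ := Pi.single i 1 - Pi.single j 1

/-- The substitution `x_i ↦ x_i + α x_j` on series, with expansion rule `c`. -/
def subst (c : ℤ → ℤ → ℂ) (i j : ι) (F : (ι → ℤ) → W) (k : ι → ℤ) : W :=
  ∑ᶠ n : ℤ, c (k i + n) (k i) • F (k + n • quot i j)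

/-- The families on which `subst c i j` involves only finite sums. -/
def SubstDom (c : ℤ → ℤ → ℂ) (i j : ι) (F : (ι → ℤ) → W) : Prop :=
  ∀ (k : ι → ℤ) (m : ℤ), {n : ℤ | c n m ≠ 0 ∧ F (k + n • quot i j) ≠ 0}.Finite

/-- The substitution `x_i ↦ x_i + α x_j` on polynomials. -/
def substPoly (α : ℂ) (i j : ι) : MvPolynomial ι ℂ →ₐ[ℂ] MvPolynomial ι ℂ :=
  MvPolynomial.aeval fun l =>
    if l = i then MvPolynomial.X i + MvPolynomial.C α * MvPolynomial.X j else MvPolynomial.X l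

lemma substPoly_X_self (α : ℂ) (i j : ι) : substPoly α i j (MvPolynomial.X i) =
    MvPolynomial.X i + MvPolynomial.C α * MvPolynomial.X j := by
  simp [substPoly]

lemma substPoly_X_of_ne (α : ℂ) {i l : ι} (j : ι) (h : l ≠ i) :
    substPoly α i j (MvPolynomial.X l) = MvPolynomial.X l := by
  simp [substPoly, h]

lemma substPoly_C (α : ℂ) (i j : ι) (a : ℂ) :
    substPoly α i j (MvPolynomial.C a) = MvPolynomial.C a := by
  simp [substPoly]

variable {c : ℤ → ℤ → ℂ} {i j : ι}

lemma SubstDom.finite {F : (ι → ℤ) → W} (h : SubstDom c i j F) (k : ι → ℤ) (u m : ℤ) :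
    {n : ℤ | c (u + n) m ≠ 0 ∧ F (k + n • quot i j) ≠ 0}.Finite := by
  have := h (k - u • quot i j) m
  refine (this.preimage (f := fun n => u + n) (fun a _ b _ hab => by simpa using hab)).subset ?_
  rintro n ⟨h1, h2⟩
  refine ⟨h1, ?_⟩
  have e : k - u • quot i j + (u + n) • quot i j = k + n • quot i j := by
    rw [add_smul]; abel
  change F (k - u • quot i j + (u + n) • quot i j) ≠ 0
  rwa [e]

lemma SubstDom.support {F : (ι → ℤ) → W} (h : SubstDom c i j F) (k : ι → ℤ) (u m : ℤ) :
    (Function.support fun n : ℤ => c (u + n) m • F (k + n • quot i j)).Finite := by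
  refine (h.finite k u m).subset ?_
  intro n hn
  rw [Function.mem_support] at hn
  exact ⟨fun h => hn (by rw [h, zero_smul]), fun h => hn (by rw [h, smul_zero])⟩

lemma SubstDom.add {F G : (ι → ℤ) → W} (hF : SubstDom c i j F) (hG : SubstDom c i j G) :
    SubstDom c i j (F + G) := by
  intro k m
  refine ((hF k m).union (hG k m)).subset ?_
  rintro n ⟨h1, h2⟩
  by_contra h
  simp only [Set.mem_union, Set.mem_ofPred_eq, not_or, not_and, not_not] at h
  exact h2 (by rw [Pi.add_apply, h.1 h1, h.2 h1, add_zero])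

lemma SubstDom.smul {F : (ι → ℤ) → W} (hF : SubstDom c i j F) (a : ℂ) :
    SubstDom c i j (a • F) := by
  intro k m
  refine (hF k m).subset ?_
  rintro n ⟨h1, h2⟩
  exact ⟨h1, fun h => h2 (by rw [Pi.smul_apply, h, smul_zero])⟩

lemma subst_add {F G : (ι → ℤ) → W} (hF : SubstDom c i j F) (hG : SubstDom c i j G) :
    subst c i j (F + G) = subst c i j F + subst c i j G := by
  funext k
  simp only [subst, Pi.add_apply, smul_add]
  exact finsum_add_distrib (hF.support k _ _) (hG.support k _ _)

lemma subst_smul (F : (ι → ℤ) → W) (a : ℂ) :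
    subst c i j (a • F) = a • subst c i j F := by
  funext k
  simp only [subst, Pi.smul_apply]
  rw [smul_finsum]
  congr 1
  funext n
  rw [smul_comm]

lemma SubstDom.act_X {F : (ι → ℤ) → W} (hF : SubstDom c i j F) (l : ι) : SubstDom c i j (act (MvPolynomial.X l) F) := by
  intro k m
  simp only [NVA.act_X]
  have := hF (k - Pi.single l 1) m
  refine this.subset ?_
  rintro n ⟨h1, h2⟩
  refine ⟨h1, ?_⟩
  have e : k + n • quot i j - Pi.single l 1 = k - Pi.single l 1 + n • quot i j := by abel
  rwa [e] at h2

lemma SubstDom.act {F : (ι → ℤ) → W} (hF : SubstDom c i j F) (P : MvPolynomial ι ℂ) : SubstDom c i j (act P F) := by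
  induction P using MvPolynomial.induction_on generalizing F with
  | C a => rw [act_C]; exact hF.smul a
  | add p q hp hq => rw [act_add]; exact (hp hF).add (hq hF)
  | mul_X p l hp => rw [act_mul]; exact hp (hF.act_X l)

lemma subst_act_X {F : (ι → ℤ) → W} {α : ℂ} (hc : IsExpansion α c) (hij : i ≠ j)
    (hF : SubstDom c i j F) (l : ι) :
    subst c i j (act (MvPolynomial.X l) F) =
      NVA.act (substPoly α i j (MvPolynomial.X l)) (subst c i j F) := by
  funext k
  by_cases hl : l = i
  · subst hl
    rw [substPoly_X_self, act_add, act_mul, act_C]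
    simp only [Pi.add_apply, Pi.smul_apply, act_X, subst]
    have e1 : ((k - Pi.single l 1 : ι → ℤ)) l = k l - 1 := by simp
    have e2 : ((k - Pi.single j 1 : ι → ℤ)) l = k l := by simp [hij]
    rw [e1, e2, smul_finsum]
    have e3 : ∑ᶠ n : ℤ, α • c (k l + n) (k l) • F (k - Pi.single j 1 + n • quot l j) =
        ∑ᶠ n : ℤ, α • c (k l - 1 + n) (k l) • F (k - Pi.single l 1 + n • quot l j) := by
      rw [← finsum_comp_equiv (Equiv.addRight (-1 : ℤ))]
      congr 1
      funext n
      simp only [Equiv.coe_addRight]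
      have a1 : k l + (n + -1) = k l - 1 + n := by ring
      have a2 : k - Pi.single j 1 + (n + -1) • quot l j =
          k - Pi.single l 1 + n • quot l j := by
        rw [add_smul, neg_smul, one_smul]; simp only [quot]; abel
      rw [a1, a2]
    rw [e3, ← finsum_add_distrib (hF.support _ _ _)]
    · congr 1
      funext n
      have a1 : k + n • quot l j - Pi.single l 1 = k - Pi.single l 1 + n • quot l j := by abel
      rw [a1, smul_smul, ← add_smul]
      congr 1
      rw [show k l + n = k l - 1 + n + 1 by ring, hc]
    · refine (hF.support (k - Pi.single l 1) (k l - 1) (k l)).subset ?_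
      intro n hn hn'
      exact hn (by simp only at hn' ⊢; rw [hn', smul_zero])
  · rw [substPoly_X_of_ne _ _ hl]
    simp only [act_X, subst]
    have e : ((k - Pi.single l 1 : ι → ℤ)) i = k i := by simp [Ne.symm hl]
    rw [e]
    congr 1
    funext n
    congr 2
    abel

lemma subst_act {F : (ι → ℤ) → W} {α : ℂ} (hc : IsExpansion α c) (hij : i ≠ j)
    (hF : SubstDom c i j F) (P : MvPolynomial ι ℂ) :
    subst c i j (act P F) = NVA.act (substPoly α i j P) (subst c i j F) := by
  induction P using MvPolynomial.induction_on generalizing F with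
  | C a => rw [substPoly_C, act_C, act_C, subst_smul]
  | add p q hp hq =>
    rw [map_add, act_add, act_add, subst_add (hF.act p) (hF.act q), hp hF, hq hF]
  | mul_X p l hp =>
    rw [map_mul, act_mul, act_mul, hp (hF.act_X l), subst_act_X hc hij hF]

end Subst

/-! ### Cancellation of polynomial factors -/

section Cancel

variable {ι : Type*} [DecidableEq ι]

/-- Setting all variables except `x_j` to zero. -/
def evalMain (j : ι) : MvPolynomial ι ℂ →ₐ[ℂ] Polynomial ℂ :=
  MvPolynomial.aeval fun l => if l = j then Polynomial.X else 0

lemma evalMain_X_self (j : ι) : evalMain j (MvPolynomial.X j) = Polynomial.X := by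
  simp [evalMain]

lemma evalMain_X_of_ne {j l : ι} (h : l ≠ j) : evalMain j (MvPolynomial.X l) = 0 := by
  simp [evalMain, h]

lemma coeff_evalMain (j : ι) (P : MvPolynomial ι ℂ) (e : ℕ) :
    (evalMain j P).coeff e = MvPolynomial.coeff (Finsupp.single j e) P := by
  induction P using MvPolynomial.induction_on generalizing e with
  | C a =>
    simp only [evalMain, MvPolynomial.aeval_C, MvPolynomial.coeff_C]
    rw [← Polynomial.C_eq_algebraMap, Polynomial.coeff_C]
    by_cases h : e = 0
    · simp [h]
    · have : (0 : ι →₀ ℕ) ≠ Finsupp.single j e := by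
        intro h'
        exact h (Finsupp.single_eq_zero.mp h'.symm)
      simp [h, this]
  | add p q hp hq => simp [hp, hq]
  | mul_X p l hp =>
    rw [map_mul, MvPolynomial.coeff_mul_X']
    by_cases hl : l = j
    · subst hl
      rw [evalMain_X_self]
      cases e with
      | zero => simp
      | succ e =>
        rw [Polynomial.coeff_mul_X, hp, if_pos (by simp)]
        congr 1
        ext x
        by_cases hx : x = l
        · subst hx; simp
        · simp [Ne.symm hx]
    · rw [evalMain_X_of_ne hl, mul_zero, if_neg]
      · simp
      · intro h
        have := Finsupp.support_single_subset h
        simp at this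
        exact hl this

lemma eq_zero_of_act_eq_zero (j : ι) (D : (ι → ℤ) → W)
    (h1 : ∀ k : ι → ℤ, ∃ n : ℕ, ∀ d : ι →₀ ℕ, n ≤ d.degree → d j = 0 → ∀ t : ℤ,
      D (fun l => k l - d l + t * (Pi.single j 1 : ι → ℤ) l) = 0)
    (h2 : ∀ k : ι → ℤ, ∃ N : ℤ, ∀ t < N,
      D (fun l => k l + t * (Pi.single j 1 : ι → ℤ) l) = 0)
    (V : MvPolynomial ι ℂ) (hV : evalMain j V ≠ 0) (h : act V D = 0) : D = 0 := by
  by_contra hD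
  obtain ⟨k0, hk0⟩ : ∃ k, D k ≠ 0 := by
    by_contra h'
    push Not at h'
    exact hD (funext h')
  let A : ℕ → Prop := fun m => ∃ d : ι →₀ ℕ, d.degree = m ∧ d j = 0 ∧ ∃ t : ℤ,
    D (fun l => k0 l - d l + t * (Pi.single j 1 : ι → ℤ) l) ≠ 0
  obtain ⟨n, hn⟩ := h1 k0
  have hA0 : A 0 := ⟨0, by simp, by simp, 0, by simpa using hk0⟩
  have hAn : ∀ m, A m → m ≤ n := by
    rintro m ⟨d, rfl, hdj, t, ht⟩
    by_contra hlt
    exact ht (hn d (by omega) hdj t)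
  have hmax := Nat.findGreatest_spec (P := A) (Nat.zero_le n) hA0
  obtain ⟨d, hd, hdj, t0, ht0⟩ := hmax
  have hgt : ∀ m, Nat.findGreatest A n < m → ¬ A m := fun m hm hAm =>
    Nat.findGreatest_is_greatest hm (hAn m hAm) hAm
  obtain ⟨N, hN⟩ := h2 (fun l => k0 l - d l)
  obtain ⟨t, ht, htmin⟩ := Int.exists_least_of_bdd
    (P := fun t : ℤ => D (fun l => k0 l - d l + t * (Pi.single j 1 : ι → ℤ) l) ≠ 0)
    ⟨N, fun z hz => by by_contra hlt; exact hz (hN z (by omega))⟩ ⟨t0, ht0⟩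
  set e := (evalMain j V).natTrailingDegree with he
  have hce : MvPolynomial.coeff (Finsupp.single j e) V ≠ 0 := by
    rw [← coeff_evalMain]
    exact Polynomial.trailingCoeff_nonzero_iff_nonzero.mpr hV
  have hev := congrFun h (fun l => k0 l - d l + (t + e) * (Pi.single j 1 : ι → ℤ) l)
  rw [act_apply, Finset.sum_eq_single (Finsupp.single j e)] at hev
  · have e1 : (fun l => k0 l - d l + (t + e) * (Pi.single j 1 : ι → ℤ) l -
        ((Finsupp.single j e) l : ℕ)) =
        fun l => k0 l - d l + t * (Pi.single j 1 : ι → ℤ) l := by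
      funext l
      by_cases hl : l = j
      · subst hl; simp; ring
      · simp [hl]
    rw [e1] at hev
    rcases smul_eq_zero.mp hev with h' | h'
    · exact hce h'
    · exact ht h'
  · intro d' hd' hne
    by_cases hz : d'.erase j = 0
    · have hd'' : d' = Finsupp.single j (d' j) := by
        conv_lhs => rw [← Finsupp.single_add_erase j d', hz, add_zero]
      have hle : e ≤ d' j := by
        rw [he]
        apply Polynomial.natTrailingDegree_le_of_ne_zero
        rw [coeff_evalMain, ← hd'']
        exact MvPolynomial.mem_support_iff.mp hd'
      have hlt : e ≠ d' j := fun h' => hne (by rw [h']; exact hd'')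
      have e1 : (fun l => k0 l - d l + (t + e) * (Pi.single j 1 : ι → ℤ) l - (d' l : ℕ)) =
          fun l => k0 l - d l + (t + e - d' j) * (Pi.single j 1 : ι → ℤ) l := by
        funext l
        by_cases hl : l = j
        · subst hl; simp; ring
        · have : d' l = 0 := by rw [hd'']; simp [hl]
          simp [hl, this]
      rw [e1]
      have : D (fun l => k0 l - d l + (t + e - d' j) * (Pi.single j 1 : ι → ℤ) l) = 0 := by
        by_contra h'
        have := htmin _ h'
        omega
      rw [this, smul_zero]
    · have hpos : 0 < (d'.erase j).degree := by
        rw [Nat.pos_iff_ne_zero]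
        intro h'
        exact hz ((Finsupp.degree_eq_zero_iff _).mp h')
      have hnot := hgt ((d + d'.erase j).degree) (by rw [map_add, hd]; omega)
      have : D (fun l => k0 l - d l + (t + e) * (Pi.single j 1 : ι → ℤ) l - (d' l : ℕ)) = 0 := by
        by_contra h'
        refine hnot ⟨_, rfl, by simp [hdj], t + e - d' j, ?_⟩
        convert h' using 2
        funext l
        by_cases hl : l = j
        · subst hl; simp [hdj]; ring
        · simp [hl]; ring
      rw [this, smul_zero]
  · intro h'
    exact absurd (MvPolynomial.notMem_support_iff.mp h') hce

lemma act_X_injective (l : ι) (F : (ι → ℤ) → W) (h : act (MvPolynomial.X l) F = 0) :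
    F = 0 := by
  funext k
  have := congrFun h (k + Pi.single l 1)
  rw [act_X, add_sub_cancel_right] at this
  exact this

lemma act_X_pow_injective (l : ι) (e : ℕ) (F : (ι → ℤ) → W)
    (h : act (MvPolynomial.X l ^ e) F = 0) : F = 0 := by
  induction e with
  | zero => rwa [pow_zero, act_one] at h
  | succ e ih =>
    rw [pow_succ', act_mul] at h
    exact ih (act_X_injective l _ h)

lemma substPoly_substPoly_neg (α : ℂ) {i j : ι} (hij : i ≠ j) (P : MvPolynomial ι ℂ) :
    substPoly (-α) i j (substPoly α i j P) = P := by
  have : (substPoly (-α) i j).comp (substPoly α i j) = AlgHom.id ℂ _ := by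
    apply MvPolynomial.algHom_ext
    intro l
    by_cases hl : l = i
    · subst hl
      simp only [AlgHom.comp_apply, substPoly_X_self, map_add, map_mul, substPoly_C,
        substPoly_X_of_ne _ _ (Ne.symm hij), AlgHom.id_apply, map_neg]
      ring
    · simp [substPoly_X_of_ne _ _ hl]
  exact DFunLike.congr_fun this P

lemma substPoly_ne_zero (α : ℂ) {i j : ι} (hij : i ≠ j) {P : MvPolynomial ι ℂ} (hP : P ≠ 0) :
    substPoly α i j P ≠ 0 := by
  intro h
  apply hP
  rw [← substPoly_substPoly_neg α hij P, h, map_zero]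

lemma act_map {W' : Type*} [AddCommGroup W'] [Module ℂ W'] (φ : W →ₗ[ℂ] W')
    (P : MvPolynomial ι ℂ) (F : (ι → ℤ) → W) :
    act P (fun k => φ (F k)) = fun k => φ (act P F k) := by
  funext k
  rw [act_apply, act_apply, map_sum]
  simp

lemma subst_map {W' : Type*} [AddCommGroup W'] [Module ℂ W'] (φ : W →ₗ[ℂ] W')
    {c : ℤ → ℤ → ℂ} {i j : ι} {F : (ι → ℤ) → W} (hF : SubstDom c i j F) :
    subst c i j (fun k => φ (F k)) = fun k => φ (subst c i j F k) := by
  funext k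
  simp only [subst]
  rw [← LinearMap.toAddMonoidHom_coe, AddMonoidHom.map_finsum _ (hF.support _ _ _)]
  simp

end Cancel

lemma exists_X_pow_mul {q : MvPolynomial (Fin 2) ℂ} (hq : q ≠ 0) :
    ∃ (e : ℕ) (v : MvPolynomial (Fin 2) ℂ),
      q = MvPolynomial.X 0 ^ e * v ∧ evalMain 1 v ≠ 0 := by
  obtain ⟨e, v, hv, rfl⟩ := WfDvdMonoid.max_power_factor hq
    (MvPolynomial.X_prime (R := ℂ) (i := (0 : Fin 2))).irreducible
  refine ⟨e, v, rfl, fun h => hv ?_⟩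
  rw [MvPolynomial.X_dvd_iff_modMonomial_eq_zero]
  ext d
  rw [MvPolynomial.coeff_zero]
  by_cases hd : Finsupp.single 0 1 ≤ d
  · exact MvPolynomial.coeff_modMonomial_of_le _ hd
  · rw [MvPolynomial.coeff_modMonomial_of_not_le _ hd]
    have hd0 : d 0 = 0 := by
      by_contra h0
      exact hd (Finsupp.single_le_iff.mpr (by omega))
    have : d = Finsupp.single 1 (d 1) := by
      ext x
      fin_cases x
      · simpa using hd0
      · simp
    rw [this, ← coeff_evalMain, h, Polynomial.coeff_zero]

/-! ### Truncation conditions -/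

section Truncation

variable {ι : Type*}

/-- The family is lower truncated in each of the variables in `s`, uniformly. -/
def LauOn (s : Set ι) (F : (ι → ℤ) → W) : Prop :=
  ∃ N : ℤ, ∀ k : ι → ℤ, (∃ i ∈ s, k i < N) → F k = 0

lemma LauOn.act {s : Set ι} {F : (ι → ℤ) → W} (h : LauOn s F) (P : MvPolynomial ι ℂ) :
    LauOn s (act P F) := by
  obtain ⟨N, hN⟩ := h
  refine ⟨N, fun k ⟨i, hi, hk⟩ => ?_⟩
  rw [act_apply]
  refine Finset.sum_eq_zero fun d _ => ?_
  rw [hN _ ⟨i, hi, by omega⟩, smul_zero]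

lemma LauOn.add {s : Set ι} {F G : (ι → ℤ) → W} (hF : LauOn s F) (hG : LauOn s G) :
    LauOn s (F + G) := by
  obtain ⟨N, hN⟩ := hF
  obtain ⟨M, hM⟩ := hG
  refine ⟨min N M, fun k ⟨i, hi, hk⟩ => ?_⟩
  rw [Pi.add_apply, hN k ⟨i, hi, by omega⟩, hM k ⟨i, hi, by omega⟩, add_zero]

lemma LauOn.smul {s : Set ι} {F : (ι → ℤ) → W} (hF : LauOn s F) (a : ℂ) :
    LauOn s (a • F) := by
  obtain ⟨N, hN⟩ := hF
  refine ⟨N, fun k hk => ?_⟩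
  rw [Pi.smul_apply, hN k hk, smul_zero]

lemma LauOn.map {W' : Type*} [AddCommGroup W'] [Module ℂ W'] {s : Set ι} {F : (ι → ℤ) → W}
    (hF : LauOn s F) (φ : W →ₗ[ℂ] W') : LauOn s (fun k => φ (F k)) := by
  obtain ⟨N, hN⟩ := hF
  exact ⟨N, fun k hk => by simp only [hN k hk, map_zero]⟩

variable [DecidableEq ι]

lemma add_smul_quot_left {i j : ι} (hij : i ≠ j) (k : ι → ℤ) (n : ℤ) :
    (k + n • quot i j) i = k i + n := by
  simp [quot, hij]

lemma add_smul_quot_right {i j : ι} (hij : i ≠ j) (k : ι → ℤ) (n : ℤ) :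
    (k + n • quot i j) j = k j - n := by
  simp [quot, hij.symm]; ring

lemma add_smul_quot_of_ne {i j l : ι} (hi : l ≠ i) (hj : l ≠ j) (k : ι → ℤ) (n : ℤ) :
    (k + n • quot i j) l = k l := by
  simp [quot, hi, hj]

lemma LauOn.substDom {s : Set ι} {F : (ι → ℤ) → W} (h : LauOn s F) (c : ℤ → ℤ → ℂ)
    {i j : ι} (hij : i ≠ j) (hi : i ∈ s) (hj : j ∈ s) : SubstDom c i j F := by
  obtain ⟨N, hN⟩ := h
  intro k m
  refine (Set.finite_Icc (N - k i) (k j - N)).subset ?_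
  rintro n ⟨-, hn⟩
  constructor
  · by_contra hlt
    exact hn (hN _ ⟨i, hi, by rw [add_smul_quot_left hij]; omega⟩)
  · by_contra hlt
    exact hn (hN _ ⟨j, hj, by rw [add_smul_quot_right hij]; omega⟩)

lemma subst_expL_eq_zero {s : Set ι} {F : (ι → ℤ) → W} {N : ℤ}
    (hN : ∀ k : ι → ℤ, (∃ i ∈ s, k i < N) → F k = 0) (α : ℂ)
    {i j : ι} (hij : i ≠ j) (hi : i ∈ s) (hj : j ∈ s) {k : ι → ℤ}
    (hk : k i < 0 ∨ k i + k j < 2 * N ∨ ∃ l ∈ s, l ≠ i ∧ l ≠ j ∧ k l < N) :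
    subst (expL α) i j F k = 0 := by
  rw [subst]
  apply finsum_eq_zero_of_forall_eq_zero
  intro n
  rcases hk with h | h | ⟨l, hl, hli, hlj, h⟩
  · rw [expL, if_neg (by omega), zero_smul]
  · by_cases hn : k i + n < N
    · rw [hN _ ⟨i, hi, by rw [add_smul_quot_left hij]; exact hn⟩, smul_zero]
    · rw [hN _ ⟨j, hj, by rw [add_smul_quot_right hij]; omega⟩, smul_zero]
  · rw [hN _ ⟨l, hl, by rwa [add_smul_quot_of_ne hli hlj]⟩, smul_zero]

end Truncation

/-! ### Two-variable relation -/

/-- The family lies in `W((x₁))((x₀))`. -/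
def OutTrunc (B : (Fin 2 → ℤ) → W) : Prop :=
  (∃ N : ℤ, ∀ k, k 0 < N → B k = 0) ∧ ∀ m : ℤ, ∃ N : ℤ, ∀ k, k 0 ≤ m → k 1 < N → B k = 0

lemma OutTrunc.of_eq {B : (Fin 2 → ℤ) → W} (h1 : ∃ N : ℤ, ∀ k, k 0 < N → B k = 0)
    (h2 : ∀ m : ℤ, ∃ N : ℤ, ∀ k, k 0 = m → k 1 < N → B k = 0) : OutTrunc B := by
  refine ⟨h1, fun m => ?_⟩
  obtain ⟨N, hN⟩ := h1
  by_cases hm : m < N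
  · exact ⟨0, fun k hk _ => hN k (by omega)⟩
  obtain ⟨n, rfl⟩ : ∃ n : ℕ, m = N + n := ⟨(m - N).toNat, by omega⟩
  clear hm
  induction n with
  | zero =>
    obtain ⟨M, hM⟩ := h2 N
    refine ⟨M, fun k hk hk1 => ?_⟩
    by_cases h : k 0 = N
    · exact hM k h hk1
    · exact hN k (by simp at hk; omega)
  | succ n ih =>
    obtain ⟨M, hM⟩ := ih
    obtain ⟨M', hM'⟩ := h2 (N + (n + 1 : ℕ))
    refine ⟨min M M', fun k hk hk1 => ?_⟩
    by_cases h : k 0 = N + (n + 1 : ℕ)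
    · exact hM' k h (by omega)
    · exact hM k (by push_cast at *; omega) (by omega)

lemma OutTrunc.act {B : (Fin 2 → ℤ) → W} (h : OutTrunc B) (P : MvPolynomial (Fin 2) ℂ) :
    OutTrunc (act P B) := by
  obtain ⟨⟨N, hN⟩, h2⟩ := h
  refine ⟨⟨N, fun k hk => ?_⟩, fun m => ?_⟩
  · rw [act_apply]
    refine Finset.sum_eq_zero fun d _ => ?_
    rw [hN _ (by omega), smul_zero]
  · obtain ⟨M, hM⟩ := h2 m
    refine ⟨M, fun k hk hk' => ?_⟩
    rw [act_apply]
    refine Finset.sum_eq_zero fun d _ => ?_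
    rw [hM _ (by omega) (by omega), smul_zero]

lemma OutTrunc.add {B C : (Fin 2 → ℤ) → W} (hB : OutTrunc B) (hC : OutTrunc C) :
    OutTrunc (B + C) := by
  obtain ⟨⟨N, hN⟩, h2⟩ := hB
  obtain ⟨⟨M, hM⟩, h3⟩ := hC
  refine ⟨⟨min N M, fun k hk => ?_⟩, fun m => ?_⟩
  · rw [Pi.add_apply, hN _ (by omega), hM _ (by omega), add_zero]
  · obtain ⟨A, hA⟩ := h2 m
    obtain ⟨A', hA'⟩ := h3 m
    refine ⟨min A A', fun k hk hk' => ?_⟩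
    rw [Pi.add_apply, hA _ hk (by omega), hA' _ hk (by omega), add_zero]

lemma OutTrunc.smul {B : (Fin 2 → ℤ) → W} (hB : OutTrunc B) (a : ℂ) :
    OutTrunc (a • B) := by
  obtain ⟨⟨N, hN⟩, h2⟩ := hB
  refine ⟨⟨N, fun k hk => ?_⟩, fun m => ?_⟩
  · rw [Pi.smul_apply, hN _ hk, smul_zero]
  · obtain ⟨A, hA⟩ := h2 m
    exact ⟨A, fun k hk hk' => by rw [Pi.smul_apply, hA _ hk hk', smul_zero]⟩

lemma OutTrunc.map {W' : Type*} [AddCommGroup W'] [Module ℂ W'] {B : (Fin 2 → ℤ) → W}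
    (hB : OutTrunc B) (φ : W →ₗ[ℂ] W') : OutTrunc (fun k => φ (B k)) := by
  obtain ⟨⟨N, hN⟩, h2⟩ := hB
  refine ⟨⟨N, fun k hk => by simp only [hN _ hk, map_zero]⟩, fun m => ?_⟩
  obtain ⟨A, hA⟩ := h2 m
  exact ⟨A, fun k hk hk' => by simp only [hA _ hk hk', map_zero]⟩

lemma OutTrunc.eq_zero_of_act {D : (Fin 2 → ℤ) → W} (hD : OutTrunc D)
    {q : MvPolynomial (Fin 2) ℂ} (hq : q ≠ 0) (h : NVA.act q D = 0) : D = 0 := by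
  obtain ⟨e, v, rfl, hv⟩ := exists_X_pow_mul hq
  rw [act_mul] at h
  have h' := act_X_pow_injective 0 e _ h
  obtain ⟨⟨N, hN⟩, h2⟩ := hD
  refine eq_zero_of_act_eq_zero 1 D ?_ ?_ v hv h'
  · intro k
    refine ⟨(k 0 - N + 1).toNat, fun d hd hd1 t => hN _ ?_⟩
    have : d.degree = d 0 := by
      rw [Finsupp.degree_eq_sum, Fin.sum_univ_two, hd1, add_zero]
    simp
    omega
  · intro k
    obtain ⟨M, hM⟩ := h2 (k 0)
    refine ⟨M - k 1, fun t ht => hM _ ?_ ?_⟩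
    · simp
    · simp; omega

lemma OutTrunc.subst {F : (Fin 2 → ℤ) → W} (hF : LauOn Set.univ F) (α : ℂ) :
    OutTrunc (subst (expL α) 0 1 F) := by
  obtain ⟨N, hN⟩ := hF
  refine ⟨⟨0, fun k hk => ?_⟩, fun m => ⟨2 * N - m, fun k hk hk' => ?_⟩⟩
  · exact subst_expL_eq_zero hN α (by decide) trivial trivial (Or.inl hk)
  · exact subst_expL_eq_zero hN α (by decide) trivial trivial (Or.inr (Or.inl (by omega)))

/-- `B = F|_{x₀ ↦ x₀ + α x₁}` in the sense of quasi compatible products: after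
multiplication by a suitable nonzero polynomial, `F` becomes a Laurent series for which
this is a genuine substitution. -/
def Rel2 (α : ℂ) (F B : (Fin 2 → ℤ) → W) : Prop :=
  OutTrunc B ∧ ∃ p : MvPolynomial (Fin 2) ℂ, p ≠ 0 ∧ LauOn Set.univ (act p F) ∧
    act (substPoly α 0 1 p) B = subst (expL α) 0 1 (act p F)

lemma LauOn.subst_act {F : (Fin 2 → ℤ) → W} (h : LauOn Set.univ F) {α : ℂ} (hα : α ≠ 0)
    (V : MvPolynomial (Fin 2) ℂ) :
    subst (expL α) 0 1 (NVA.act V F) =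
      NVA.act (substPoly α 0 1 V) (subst (expL α) 0 1 F) :=
  NVA.subst_act (isExpansion_expL α hα) (show (0 : Fin 2) ≠ 1 by decide)
    (h.substDom _ (by decide) trivial trivial) V

lemma Rel2.of_mul {α : ℂ} (hα : α ≠ 0) {F B : (Fin 2 → ℤ) → W} {p : MvPolynomial (Fin 2) ℂ}
    (h1 : LauOn Set.univ (act p F))
    (h2 : act (substPoly α 0 1 p) B = subst (expL α) 0 1 (act p F))
    (q : MvPolynomial (Fin 2) ℂ) :
    LauOn Set.univ (act (q * p) F) ∧
      act (substPoly α 0 1 (q * p)) B = subst (expL α) 0 1 (act (q * p) F) := by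
  rw [act_mul]
  refine ⟨h1.act q, ?_⟩
  rw [map_mul, act_mul, h2, h1.subst_act hα]

lemma Rel2.unique {α : ℂ} (hα : α ≠ 0) {F B B' : (Fin 2 → ℤ) → W} (h : Rel2 α F B)
    (h' : Rel2 α F B') : B = B' := by
  obtain ⟨hB, p, hp, hL, hp'⟩ := h
  obtain ⟨hB', q, hq, hL', hq'⟩ := h'
  have e1 := (Rel2.of_mul hα hL hp' q).2
  have e2 := (Rel2.of_mul hα hL' hq' p).2
  rw [mul_comm p q, ← e1] at e2
  have h0 : B + (-1 : ℂ) • B' = 0 := by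
    refine (hB.add (hB'.smul _)).eq_zero_of_act
      (substPoly_ne_zero α (show (0 : Fin 2) ≠ 1 by decide) (mul_ne_zero hq hp)) ?_
    rw [act_add_right, act_smul_right, e2]
    simp
  rw [neg_one_smul, ← sub_eq_add_neg, sub_eq_zero] at h0
  exact h0

lemma Rel2.add {α : ℂ} (hα : α ≠ 0) {F B F' B' : (Fin 2 → ℤ) → W} (h : Rel2 α F B)
    (h' : Rel2 α F' B') : Rel2 α (F + F') (B + B') := by
  obtain ⟨hB, p, hp, hL, hp'⟩ := h
  obtain ⟨hB', q, hq, hL', hq'⟩ := h'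
  have e1 := Rel2.of_mul hα hL hp' q
  have e2 := Rel2.of_mul hα hL' hq' p
  rw [mul_comm p q] at e2
  refine ⟨hB.add hB', q * p, mul_ne_zero hq hp, ?_, ?_⟩
  · rw [act_add_right]; exact e1.1.add e2.1
  · rw [act_add_right, act_add_right, subst_add, e1.2, e2.2]
    · exact e1.1.substDom _ (by decide) trivial trivial
    · exact e2.1.substDom _ (by decide) trivial trivial

lemma Rel2.smul {α : ℂ} {F B : (Fin 2 → ℤ) → W} (h : Rel2 α F B) (a : ℂ) :
    Rel2 α (a • F) (a • B) := by
  obtain ⟨hB, p, hp, hL, hp'⟩ := h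
  refine ⟨hB.smul a, p, hp, ?_, ?_⟩
  · rw [act_smul_right]; exact hL.smul a
  · rw [act_smul_right, act_smul_right, subst_smul, hp']

lemma Rel2.act {α : ℂ} (hα : α ≠ 0) {F B : (Fin 2 → ℤ) → W} (h : Rel2 α F B)
    (V : MvPolynomial (Fin 2) ℂ) :
    Rel2 α (NVA.act V F) (NVA.act (substPoly α 0 1 V) B) := by
  obtain ⟨hB, p, hp, hL, hp'⟩ := h
  refine ⟨hB.act _, p, hp, ?_, ?_⟩
  · rw [← act_mul, mul_comm, act_mul]; exact hL.act V
  · rw [act_comm, hp', act_comm p V, hL.subst_act hα]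

lemma Rel2.map {W' : Type*} [AddCommGroup W'] [Module ℂ W'] {α : ℂ}
    {F B : (Fin 2 → ℤ) → W} (h : Rel2 α F B) (φ : W →ₗ[ℂ] W') :
    Rel2 α (fun k => φ (F k)) (fun k => φ (B k)) := by
  obtain ⟨hB, p, hp, hL, hp'⟩ := h
  refine ⟨hB.map φ, p, hp, ?_, ?_⟩
  · rw [act_map]; exact hL.map φ
  · rw [act_map, act_map, subst_map _ (hL.substDom _ (by decide) trivial trivial), hp']

lemma Rel2.of_lauOn {α : ℂ} {F : (Fin 2 → ℤ) → W} (h : LauOn Set.univ F) :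
    Rel2 α F (subst (expL α) 0 1 F) := by
  refine ⟨OutTrunc.subst h α, 1, one_ne_zero, ?_, ?_⟩
  · rwa [act_one]
  · rw [map_one, act_one, act_one]

/-! ### Two-variable slices -/

section Slice

variable {ι : Type*} [DecidableEq ι]

/-- The restriction of a family to the variables `i, j`. -/
def slice (i j : ι) (k : ι → ℤ) (F : (ι → ℤ) → W) (s : Fin 2 → ℤ) : W :=
  F (Function.update (Function.update k i (s 0)) j (s 1))

variable {i j : ι}

lemma slice_act_X_left (hij : i ≠ j) (k : ι → ℤ) (F : (ι → ℤ) → W) :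
    slice i j k (act (MvPolynomial.X i) F) = act (MvPolynomial.X 0) (slice i j k F) := by
  funext s
  rw [act_X, slice, slice, act_X]
  congr 1
  funext l
  by_cases hj : l = j
  · subst hj; simp [hij]
  · by_cases hi : l = i
    · subst hi; simp [hij]
    · simp [hi, hj]

lemma slice_act_X_right (hij : i ≠ j) (k : ι → ℤ) (F : (ι → ℤ) → W) :
    slice i j k (act (MvPolynomial.X j) F) = act (MvPolynomial.X 1) (slice i j k F) := by
  funext s
  rw [act_X, slice, slice, act_X]
  congr 1
  funext l
  by_cases hj : l = j
  · subst hj; simp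
  · by_cases hi : l = i
    · subst hi; simp [hij]
    · simp [hi, hj]

lemma slice_act_X_of_ne {l : ι} (hi : l ≠ i) (hj : l ≠ j) (k : ι → ℤ) (F : (ι → ℤ) → W) :
    slice i j k (act (MvPolynomial.X l) F) = slice i j (k - Pi.single l 1) F := by
  funext s
  rw [slice, slice, act_X]
  congr 1
  funext m
  by_cases h1 : m = j
  · subst h1; simp [Ne.symm hj]
  · by_cases h2 : m = i
    · subst h2; simp [Ne.symm hi, h1]
    · simp [h1, h2]

lemma slice_subst (hij : i ≠ j) (c : ℤ → ℤ → ℂ) (k : ι → ℤ) (F : (ι → ℤ) → W) :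
    slice i j k (subst c i j F) = subst c 0 1 (slice i j k F) := by
  funext s
  simp only [slice, subst]
  congr 1
  funext n
  have e1 : Function.update (Function.update k i (s 0)) j (s 1) i = s 0 := by simp [hij]
  rw [e1]
  congr 2
  funext l
  by_cases hj : l = j
  · subst hj; simp [quot, hij.symm]
  · by_cases hi : l = i
    · subst hi; simp [quot, hij]
    · simp [quot, hi, hj]

lemma slice_self (k : ι → ℤ) (F : (ι → ℤ) → W) :
    slice i j k F ![k i, k j] = F k := by
  simp [slice]

/-- Slicewise version of `Rel2`. -/
def Rel (α : ℂ) (i j : ι) (F B : (ι → ℤ) → W) : Prop :=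
  ∀ k, Rel2 α (slice i j k F) (slice i j k B)

lemma Rel.unique {α : ℂ} (hα : α ≠ 0) {F B B' : (ι → ℤ) → W} (h : Rel α i j F B)
    (h' : Rel α i j F B') : B = B' := by
  funext k
  rw [← slice_self (i := i) (j := j) k B, Rel2.unique hα (h k) (h' k), slice_self]

lemma Rel.act {α : ℂ} (hα : α ≠ 0) (hij : i ≠ j) {F B : (ι → ℤ) → W} (h : Rel α i j F B)
    (V : MvPolynomial ι ℂ) :
    Rel α i j (NVA.act V F) (NVA.act (substPoly α i j V) B) := by
  induction V using MvPolynomial.induction_on generalizing F B with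
  | C a =>
    rw [substPoly_C, act_C, act_C]
    exact fun k => (h k).smul a
  | add p q hp hq =>
    rw [map_add, act_add, act_add]
    exact fun k => (hp h k).add hα (hq h k)
  | mul_X p l hp =>
    rw [map_mul, act_mul, act_mul]
    refine hp fun k => ?_
    by_cases hi : l = i
    · subst hi
      have := (h k).act hα (MvPolynomial.X 0)
      rw [substPoly_X_self, act_add, act_mul, act_C] at this
      rw [substPoly_X_self, act_add, act_mul, act_C, slice_act_X_left hij]
      convert this using 1
      rw [← slice_act_X_left hij, ← slice_act_X_right hij]
      rfl
    · rw [substPoly_X_of_ne _ _ hi]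
      by_cases hj : l = j
      · subst hj
        have := (h k).act hα (MvPolynomial.X 1)
        rw [substPoly_X_of_ne _ _ (by decide)] at this
        rwa [slice_act_X_right hij, slice_act_X_right hij]
      · rw [slice_act_X_of_ne hi hj, slice_act_X_of_ne hi hj]
        exact h _

lemma LauOn.slice {s : Set ι} {F : (ι → ℤ) → W} (h : LauOn s F) (hij : i ≠ j)
    (hi : i ∈ s) (hj : j ∈ s) (k : ι → ℤ) : LauOn Set.univ (slice i j k F) := by
  obtain ⟨N, hN⟩ := h
  refine ⟨N, ?_⟩
  rintro t ⟨l, -, hl⟩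
  fin_cases l
  · exact hN _ ⟨i, hi, by simpa [hij] using hl⟩
  · exact hN _ ⟨j, hj, by simpa using hl⟩

lemma Rel.eq_subst {α : ℂ} (hα : α ≠ 0) (hij : i ≠ j) {F B : (ι → ℤ) → W}
    (h : Rel α i j F B) {s : Set ι} (hF : LauOn s F) (hi : i ∈ s) (hj : j ∈ s) :
    B = subst (expL α) i j F := by
  refine Rel.unique hα h fun k => ?_
  rw [slice_subst hij]
  exact Rel2.of_lauOn (hF.slice hij hi hj k)

end Slice

/-! ### Multiplication by iterated Laurent series -/

/-- Multiplication of a family, seen as a series, by an element of `ℂ((x₁))((x₀))`. -/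
def conv (Q : K2) (G : (Fin 2 → ℤ) → W) (k : Fin 2 → ℤ) : W :=
  ∑ᶠ s : ℤ × ℤ, ((Q.coeff s.1).coeff s.2) • G ![k 0 - s.1, k 1 - s.2]

lemma outTrunc_coeff (Q : K2) : OutTrunc (fun k : Fin 2 → ℤ => (Q.coeff (k 0)).coeff (k 1)) := by
  refine OutTrunc.of_eq ⟨Q.order, fun k hk => ?_⟩ fun m => ⟨(Q.coeff m).order, ?_⟩
  · simp [HahnSeries.coeff_eq_zero_of_lt_order hk]
  · rintro k rfl hk
    exact HahnSeries.coeff_eq_zero_of_lt_order hk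

lemma conv_support {G : (Fin 2 → ℤ) → W} (hG : OutTrunc G) (Q : K2) (k : Fin 2 → ℤ) :
    (Function.support fun s : ℤ × ℤ =>
      ((Q.coeff s.1).coeff s.2) • G ![k 0 - s.1, k 1 - s.2]).Finite := by
  obtain ⟨⟨o, ho⟩, h⟩ := outTrunc_coeff Q
  obtain ⟨⟨N, hN⟩, h'⟩ := hG
  obtain ⟨o', ho'⟩ := h (k 0 - N)
  obtain ⟨N', hN'⟩ := h' (k 0 - o)
  refine ((Set.finite_Icc o (k 0 - N)).prod (Set.finite_Icc o' (k 1 - N'))).subset ?_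
  rintro ⟨s, t⟩ hs
  rw [Function.mem_support] at hs
  have hq : (Q.coeff s).coeff t ≠ 0 := fun h => hs (by simp [h])
  have hg : G ![k 0 - s, k 1 - t] ≠ 0 := fun h => hs (by simp [h])
  have h1 : o ≤ s := by
    by_contra hlt
    exact hq (ho ![s, t] (by simp; omega))
  have h2 : N ≤ k 0 - s := by
    by_contra hlt
    exact hg (hN _ (by simp; omega))
  have h3 : o' ≤ t := by
    by_contra hlt
    exact hq (ho' ![s, t] (by simp; omega) (by simp; omega))
  have h4 : N' ≤ k 1 - t := by
    by_contra hlt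
    exact hg (hN' _ (by simp; omega) (by simp; omega))
  simp only [Set.mem_prod, Set.mem_Icc]
  omega

lemma conv_eq_zero {G : (Fin 2 → ℤ) → W} {N : ℤ} (hN : ∀ k, k 0 < N → G k = 0) {Q : K2}
    {k : Fin 2 → ℤ} (hk : k 0 < Q.order + N) : conv Q G k = 0 := by
  apply finsum_eq_zero_of_forall_eq_zero
  intro s
  by_cases h : s.1 < Q.order
  · simp [HahnSeries.coeff_eq_zero_of_lt_order h]
  · rw [hN _ (by simp; omega), smul_zero]

lemma OutTrunc.conv {G : (Fin 2 → ℤ) → W} (hG : OutTrunc G) (Q : K2) :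
    OutTrunc (conv Q G) := by
  obtain ⟨⟨o, ho⟩, h⟩ := outTrunc_coeff Q
  obtain ⟨⟨N, hN⟩, h'⟩ := hG
  refine ⟨⟨_, fun k hk => conv_eq_zero hN hk⟩, fun m => ?_⟩
  obtain ⟨o', ho'⟩ := h (m - N)
  obtain ⟨N', hN'⟩ := h' (m - o)
  refine ⟨o' + N', fun k hk hk' => finsum_eq_zero_of_forall_eq_zero fun s => ?_⟩
  by_cases h1 : s.1 < o
  · have := ho ![s.1, s.2] (by simpa using h1)
    simp at this
    rw [this, zero_smul]
  by_cases h2 : k 0 - s.1 < N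
  · rw [hN _ (by simpa using h2), smul_zero]
  by_cases h3 : s.2 < o'
  · have := ho' ![s.1, s.2] (by simp; omega) (by simpa using h3)
    simp at this
    rw [this, zero_smul]
  · rw [hN' _ (by simp; omega) (by simp; omega), smul_zero]

lemma conv_add {G : (Fin 2 → ℤ) → W} (hG : OutTrunc G) (Q R : K2) :
    conv (Q + R) G = conv Q G + conv R G := by
  funext k
  simp only [conv, Pi.add_apply, HahnSeries.coeff_add, add_smul]
  exact finsum_add_distrib (conv_support hG Q k) (conv_support hG R k)

lemma conv_one (G : (Fin 2 → ℤ) → W) : conv 1 G = G := by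
  funext k
  rw [conv, finsum_eq_single _ (0, 0)]
  · simp only [HahnSeries.coeff_one, if_true, one_smul, sub_zero]
    congr 1
    funext l
    fin_cases l <;> rfl
  · rintro ⟨s, t⟩ h
    by_cases hs : s = 0
    · have ht : t ≠ 0 := fun ht => h (by rw [hs, ht])
      simp [HahnSeries.coeff_one, hs, ht]
    · simp [HahnSeries.coeff_one, hs]

lemma conv_zero (G : (Fin 2 → ℤ) → W) : conv 0 G = 0 := by
  funext k
  simp [conv]

lemma conv_xOuter_mul (Q : K2) (G : (Fin 2 → ℤ) → W) :
    conv (xOuter * Q) G = act (MvPolynomial.X 0) (conv Q G) := by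
  funext k
  rw [act_X, conv, conv, ← finsum_comp_equiv ((Equiv.addRight (1 : ℤ)).prodCongr (Equiv.refl ℤ))]
  congr 1
  funext s
  simp only [xOuter, Equiv.prodCongr_apply, Prod.map, Equiv.coe_addRight, Equiv.refl_apply,
    HahnSeries.coeff_single_mul, one_mul, add_sub_cancel_right]
  congr 2
  funext l
  fin_cases l
  · simp; ring
  · simp

lemma conv_xInnerC_mul (c : ℂ) (Q : K2) (G : (Fin 2 → ℤ) → W) :
    conv (xInnerC c * Q) G = c • act (MvPolynomial.X 1) (conv Q G) := by
  funext k
  rw [Pi.smul_apply, act_X, conv, conv,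
    ← finsum_comp_equiv ((Equiv.refl ℤ).prodCongr (Equiv.addRight (1 : ℤ))), smul_finsum]
  congr 1
  funext s
  simp only [xInnerC, Equiv.prodCongr_apply, Prod.map, Equiv.coe_addRight, Equiv.refl_apply,
    HahnSeries.coeff_single_mul, sub_zero, add_sub_cancel_right, mul_smul]
  congr 3
  funext l
  fin_cases l
  · simp
  · simp; ring

lemma K2.add_mul (a b c : K2) : (a + b) * c = a * c + b * c :=
  (inferInstance : CommRing K2).right_distrib a b c

lemma K2.mul_assoc (a b c : K2) : a * b * c = a * (b * c) :=
  (inferInstance : CommRing K2).mul_assoc a b c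

lemma K2.zero_mul (a : K2) : 0 * a = 0 :=
  MulZeroClass.zero_mul a

lemma K2.mul_inv_cancel {a : K2} (h : a ≠ 0) : a * a⁻¹ = 1 :=
  (inferInstance : Field K2).mul_inv_cancel a h

lemma qK_C (c α : ℂ) : qK (MvPolynomial.C c) α = HahnSeries.single 0 (HahnSeries.single 0 c) := by
  rw [qK, MvPolynomial.aeval_C]
  have h1 : HahnSeries.ofPowerSeries ℤ LC
      (PowerSeries.C (HahnSeries.ofPowerSeries ℤ ℂ (PowerSeries.C c))) =
        HahnSeries.single 0 (HahnSeries.single 0 c) := by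
    rw [HahnSeries.ofPowerSeries_C, HahnSeries.ofPowerSeries_C, HahnSeries.C_apply,
      HahnSeries.C_apply]
  have h2 : (algebraMap ℂ (PowerSeries LC)) c =
      PowerSeries.C (HahnSeries.ofPowerSeries ℤ ℂ (PowerSeries.C c)) := by
    rw [MvPowerSeries.algebraMap_apply]
    rfl
  rw [← h1, ← h2]
  rfl

lemma qK_add (p q : MvPolynomial (Fin 2) ℂ) (α : ℂ) : qK (p + q) α = qK p α + qK q α := by
  rw [qK, map_add]; rfl

lemma qK_mul (p q : MvPolynomial (Fin 2) ℂ) (α : ℂ) : qK (p * q) α = qK p α * qK q α := by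
  rw [qK, map_mul]; rfl

lemma qK_X_zero (α : ℂ) : qK (MvPolynomial.X 0) α = xOuter + xInnerC α := by
  rw [qK, MvPolynomial.aeval_X]; rfl

lemma qK_X_one (α : ℂ) : qK (MvPolynomial.X 1) α = xInnerC 1 := by
  rw [qK, MvPolynomial.aeval_X]; rfl

lemma conv_qK_C_mul (c α : ℂ) (Q : K2) (G : (Fin 2 → ℤ) → W) :
    conv (qK (MvPolynomial.C c) α * Q) G = c • conv Q G := by
  funext k
  rw [Pi.smul_apply, conv, conv, smul_finsum, qK_C]
  congr 1
  funext s
  rw [HahnSeries.coeff_single_mul, HahnSeries.coeff_single_mul, sub_zero, sub_zero, mul_smul]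

lemma conv_qK_mul {G : (Fin 2 → ℤ) → W} (hG : OutTrunc G) (α : ℂ)
    (p : MvPolynomial (Fin 2) ℂ) (Q : K2) :
    conv (qK p α * Q) G = act (substPoly α 0 1 p) (conv Q G) := by
  induction p using MvPolynomial.induction_on generalizing Q with
  | C a => rw [substPoly_C, act_C, conv_qK_C_mul]
  | add p q hp hq => rw [qK_add, map_add, K2.add_mul, act_add, conv_add hG, hp, hq]
  | mul_X p l hp =>
    rw [qK_mul, map_mul, K2.mul_assoc, hp, act_mul]
    congr 1
    fin_cases l
    · change conv (qK (MvPolynomial.X 0) α * Q) G =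
        act (substPoly α 0 1 (MvPolynomial.X 0)) (conv Q G)
      rw [substPoly_X_self, qK_X_zero, K2.add_mul, conv_add hG, conv_xOuter_mul,
        conv_xInnerC_mul, act_add, act_mul, act_C]
    · change conv (qK (MvPolynomial.X 1) α * Q) G =
        act (substPoly α 0 1 (MvPolynomial.X 1)) (conv Q G)
      rw [substPoly_X_of_ne _ _ (by decide), qK_X_one, conv_xInnerC_mul, one_smul]

lemma qK_ne_zero {p : MvPolynomial (Fin 2) ℂ} (hp : p ≠ 0) (α : ℂ) : qK p α ≠ 0 := by
  intro h
  let δ : (Fin 2 → ℤ) → ℂ := fun k => if k = 0 then 1 else 0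
  have hδ : OutTrunc δ := by
    refine ⟨⟨0, fun k hk => if_neg ?_⟩, fun m => ⟨0, fun k _ hk => if_neg ?_⟩⟩ <;>
    · rintro rfl
      simp at hk
  have h1 := conv_qK_mul hδ α p 1
  rw [h, K2.zero_mul, conv_zero, conv_one] at h1
  have h2 := hδ.eq_zero_of_act (substPoly_ne_zero α (show (0 : Fin 2) ≠ 1 by decide) hp) h1.symm
  have h3 := congrFun h2 0
  simp [δ] at h3

/-! ### The products on quasi compatible pairs -/

/-- The family of coefficients of `a(x₀) b(x₁) w`. -/
def pairFam (a b : EW W) (w : W) (k : Fin 2 → ℤ) : W :=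
  mf a (mf b w (-(k 1) - 1)) (-(k 0) - 1)

/-- The family of coefficients of `(Y^{(α)}(a(x₁), x₀) b(x₁)) w`. -/
def prodFam (α : ℂˣ) (a b : EW W) (w : W) (k : Fin 2 → ℤ) : W :=
  mf (YEa α a b (-(k 0) - 1)) w (-(k 1) - 1)

lemma mf_add (a : EW W) (w w' : W) (n : ℤ) : mf a (w + w') n = mf a w n + mf a w' n := by
  simp [mf]

lemma mf_smul (a : EW W) (c : ℂ) (w : W) (n : ℤ) : mf a (c • w) n = c • mf a w n := by
  simp [mf]

lemma mf_zero (a : EW W) (n : ℤ) : mf a 0 n = 0 := by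
  simp [mf]

lemma mf_add_left (a b : EW W) (w : W) (n : ℤ) : mf (a + b) w n = mf a w n + mf b w n := rfl

lemma mf_smul_left (c : ℂ) (a : EW W) (w : W) (n : ℤ) : mf (c • a) w n = c • mf a w n := rfl

lemma mf_zero_left (w : W) (n : ℤ) : mf (0 : EW W) w n = 0 := rfl

lemma EW.ext {a b : EW W} (h : ∀ w n, mf a w n = mf b w n) : a = b := by
  apply Subtype.ext
  apply LinearMap.ext
  intro w
  funext n
  exact h w n

/-- A mode as a linear endomorphism. -/
def modeL (a : EW W) (n : ℤ) : W →ₗ[ℂ] W where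
  toFun w := mf a w n
  map_add' w w' := mf_add a w w' n
  map_smul' c w := mf_smul a c w n

lemma mulPoly_eq_act (p : MvPolynomial (Fin 2) ℂ) (a b : EW W) (w : W) (m t : ℤ) :
    mulPoly p (Fab a b w) m t = act p (pairFam a b w) ![m, t] := by
  rw [act_apply]
  rfl

lemma qcPair_iff (a b : EW W) : QCPair a b ↔ ∃ p : MvPolynomial (Fin 2) ℂ, p ≠ 0 ∧
    ∀ w, LauOn Set.univ (act p (pairFam a b w)) := by
  refine exists_congr fun p => and_congr_right fun _ => forall_congr' fun w =>
    exists_congr fun N => ⟨fun h k => ?_, fun h m t hmt => ?_⟩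
  · rintro ⟨l, -, hl⟩
    have e : k = ![k 0, k 1] := by funext l; fin_cases l <;> rfl
    rw [e, ← mulPoly_eq_act]
    apply h
    fin_cases l
    · exact Or.inl hl
    · exact Or.inr hl
  · rw [mulPoly_eq_act]
    apply h
    rcases hmt with h | h
    · exact ⟨0, trivial, h⟩
    · exact ⟨1, trivial, h⟩

lemma substYE_eq (α : ℂ) (p : MvPolynomial (Fin 2) ℂ) (a b : EW W) (w : W) (j : ℕ) (t : ℤ) :
    substYE α p a b w j t = subst (expL α) 0 1 (act p (pairFam a b w)) ![j, t] := by
  rw [substYE, subst, ← finsum_comp_equiv (Equiv.addLeft (j : ℤ))]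
  congr 1
  funext n
  have e : ![(j : ℤ), t] 0 = j := rfl
  rw [e, expL, if_pos (by omega), Int.toNat_natCast]
  simp only [Equiv.coe_addLeft, mulPoly_eq_act]
  congr 2
  funext l
  fin_cases l
  · simp [quot]
  · simp [quot]; ring

lemma fullYE_eq (α : ℂ) (p : MvPolynomial (Fin 2) ℂ) (a b : EW W) (w : W) (J T : ℤ) :
    fullYE α p a b w J T =
      conv (qInv p α) (subst (expL α) 0 1 (act p (pairFam a b w))) ![J, T] := by
  rw [fullYE, conv]
  congr 1
  funext s
  congr 1
  split_ifs with h
  · rw [substYE_eq]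
    congr 2
    exact Int.toNat_of_nonneg h
  · rw [subst, finsum_eq_zero_of_forall_eq_zero]
    intro n
    rw [expL, if_neg (by exact h), zero_smul]

lemma rel2_conv {α : ℂ} (p : MvPolynomial (Fin 2) ℂ) (hp : p ≠ 0)
    {F : (Fin 2 → ℤ) → W} (hF : LauOn Set.univ (act p F)) :
    Rel2 α F (conv (qInv p α) (subst (expL α) 0 1 (act p F))) := by
  have hG := OutTrunc.subst hF α
  refine ⟨hG.conv _, p, hp, hF, ?_⟩
  rw [← conv_qK_mul hG, qInv, K2.mul_inv_cancel (qK_ne_zero hp α), conv_one]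

lemma pairFam_add (a b : EW W) (w w' : W) :
    pairFam a b (w + w') = pairFam a b w + pairFam a b w' := by
  funext k
  simp [pairFam, mf_add]

lemma pairFam_smul (a b : EW W) (c : ℂ) (w : W) :
    pairFam a b (c • w) = c • pairFam a b w := by
  funext k
  simp [pairFam, mf_smul]

lemma mf_YEa {a b : EW W} (h : QCPair a b) (α : ℂˣ) (n : ℤ) (w : W) (m : ℤ) :
    mf (YEa α a b n) w m = conv (qInv h.choose α)
      (subst (expL α) 0 1 (act h.choose (pairFam a b w))) ![-n - 1, -m - 1] := by
  have hα := α.ne_zero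
  have hp := h.choose_spec.1
  have hL : ∀ w, LauOn Set.univ (act h.choose (pairFam a b w)) := by
    intro w
    obtain ⟨N, hN⟩ := h.choose_spec.2 w
    refine ⟨N, fun k ⟨l, _, hl⟩ => ?_⟩
    have e : k = ![k 0, k 1] := by funext l; fin_cases l <;> rfl
    rw [e, ← mulPoly_eq_act]
    apply hN
    fin_cases l
    · exact Or.inl hl
    · exact Or.inr hl
  set B : W → (Fin 2 → ℤ) → W := fun w =>
    conv (qInv h.choose α) (subst (expL α) 0 1 (act h.choose (pairFam a b w))) with hB
  have hR : ∀ w, Rel2 (α : ℂ) (pairFam a b w) (B w) := fun w => rel2_conv _ hp (hL w)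
  have hadd : ∀ w w', B (w + w') = B w + B w' := fun w w' =>
    (hR (w + w')).unique hα (by rw [pairFam_add]; exact (hR w).add hα (hR w'))
  have hsmul : ∀ (c : ℂ) w, B (c • w) = c • B w := fun c w =>
    (hR (c • w)).unique hα (by rw [pairFam_smul]; exact (hR w).smul c)
  have hraw : ∀ w m, rawYE (α : ℂ) a b n w m = B w ![-n - 1, -m - 1] := by
    intro w m
    rw [rawYE, dif_pos h, fullYE_eq]
  have hex : ∃ c : EW W, ∀ w m, mf c w m = rawYE (α : ℂ) a b n w m := by
    refine ⟨⟨{ toFun := fun w m => B w ![-n - 1, -m - 1]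
               map_add' := fun w w' => by funext m; simp [hadd]
               map_smul' := fun c w => by funext m; simp [hsmul] }, fun w => ?_⟩,
      fun w m => (hraw w m).symm⟩
    obtain ⟨N, hN⟩ := (hR w).1.2 (-n - 1)
    refine ⟨-N, fun m hm => hN _ ?_ ?_⟩
    · simp
    · simp; omega
  rw [YEa, dif_pos hex, hex.choose_spec, hraw]

lemma rel2_prodFam {a b : EW W} (h : QCPair a b) (α : ℂˣ) (w : W) :
    Rel2 (α : ℂ) (pairFam a b w) (prodFam α a b w) := by
  have hL : LauOn Set.univ (act h.choose (pairFam a b w)) := by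
    obtain ⟨N, hN⟩ := h.choose_spec.2 w
    refine ⟨N, fun k ⟨l, _, hl⟩ => ?_⟩
    have e : k = ![k 0, k 1] := by funext l; fin_cases l <;> rfl
    rw [e, ← mulPoly_eq_act]
    apply hN
    fin_cases l
    · exact Or.inl hl
    · exact Or.inr hl
  have e : prodFam α a b w = conv (qInv h.choose α)
      (subst (expL α) 0 1 (act h.choose (pairFam a b w))) := by
    funext k
    rw [prodFam, mf_YEa h]
    congr 1
    funext l
    fin_cases l
    · simp
    · simp
  rw [e]
  exact rel2_conv _ h.choose_spec.1 hL

lemma YEa_eq_zero {a b : EW W} (h : QCPair a b) (α : ℂˣ) :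
    ∃ N : ℤ, ∀ n, N ≤ n → YEa α a b n = 0 := by
  refine ⟨-(qInv h.choose α).order, fun n hn => EW.ext fun w m => ?_⟩
  rw [mf_YEa h, mf_zero_left]
  refine conv_eq_zero (N := 0) (fun k hk => ?_) (by simp; omega)
  rw [subst]
  refine finsum_eq_zero_of_forall_eq_zero fun n => ?_
  rw [expL, if_neg (by omega), zero_smul]

/-! ### Quasi compatibility of lists with named variables -/

/-- The operator coefficient of `a⁽¹⁾(x_{i₁}) ⋯ a⁽ʳ⁾(x_{i_r})`. -/
def opL : List (ℕ × EW W) → (ℕ → ℤ) → W →ₗ[ℂ] W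
  | [], _ => LinearMap.id
  | x :: L, k => modeL x.2 (-(k x.1) - 1) ∘ₗ opL L k

lemma opL_append (L₁ L₂ : List (ℕ × EW W)) (k : ℕ → ℤ) (w : W) :
    opL (L₁ ++ L₂) k w = opL L₁ k (opL L₂ k w) := by
  induction L₁ with
  | nil => rfl
  | cons x L ih => simp only [List.cons_append, opL, LinearMap.comp_apply, ih]

lemma opL_cons (x : ℕ × EW W) (L : List (ℕ × EW W)) (k : ℕ → ℤ) (w : W) :
    opL (x :: L) k w = mf x.2 (opL L k w) (-(k x.1) - 1) := rfl

lemma opL_congr {L : List (ℕ × EW W)} {k k' : ℕ → ℤ}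
    (h : ∀ x ∈ L, k x.1 = k' x.1) : opL L k = opL L k' := by
  induction L with
  | nil => rfl
  | cons x L ih =>
    rw [opL, opL, ih fun y hy => h y (List.mem_cons_of_mem _ hy), h x List.mem_cons_self]

/-- The polynomial `p(x_i, x_j)`. -/
def pairR (p : MvPolynomial (Fin 2) ℂ) (i j : ℕ) : MvPolynomial ℕ ℂ :=
  MvPolynomial.rename ![i, j] p

/-- The product of `p(x_i, x_j)` over `i` preceding `j` in the list. -/
def ppL (p : MvPolynomial (Fin 2) ℂ) : List ℕ → MvPolynomial ℕ ℂ
  | [] => 1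
  | i :: l => (l.map (pairR p i)).prod * ppL p l

/-- Quasi compatibility of the sequence of entries of a list with named variables. -/
def LQC (L : List (ℕ × EW W)) : Prop :=
  ∃ p : MvPolynomial (Fin 2) ℂ, p ≠ 0 ∧
    ∀ w, LauOn {i | i ∈ L.map Prod.fst} (act (ppL p (L.map Prod.fst)) fun k => opL L k w)

lemma ppL_mul (p q : MvPolynomial (Fin 2) ℂ) (l : List ℕ) :
    ppL (p * q) l = ppL p l * ppL q l := by
  induction l with
  | nil => simp [ppL]
  | cons i l ih =>
    have : pairR (p * q) i = fun j => pairR p i j * pairR q i j := by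
      funext j; simp [pairR]
    rw [ppL, ppL, ppL, ih, this, List.prod_map_mul]
    ring

lemma ppL_pow (p : MvPolynomial (Fin 2) ℂ) (n : ℕ) (l : List ℕ) :
    ppL (p ^ n) l = ppL p l ^ n := by
  induction n with
  | zero =>
    rw [pow_zero, pow_zero]
    induction l with
    | nil => rfl
    | cons i l ih =>
      have : pairR 1 i = fun _ => 1 := by
        funext j
        simp [pairR]
      simp [ppL, ih, this]
  | succ n ih => rw [pow_succ, pow_succ, ppL_mul, ih]

lemma ppL_insert (p : MvPolynomial (Fin 2) ℂ) (l₁ l₂ : List ℕ) (j : ℕ) :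
    ppL p (l₁ ++ j :: l₂) =
      ppL p (l₁ ++ l₂) * ((l₁.map fun l => pairR p l j).prod * (l₂.map (pairR p j)).prod) := by
  induction l₁ with
  | nil => simp only [List.nil_append, ppL, List.map_nil, List.prod_nil]; ring
  | cons i l ih =>
    simp only [List.cons_append, ppL, ih, List.map_append, List.map_cons, List.prod_append,
      List.prod_cons]
    ring

lemma pairPoly_succ (p : MvPolynomial (Fin 2) ℂ) (r : ℕ) :
    pairPoly p (r + 1) = (∏ j : Fin r, MvPolynomial.rename ![0, j.succ] p) *
      MvPolynomial.rename Fin.succ (pairPoly p r) := by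
  simp only [pairPoly, Finset.prod_filter, ← Finset.univ_product_univ, Finset.prod_product]
  rw [Fin.prod_univ_succ, Fin.prod_univ_succ]
  simp only [lt_self_iff_false, if_false, one_mul, Fin.succ_pos, if_true, map_prod]
  congr 1
  refine Finset.prod_congr rfl fun i _ => ?_
  rw [Fin.prod_univ_succ]
  simp only [Fin.not_lt_zero, if_false, one_mul, Fin.succ_lt_succ_iff]
  refine Finset.prod_congr rfl fun j _ => ?_
  split_ifs
  · rw [MvPolynomial.rename_rename]
    congr 1
    congr 1
    funext l
    fin_cases l <;> rfl
  · simp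

lemma ppL_ofFn (p : MvPolynomial (Fin 2) ℂ) {r : ℕ} (σ : Fin r → ℕ) :
    ppL p (List.ofFn σ) = MvPolynomial.rename σ (pairPoly p r) := by
  induction r with
  | zero => simp [ppL, pairPoly]
  | succ r ih =>
    rw [List.ofFn_succ, ppL, ih, pairPoly_succ, map_mul, map_prod, MvPolynomial.rename_rename,
      List.map_ofFn, List.prod_ofFn]
    congr 1
    refine Finset.prod_congr rfl fun j _ => ?_
    rw [MvPolynomial.rename_rename, Function.comp_apply, pairR]
    congr 1
    congr 1
    funext l
    fin_cases l <;> rfl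

lemma opL_ofFn {r : ℕ} (σ : Fin r → ℕ) (ψ : Fin r → EW W) (k : ℕ → ℤ) (w : W) :
    opL (List.ofFn fun i => (σ i, ψ i)) k w = seqCoeff ψ w (k ∘ σ) := by
  induction r with
  | zero => rfl
  | succ r ih =>
    rw [List.ofFn_succ, opL_cons, ih]
    rfl

lemma qcSeq_iff {r : ℕ} (σ : Fin r → ℕ) (hσ : Function.Injective σ) (ψ : Fin r → EW W) :
    QCSeq ψ ↔ LQC (List.ofFn fun i => (σ i, ψ i)) := by
  have hn : (List.ofFn fun i => (σ i, ψ i)).map Prod.fst = List.ofFn σ := by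
    rw [List.map_ofFn]; rfl
  refine exists_congr fun p => and_congr_right fun _ => forall_congr' fun w =>
    exists_congr fun N => ?_
  rw [hn]
  have key : ∀ k : ℕ → ℤ,
      act (ppL p (List.ofFn σ)) (fun k => opL (List.ofFn fun i => (σ i, ψ i)) k w) k =
        mulPolyN (pairPoly p r) (seqCoeff ψ w) (k ∘ σ) := by
    intro k
    simp only [opL_ofFn]
    rw [ppL_ofFn, act_rename σ hσ, act_apply]
    rfl
  constructor
  · rintro h k ⟨i, hi, hk⟩
    rw [key]
    obtain ⟨l, rfl⟩ := (List.mem_ofFn' _ _).mp hi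
    exact h _ ⟨l, hk⟩
  · rintro h k ⟨l, hl⟩
    have e : Function.extend σ k 0 ∘ σ = k := by
      funext l
      simp [hσ.extend_apply]
    rw [← e, ← key]
    refine h _ ⟨σ l, ?_, ?_⟩
    · exact (List.mem_ofFn' _ _).mpr ⟨l, rfl⟩
    · rwa [hσ.extend_apply]

lemma qcSet_iff (S : Set (EW W)) : QCSet S ↔
    ∀ L : List (ℕ × EW W), (L.map Prod.fst).Nodup → (∀ x ∈ L, x.2 ∈ S) → LQC L := by
  constructor
  · intro h L hn hL
    have e : L = List.ofFn fun i : Fin L.length => ((L.get i).1, (L.get i).2) :=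
      (List.ofFn_get L).symm
    rw [e]
    refine (qcSeq_iff (fun i => (L.get i).1) ?_ fun i => (L.get i).2).mp
      (h _ _ fun i => hL _ (List.get_mem L i))
    rw [← List.nodup_ofFn]
    have : (List.ofFn fun i => (L.get i).1) = L.map Prod.fst := by
      conv_rhs => rw [e, List.map_ofFn]
      rfl
    rwa [this]
  · intro h r ψ hψ
    refine (qcSeq_iff (fun i => (i : ℕ)) Fin.val_injective ψ).mpr (h _ ?_ ?_)
    · rw [List.map_ofFn]
      exact List.nodup_ofFn.mpr Fin.val_injective
    · intro x hx
      obtain ⟨i, rfl⟩ := (List.mem_ofFn' _ _).mp hx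
      exact hψ i

lemma QCSet.qcPair {S : Set (EW W)} (h : QCSet S) {a b : EW W} (ha : a ∈ S) (hb : b ∈ S) :
    QCPair a b := by
  obtain ⟨p, hp, hL⟩ := h 2 ![a, b] (by intro i; fin_cases i <;> assumption)
  refine (qcPair_iff a b).mpr ⟨p, hp, fun w => ?_⟩
  obtain ⟨N, hN⟩ := hL w
  refine ⟨N, fun k hk => ?_⟩
  have := hN k ⟨hk.choose, hk.choose_spec.2⟩
  have e : pairPoly p 2 = p := by
    rw [pairPoly_succ, pairPoly_succ]
    have h0 : pairPoly p 0 = 1 := by simp [pairPoly]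
    rw [h0]
    simp only [Finset.univ_unique, Finset.prod_singleton, Finset.univ_eq_empty,
      Finset.prod_empty, map_one, mul_one]
    have : (![0, Fin.succ default] : Fin 2 → Fin 2) = id := by
      funext l
      fin_cases l <;> rfl
    rw [this, MvPolynomial.rename_id_apply]
  rw [e] at this
  rw [act_apply]
  exact this

/-! ### Multiplication by polynomials in part of the variables -/

lemma act_rename_commute {ι κ : Type*} (f : κ → ι)
    (Φ : ((ι → ℤ) → W) →ₗ[ℂ] ((ι → ℤ) → W))
    (h : ∀ l F, Φ (act (MvPolynomial.X (f l)) F) = act (MvPolynomial.X (f l)) (Φ F))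
    (p : MvPolynomial κ ℂ) (F : (ι → ℤ) → W) :
    Φ (act (MvPolynomial.rename f p) F) = act (MvPolynomial.rename f p) (Φ F) := by
  induction p using MvPolynomial.induction_on generalizing F with
  | C a => rw [MvPolynomial.rename_C, act_C, act_C, map_smul]
  | add p q hp hq => rw [map_add, act_add, act_add, map_add, hp, hq]
  | mul_X p l hp => rw [map_mul, act_mul, act_mul, hp, MvPolynomial.rename_X, h]

lemma act_ppL_commute (Φ : ((ℕ → ℤ) → W) →ₗ[ℂ] ((ℕ → ℤ) → W)) (l : List ℕ)
    (h : ∀ i ∈ l, ∀ F, Φ (act (MvPolynomial.X i) F) = act (MvPolynomial.X i) (Φ F))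
    (p : MvPolynomial (Fin 2) ℂ) (F : (ℕ → ℤ) → W) :
    Φ (act (ppL p l) F) = act (ppL p l) (Φ F) := by
  induction l generalizing F with
  | nil => rw [ppL, act_one, act_one]
  | cons i l ih =>
    have key : ∀ (m : List ℕ), (∀ j ∈ m, j ∈ l) → ∀ F,
        Φ (act (m.map (pairR p i)).prod F) = act (m.map (pairR p i)).prod (Φ F) := by
      intro m
      induction m with
      | nil => intro _ F; simp only [List.map_nil, List.prod_nil, act_one]
      | cons j m ihm =>
        intro hm F
        rw [List.map_cons, List.prod_cons, act_mul, act_mul, pairR, act_rename_commute,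
          ihm fun x hx => hm x (List.mem_cons_of_mem _ hx)]
        intro t F
        fin_cases t
        · exact h i List.mem_cons_self F
        · exact h j (List.mem_cons_of_mem _ (hm j List.mem_cons_self)) F
    rw [ppL, act_mul, act_mul, key l fun _ h => h, ih fun j hj => h j (List.mem_cons_of_mem _ hj)]

/-! ### Closure of quasi compatibility under products -/

/-- The substitution `x_i ↦ 0` on polynomials. -/
def killVar (i : ℕ) : MvPolynomial ℕ ℂ →ₐ[ℂ] MvPolynomial ℕ ℂ :=
  MvPolynomial.aeval fun l => if l = i then 0 else MvPolynomial.X l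

lemma X_dvd_sub_killVar (i : ℕ) (P : MvPolynomial ℕ ℂ) :
    MvPolynomial.X i ∣ P - killVar i P := by
  induction P using MvPolynomial.induction_on with
  | C a => simp [killVar]
  | add p q hp hq =>
    rw [map_add, add_sub_add_comm]
    exact dvd_add hp hq
  | mul_X p l hp =>
    by_cases h : l = i
    · subst h
      simp [killVar]
    · have : killVar i (MvPolynomial.X l) = MvPolynomial.X l := by simp [killVar, h]
      rw [map_mul, this, ← sub_mul]
      exact hp.mul_right _

lemma algHom_pairR {A : Type*} [CommSemiring A] [Algebra ℂ A] (φ ψ : MvPolynomial ℕ ℂ →ₐ[ℂ] A)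
    (p : MvPolynomial (Fin 2) ℂ) {i j i' j' : ℕ}
    (h0 : φ (MvPolynomial.X i) = ψ (MvPolynomial.X i'))
    (h1 : φ (MvPolynomial.X j) = ψ (MvPolynomial.X j')) :
    φ (pairR p i j) = ψ (pairR p i' j') := by
  have : φ.comp (MvPolynomial.rename ![i, j]) = ψ.comp (MvPolynomial.rename ![i', j']) := by
    apply MvPolynomial.algHom_ext
    intro l
    fin_cases l <;> simp [h0, h1]
  exact DFunLike.congr_fun this p

lemma algHom_ppL (φ : MvPolynomial ℕ ℂ →ₐ[ℂ] MvPolynomial ℕ ℂ) (p : MvPolynomial (Fin 2) ℂ)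
    (l : List ℕ) (h : ∀ i ∈ l, φ (MvPolynomial.X i) = MvPolynomial.X i) :
    φ (ppL p l) = ppL p l := by
  induction l with
  | nil => simp [ppL]
  | cons i l ih =>
    rw [ppL, map_mul, ih fun j hj => h j (List.mem_cons_of_mem _ hj), map_list_prod,
      List.map_map]
    congr 2
    refine List.map_congr_left fun j hj => ?_
    exact algHom_pairR φ (AlgHom.id ℂ _) p (h i List.mem_cons_self)
      (h j (List.mem_cons_of_mem _ hj))

lemma pairR_dvd_ppL (U : MvPolynomial (Fin 2) ℂ) (u : MvPolynomial ℕ ℂ) (l₁ l₂ : List ℕ) (j : ℕ)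
    (h : l₁ ++ l₂ ≠ []) (hu : ∀ l, u ∣ pairR U l j ∧ u ∣ pairR U j l) :
    u ∣ ppL U (l₁ ++ j :: l₂) := by
  rw [ppL_insert]
  refine Dvd.dvd.mul_left ?_ _
  cases l₁ with
  | cons l l₁ =>
    refine Dvd.dvd.mul_right ?_ _
    rw [List.map_cons, List.prod_cons]
    exact (hu l).1.mul_right _
  | nil =>
    refine Dvd.dvd.mul_left ?_ _
    cases l₂ with
    | nil => exact absurd rfl h
    | cons l l₂ =>
      rw [List.map_cons, List.prod_cons]
      exact (hu l).2.mul_right _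

lemma exists_substPoly_ppL {p : MvPolynomial (Fin 2) ℂ} (hp : p ≠ 0) (l₁ l₂ : List ℕ) (i j : ℕ)
    (hn : (l₁ ++ i :: j :: l₂).Nodup) (hne : l₁ ++ l₂ ≠ []) :
    ∃ q : MvPolynomial (Fin 2) ℂ, q ≠ 0 ∧ ∃ (e : ℕ) (V R R' : MvPolynomial ℕ ℂ),
      substPoly 1 i j (ppL p (l₁ ++ i :: j :: l₂)) = MvPolynomial.X i ^ e * V ∧
      ppL q (l₁ ++ j :: l₂) = V * R + MvPolynomial.X i * R' := by
  have hmid := List.nodup_middle.mp hn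
  have hnew : ∀ l ∈ l₁ ++ j :: l₂, l ≠ i := by
    rintro l hl rfl
    exact (List.nodup_cons.mp hmid).1 hl
  have hij : i ≠ j := fun h => hnew j (by simp) h.symm
  obtain ⟨e, v, hv, hv0⟩ := exists_X_pow_mul (substPoly_ne_zero 1 (show (0 : Fin 2) ≠ 1 by decide) hp)
  set u := evalMain 1 v with hu
  let U : MvPolynomial (Fin 2) ℂ :=
    Polynomial.aeval (MvPolynomial.X 0) u * Polynomial.aeval (MvPolynomial.X 1) u
  have hU : U ≠ 0 := by
    have key : ∀ t : Fin 2, Polynomial.aeval (MvPolynomial.X t : MvPolynomial (Fin 2) ℂ) u ≠ 0 := by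
      intro t ht
      apply hv0
      have := congrArg (evalMain t) ht
      rw [← Polynomial.aeval_algHom_apply, evalMain_X_self, map_zero,
        Polynomial.aeval_X_left_apply] at this
      exact this
    exact mul_ne_zero (key 0) (key 1)
  let τ := substPoly 1 i j
  have hτ : τ (pairR p i j) = MvPolynomial.X i ^ e * pairR v i j := by
    have : τ.comp (MvPolynomial.rename ![i, j]) =
        (MvPolynomial.rename ![i, j]).comp (substPoly 1 (0 : Fin 2) 1) := by
      apply MvPolynomial.algHom_ext
      intro l
      fin_cases l
      · simp [τ, substPoly_X_self]
      · simp [τ, substPoly_X_of_ne 1 j hij.symm, substPoly_X_of_ne 1 (1 : Fin 2)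
          (show (1 : Fin 2) ≠ 0 by decide)]
    have h2 := DFunLike.congr_fun this p
    simp only [AlgHom.comp_apply] at h2
    rw [pairR, h2, hv, map_mul, map_pow, MvPolynomial.rename_X, pairR]
    rfl
  have hεv : killVar i (pairR v i j) = Polynomial.aeval (MvPolynomial.X j) u := by
    have : (killVar i).comp (MvPolynomial.rename ![i, j]) =
        (Polynomial.aeval (MvPolynomial.X j : MvPolynomial ℕ ℂ)).comp (evalMain (1 : Fin 2)) := by
      apply MvPolynomial.algHom_ext
      intro l
      fin_cases l
      · simp [killVar, evalMain_X_of_ne]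
      · simp [killVar, evalMain_X_self, hij.symm]
    exact DFunLike.congr_fun this v
  let V := ppL p (l₁ ++ j :: l₂) * (τ (l₁.map fun l => pairR p l i).prod *
    (pairR v i j * τ (l₂.map (pairR p i)).prod))
  have hετ : ∀ l : ℕ, l ≠ i → killVar i (τ (MvPolynomial.X l)) = MvPolynomial.X l := by
    intro l hl
    rw [substPoly_X_of_ne 1 j hl]
    simp [killVar, hl]
  have hετi : killVar i (τ (MvPolynomial.X i)) = MvPolynomial.X j := by
    rw [substPoly_X_self]
    simp [killVar, hij.symm]
  have hV : killVar i V ∣ ppL (p * p * U) (l₁ ++ j :: l₂) := by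
    simp only [V, map_mul, hεv]
    rw [algHom_ppL (killVar i) p _ fun l hl => by simp [killVar, hnew l hl]]
    rw [map_list_prod, map_list_prod, map_list_prod, map_list_prod]
    simp only [List.map_map]
    have e1 : l₁.map (killVar i ∘ τ ∘ fun l => pairR p l i) = l₁.map fun l => pairR p l j := by
      refine List.map_congr_left fun l hl => ?_
      exact algHom_pairR ((killVar i).comp τ) (AlgHom.id ℂ _) p
        (hετ l (hnew l (by simp [hl]))) hετi
    have e2 : l₂.map (killVar i ∘ τ ∘ pairR p i) = l₂.map (pairR p j) := by
      refine List.map_congr_left fun l hl => ?_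
      exact algHom_pairR ((killVar i).comp τ) (AlgHom.id ℂ _) p hετi
        (hετ l (hnew l (by simp [hl])))
    rw [e1, e2, ppL_mul, ppL_mul, mul_assoc]
    refine mul_dvd_mul_left _ ?_
    rw [mul_left_comm, mul_comm (Polynomial.aeval _ _)]
    rw [ppL_insert p]
    refine mul_dvd_mul (Dvd.intro_left _ rfl) ?_
    refine pairR_dvd_ppL U _ l₁ l₂ j hne fun l => ⟨?_, ?_⟩
    · simp only [U, pairR, map_mul]
      refine Dvd.dvd.mul_left ?_ _
      rw [← Polynomial.aeval_algHom_apply, MvPolynomial.rename_X]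
      rfl
    · simp only [U, pairR, map_mul]
      refine Dvd.dvd.mul_right ?_ _
      rw [← Polynomial.aeval_algHom_apply, MvPolynomial.rename_X]
      rfl
  obtain ⟨R, hR⟩ := hV
  obtain ⟨R', hR'⟩ := X_dvd_sub_killVar i V
  refine ⟨p * p * U, mul_ne_zero (mul_ne_zero hp hp) hU, e, V, R, -(R' * R), ?_, ?_⟩
  · have h := ppL_insert p l₁ (j :: l₂) i
    rw [h, map_mul, map_mul, List.map_cons, List.prod_cons, map_mul]
    rw [algHom_ppL (substPoly 1 i j) p _ fun l hl => substPoly_X_of_ne 1 j (hnew l hl)]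
    change _ * (τ _ * (τ (pairR p i j) * _)) = _
    rw [hτ]
    simp only [V]
    ring
  · rw [hR]
    linear_combination hR' * (-R)

/-- Freezing the exponent of `x_i`. -/
def freeze (i : ℕ) (J : ℤ) : ((ℕ → ℤ) → W) →ₗ[ℂ] ((ℕ → ℤ) → W) :=
  LinearMap.funLeft ℂ W fun k => Function.update k i J

lemma freeze_apply (i : ℕ) (J : ℤ) (F : (ℕ → ℤ) → W) (k : ℕ → ℤ) :
    freeze i J F k = F (Function.update k i J) := rfl

lemma freeze_act_X {i l : ℕ} (hl : l ≠ i) (J : ℤ) (F : (ℕ → ℤ) → W) :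
    freeze i J (act (MvPolynomial.X l) F) = act (MvPolynomial.X l) (freeze i J F) := by
  funext k
  rw [act_X, freeze_apply, freeze_apply, act_X]
  congr 1
  funext m
  by_cases hm : m = i
  · subst hm
    simp [hl.symm]
  · simp [Function.update_of_ne hm]

lemma update_pair_of_ne {k : ℕ → ℤ} {i j l : ℕ} (hi : l ≠ i) (hj : l ≠ j) (s t : ℤ) :
    Function.update (Function.update k i s) j t l = k l := by
  rw [Function.update_of_ne hj, Function.update_of_ne hi]

lemma rel_opL {a b : EW W} (hab : QCPair a b) (L₁ L₂ : List (ℕ × EW W)) {i j : ℕ} (hij : i ≠ j)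
    (h₁ : ∀ x ∈ L₁, x.1 ≠ i ∧ x.1 ≠ j) (h₂ : ∀ x ∈ L₂, x.1 ≠ i ∧ x.1 ≠ j) (w : W) :
    Rel 1 i j (fun k => opL (L₁ ++ (i, a) :: (j, b) :: L₂) k w)
      (fun k => opL (L₁ ++ (j, YE a b (-(k i) - 1)) :: L₂) k w) := by
  intro k
  have h := (rel2_prodFam hab 1 (opL L₂ k w)).map (opL L₁ k)
  have e1 : ∀ s t, opL L₁ (Function.update (Function.update k i s) j t) = opL L₁ k := fun s t =>
    opL_congr fun x hx => update_pair_of_ne (h₁ x hx).1 (h₁ x hx).2 s t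
  have e2 : ∀ s t, opL L₂ (Function.update (Function.update k i s) j t) = opL L₂ k := fun s t =>
    opL_congr fun x hx => update_pair_of_ne (h₂ x hx).1 (h₂ x hx).2 s t
  have ei : ∀ s t, Function.update (Function.update k i s) j t i = s := fun s t => by
    rw [Function.update_of_ne hij, Function.update_self]
  have ej : ∀ s t, Function.update (Function.update k i s) j t j = t := fun s t => by
    rw [Function.update_self]
  rw [Units.val_one] at h
  convert h using 1
  · funext s
    simp only [slice, opL_append, opL_cons, e1, e2, ei, ej]
    rfl
  · funext s
    simp only [slice, opL_append, opL_cons, e1, e2, ei, ej]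
    rfl

lemma act_eq_zero {ι : Type*} (P : MvPolynomial ι ℂ) (F : (ι → ℤ) → W) (k : ι → ℤ)
    (h : ∀ d : ι → ℤ, (∀ l, 0 ≤ d l) → F (fun l => k l - d l) = 0) : act P F k = 0 := by
  rw [act_apply]
  refine Finset.sum_eq_zero fun d _ => ?_
  rw [h (fun l => (d l : ℤ)) fun l => Int.natCast_nonneg _, smul_zero]

lemma act_X_pow {ι : Type*} [DecidableEq ι] (i : ι) (e : ℕ) (F : (ι → ℤ) → W) (k : ι → ℤ) :
    act (MvPolynomial.X i ^ e) F k = F (k - Pi.single i (e : ℤ)) := by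
  induction e generalizing k with
  | zero => rw [pow_zero, act_one]; simp
  | succ e ih =>
    rw [pow_succ', act_mul, act_X, ih]
    congr 1
    rw [sub_sub, ← Pi.single_add]
    congr 2
    push_cast
    ring

lemma LQC.of_length_le {L : List (ℕ × EW W)} (h : L.length ≤ 1) : LQC L := by
  refine ⟨1, one_ne_zero, fun w => ?_⟩
  match L, h with
  | [], _ => exact ⟨0, fun k ⟨i, hi, _⟩ => by simp at hi⟩
  | [x], _ =>
    obtain ⟨N, hN⟩ := x.2.2 w
    refine ⟨-N, fun k ⟨i, hi, hk⟩ => ?_⟩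
    simp only [List.map_cons, List.map_nil, List.mem_singleton, Set.mem_ofPred_eq] at hi
    subst hi
    simp only [List.map_cons, List.map_nil, ppL, List.prod_nil, mul_one, act_one]
    exact hN _ (by omega)
  | _ :: _ :: _, h => simp at h

lemma LQC.YE {L₁ L₂ : List (ℕ × EW W)} {i j : ℕ} {a b : EW W}
    (h : LQC (L₁ ++ (i, a) :: (j, b) :: L₂))
    (hn : ((L₁ ++ (i, a) :: (j, b) :: L₂).map Prod.fst).Nodup) (hab : QCPair a b) (n : ℤ) :
    LQC (L₁ ++ (j, NVA.YE a b n) :: L₂) := by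
  by_cases hne : L₁ ++ L₂ = []
  · obtain ⟨rfl, rfl⟩ := List.append_eq_nil_iff.mp hne
    exact LQC.of_length_le (by simp)
  obtain ⟨p, hp, hL⟩ := h
  simp only [List.map_append, List.map_cons] at hn hL
  have hmid := List.nodup_cons.mp (List.nodup_middle.mp hn)
  have hmid' := List.nodup_cons.mp (List.nodup_middle.mp hmid.2)
  have hij : i ≠ j := by
    rintro rfl
    exact hmid.1 (by simp)
  have hi : ∀ x ∈ L₁ ++ L₂, x.1 ≠ i ∧ x.1 ≠ j := by
    intro x hx
    have hx' : x.1 ∈ L₁.map Prod.fst ++ L₂.map Prod.fst := by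
      rw [← List.map_append]
      exact List.mem_map_of_mem hx
    constructor
    · rintro rfl
      refine hmid.1 ?_
      rw [List.mem_append, List.mem_cons]
      rw [List.mem_append] at hx'
      tauto
    · rintro rfl
      exact hmid'.1 hx'
  obtain ⟨q, hq, e, V, R, R', hV, hR⟩ := exists_substPoly_ppL hp (L₁.map Prod.fst)
    (L₂.map Prod.fst) i j hn (by
      rw [← List.map_append]
      simpa using hne)
  obtain ⟨N₀, hN₀⟩ := YEa_eq_zero hab 1
  let J : ℤ := -n - 1
  let M : ℕ := (J + N₀ + 1).toNat
  obtain ⟨R₁, hR₁⟩ : ∃ R₁, ppL q (L₁.map Prod.fst ++ j :: L₂.map Prod.fst) ^ M =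
      V * R₁ + MvPolynomial.X i ^ M * R' ^ M := by
    obtain ⟨c, hc⟩ := sub_dvd_pow_sub_pow (ppL q (L₁.map Prod.fst ++ j :: L₂.map Prod.fst))
      (MvPolynomial.X i * R') M
    refine ⟨R * c, ?_⟩
    rw [mul_pow] at hc
    linear_combination hc + c * hR
  refine ⟨q ^ M, pow_ne_zero _ hq, fun w => ?_⟩
  simp only [List.map_append, List.map_cons]
  set B : (ℕ → ℤ) → W := fun k => opL (L₁ ++ (j, NVA.YE a b (-(k i) - 1)) :: L₂) k w with hB
  set F : (ℕ → ℤ) → W := fun k => opL (L₁ ++ (i, a) :: (j, b) :: L₂) k w with hF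
  have hrel : Rel 1 i j F B := rel_opL hab L₁ L₂ hij
    (fun x hx => hi x (by simp [hx])) (fun x hx => hi x (by simp [hx])) w
  have hrel' := hrel.act one_ne_zero hij (ppL p (L₁.map Prod.fst ++ i :: j :: L₂.map Prod.fst))
  have heq := hrel'.eq_subst one_ne_zero hij (hL w) (by simp) (by simp)
  obtain ⟨N, hN⟩ := hL w
  have hB0 : ∀ k : ℕ → ℤ, k i < -N₀ → B k = 0 := by
    intro k hk
    have : NVA.YE a b (-(k i) - 1) = 0 := hN₀ _ (by omega)
    simp only [hB, this, opL_append, opL_cons, mf_zero_left, map_zero]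
  have hVB : ∀ k : ℕ → ℤ, (k i + k j < 2 * N - e ∨
      ∃ l ∈ (L₁ ++ L₂).map Prod.fst, k l < N) → act V B k = 0 := by
    intro k hk
    have h1 : act V B k = act (MvPolynomial.X i ^ e) (act V B) (k + Pi.single i (e : ℤ)) := by
      rw [act_X_pow, add_sub_cancel_right]
    rw [h1, ← act_mul, ← hV, heq]
    refine subst_expL_eq_zero hN 1 hij (by simp) (by simp) (Or.inr ?_)
    rcases hk with hk | ⟨l, hl, hk⟩
    · left
      simp [hij.symm]
      omega
    · right
      obtain ⟨x, hx, rfl⟩ := List.mem_map.mp hl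
      refine ⟨x.1, ?_, (hi x hx).1, (hi x hx).2, ?_⟩
      · rw [List.map_append, List.mem_append] at hl
        rw [Set.mem_ofPred_eq, List.mem_append, List.mem_cons, List.mem_cons]
        tauto
      · simpa [(hi x hx).1] using hk
  have hfr : (fun k => opL (L₁ ++ (j, NVA.YE a b n) :: L₂) k w) = freeze i J B := by
    funext k
    have e1 : opL L₁ (Function.update k i J) = opL L₁ k := opL_congr fun x hx =>
      Function.update_of_ne (hi x (by simp [hx])).1 _ _
    have e2 : opL L₂ (Function.update k i J) = opL L₂ k := opL_congr fun x hx =>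
      Function.update_of_ne (hi x (by simp [hx])).1 _ _
    have e3 : -J - 1 = n := by simp only [J]; ring
    simp only [freeze_apply, hB, opL_append, opL_cons, e1, e2, Function.update_self,
      Function.update_of_ne hij.symm, e3]
  rw [hfr, ← act_ppL_commute (freeze i J) _ (fun l hl F => freeze_act_X (by
    rintro rfl
    exact hmid.1 hl) J F), ppL_pow, hR₁]
  refine ⟨min N (2 * N - e - J), fun k hk => ?_⟩
  rw [freeze_apply, mul_comm V, act_add, Pi.add_apply, act_mul, mul_comm (MvPolynomial.X i ^ M),
    act_mul]
  set k' := Function.update k i J with hk'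
  have hki : k' i = J := Function.update_self _ _ _
  rw [act_eq_zero (R' ^ M) _ k', add_zero, act_eq_zero]
  · intro d hd
    refine hVB _ ?_
    obtain ⟨l, hl, hkl⟩ := hk
    have hdi := hd i
    have hdj := hd j
    have hdl := hd l
    by_cases hlj : l = j
    · left
      subst hlj
      have : k' l = k l := Function.update_of_ne hij.symm _ _
      simp only [hki, this]
      omega
    · right
      have hl' : l ∈ (L₁ ++ L₂).map Prod.fst := by
        rw [Set.mem_ofPred_eq, List.mem_append, List.mem_cons] at hl
        rw [List.map_append, List.mem_append]
        tauto
      refine ⟨l, hl', ?_⟩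
      obtain ⟨x, hx, rfl⟩ := List.mem_map.mp hl'
      have : k' x.1 = k x.1 := Function.update_of_ne (hi x hx).1 _ _
      simp only [this]
      omega
  · intro d hd
    rw [act_X_pow]
    have := hd i
    refine hB0 (_ - _) ?_
    simp only [Pi.sub_apply, Pi.single_eq_same, hki]
    omega

/-! ### Linearity, vacuum and scaling for quasi compatibility -/

lemma LQC.add {L₁ L₂ : List (ℕ × EW W)} {j : ℕ} {a b : EW W}
    (ha : LQC (L₁ ++ (j, a) :: L₂)) (hb : LQC (L₁ ++ (j, b) :: L₂)) :
    LQC (L₁ ++ (j, a + b) :: L₂) := by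
  obtain ⟨p, hp, hp'⟩ := ha
  obtain ⟨q, hq, hq'⟩ := hb
  refine ⟨p * q, mul_ne_zero hp hq, fun w => ?_⟩
  have h1 := (hp' w).act (ppL q ((L₁ ++ (j, a) :: L₂).map Prod.fst))
  have h2 := (hq' w).act (ppL p ((L₁ ++ (j, a) :: L₂).map Prod.fst))
  rw [← act_mul] at h1 h2
  simp only [List.map_append, List.map_cons] at h1 h2 ⊢
  rw [mul_comm, ← ppL_mul] at h1
  rw [← ppL_mul] at h2
  have := h1.add h2
  rw [← act_add_right] at this
  convert this using 2
  funext k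
  simp only [opL_append, opL_cons, mf_add_left, map_add, Pi.add_apply]

lemma LQC.smul {L₁ L₂ : List (ℕ × EW W)} {j : ℕ} {a : EW W}
    (ha : LQC (L₁ ++ (j, a) :: L₂)) (c : ℂ) : LQC (L₁ ++ (j, c • a) :: L₂) := by
  obtain ⟨p, hp, hp'⟩ := ha
  refine ⟨p, hp, fun w => ?_⟩
  have := (hp' w).smul c
  rw [← act_smul_right] at this
  simp only [List.map_append, List.map_cons] at this ⊢
  convert this using 2
  funext k
  simp only [opL_append, opL_cons, mf_smul_left, map_smul, Pi.smul_apply]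

lemma mf_oneE (w : W) (n : ℤ) : mf oneE w n = if n = -1 then w else 0 := rfl

/-- Restriction of a family to the exponent `0` of `x_j`. -/
def deltaAt (j : ℕ) : ((ℕ → ℤ) → W) →ₗ[ℂ] ((ℕ → ℤ) → W) where
  toFun F k := if k j = 0 then F k else 0
  map_add' F G := by
    funext k
    by_cases h : k j = 0 <;> simp [h]
  map_smul' c F := by
    funext k
    by_cases h : k j = 0 <;> simp [h]

lemma deltaAt_apply (j : ℕ) (F : (ℕ → ℤ) → W) (k : ℕ → ℤ) :
    deltaAt j F k = if k j = 0 then F k else 0 := rfl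

lemma LQC.oneE {L₁ L₂ : List (ℕ × EW W)} {j : ℕ} (h : LQC (L₁ ++ L₂))
    (hn : ((L₁ ++ (j, NVA.oneE) :: L₂).map Prod.fst).Nodup) :
    LQC (L₁ ++ (j, NVA.oneE) :: L₂) := by
  obtain ⟨p, hp, hL⟩ := h
  refine ⟨p, hp, fun w => ?_⟩
  have hF : (fun k => opL (L₁ ++ (j, NVA.oneE) :: L₂) k w) =
      deltaAt j fun k => opL (L₁ ++ L₂) k w := by
    funext k
    have : (-(k j) - 1 = -1) ↔ k j = 0 := by omega
    by_cases h : k j = 0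
    · simp [opL_append, opL_cons, mf_oneE, deltaAt_apply, h]
    · simp [opL_append, opL_cons, mf_oneE, deltaAt_apply, h, this]
  rw [List.map_append, List.map_cons] at hn ⊢
  have hj := (List.nodup_cons.mp (List.nodup_middle.mp hn)).1
  rw [hF, ppL_insert, mul_comm, act_mul]
  refine LauOn.act ?_ _
  rw [← act_ppL_commute]
  · obtain ⟨N, hN⟩ := hL w
    rw [List.map_append] at hN
    refine ⟨min N 0, fun k ⟨l, hl, hk⟩ => ?_⟩
    rw [deltaAt_apply]
    by_cases hlj : l = j
    · subst hlj
      rw [if_neg (by omega)]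
    · rw [hN k ⟨l, ?_, by omega⟩, ite_self]
      rw [Set.mem_ofPred_eq, List.mem_append, List.mem_cons] at hl
      rw [Set.mem_ofPred_eq, List.mem_append]
      tauto
  · intro l hl F
    have hlj : l ≠ j := by
      rintro rfl
      exact hj hl
    funext k
    rw [act_X, deltaAt_apply, deltaAt_apply, act_X]
    simp [hlj.symm]

lemma mf_RaE (α : ℂˣ) (a : EW W) (w : W) (n : ℤ) :
    mf (RaE α a) w n = (α : ℂ) ^ (-n - 1) • mf a w n := rfl

/-- The rescaling `x_l ↦ χ_l x_l` of polynomials. -/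
def scalePoly {ι : Type*} (χ : ι → ℂˣ) : MvPolynomial ι ℂ →ₐ[ℂ] MvPolynomial ι ℂ :=
  MvPolynomial.aeval fun l => MvPolynomial.C (χ l : ℂ) * MvPolynomial.X l

lemma scalePoly_X {ι : Type*} (χ : ι → ℂˣ) (l : ι) : scalePoly χ (MvPolynomial.X l) =
    MvPolynomial.C (χ l : ℂ) * MvPolynomial.X l := by
  simp [scalePoly]

lemma scalePoly_ne_zero {ι : Type*} (χ : ι → ℂˣ) {p : MvPolynomial ι ℂ} (hp : p ≠ 0) :
    scalePoly χ p ≠ 0 := by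
  have : (scalePoly χ⁻¹).comp (scalePoly χ) = AlgHom.id ℂ _ := by
    apply MvPolynomial.algHom_ext
    intro l
    rw [AlgHom.comp_apply, scalePoly_X, map_mul, scalePoly_X, MvPolynomial.algHom_C,
      MvPolynomial.algebraMap_eq, ← mul_assoc, ← MvPolynomial.C_mul]
    simp
  intro h
  apply hp
  have h2 := DFunLike.congr_fun this p
  rw [AlgHom.comp_apply, h, map_zero] at h2
  exact h2.symm

/-- The character `k ↦ ∏ χ_l ^ k_l`. -/
def scaleChar {ι : Type*} (T : Finset ι) (χ : ι → ℂˣ) (k : ι → ℤ) : ℂ :=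
  ∏ l ∈ T, (χ l : ℂ) ^ k l

lemma scaleChar_sub_single {ι : Type*} [DecidableEq ι] (T : Finset ι) (χ : ι → ℂˣ)
    (h : ∀ l ∉ T, χ l = 1) (k : ι → ℤ) (l : ι) :
    (χ l : ℂ) * scaleChar T χ (k - Pi.single l 1) = scaleChar T χ k := by
  by_cases hl : l ∈ T
  · rw [scaleChar, scaleChar, ← Finset.mul_prod_erase T _ hl, ← Finset.mul_prod_erase T _ hl,
      ← mul_assoc]
    congr 1
    · simp only [Pi.sub_apply, Pi.single_eq_same]
      rw [zpow_sub_one₀ (χ l).ne_zero, mul_comm, inv_mul_cancel_right₀ (χ l).ne_zero]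
    · refine Finset.prod_congr rfl fun m hm => ?_
      simp [(Finset.mem_erase.mp hm).1]
  · rw [h l hl, Units.val_one, one_mul]
    refine Finset.prod_congr rfl fun m hm => ?_
    have : m ≠ l := by
      rintro rfl
      exact hl hm
    simp [this]

lemma act_scalePoly {ι : Type*} [DecidableEq ι] (T : Finset ι) (χ : ι → ℂˣ)
    (h : ∀ l ∉ T, χ l = 1) (P : MvPolynomial ι ℂ) (F : (ι → ℤ) → W) :
    act (scalePoly χ P) (fun k => scaleChar T χ k • F k) =
      fun k => scaleChar T χ k • act P F k := by
  induction P using MvPolynomial.induction_on generalizing F with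
  | C a =>
    rw [MvPolynomial.algHom_C, MvPolynomial.algebraMap_eq, act_C, act_C]
    funext k
    exact smul_comm _ _ _
  | add p q hp hq =>
    rw [map_add, act_add, act_add, hp, hq]
    funext k
    simp
  | mul_X p l hp =>
    rw [map_mul, act_mul, act_mul, ← hp]
    congr 1
    funext k
    rw [scalePoly_X, act_mul, act_C, Pi.smul_apply, act_X, act_X, smul_smul,
      scaleChar_sub_single T χ h]

lemma ppL_dvd (φ : MvPolynomial ℕ ℂ →ₐ[ℂ] MvPolynomial ℕ ℂ) (p q : MvPolynomial (Fin 2) ℂ)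
    (l : List ℕ) (h : ∀ i ∈ l, ∀ j ∈ l, φ (pairR p i j) ∣ pairR q i j) :
    φ (ppL p l) ∣ ppL q l := by
  induction l with
  | nil => simp [ppL]
  | cons i l ih =>
    rw [ppL, ppL, map_mul]
    refine mul_dvd_mul ?_ (ih fun a ha b hb =>
      h a (List.mem_cons_of_mem _ ha) b (List.mem_cons_of_mem _ hb))
    have : ∀ m : List ℕ, (∀ j ∈ m, j ∈ l) →
        φ (m.map (pairR p i)).prod ∣ (m.map (pairR q i)).prod := by
      intro m
      induction m with
      | nil => intro _; simp
      | cons j m ihm =>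
        intro hm
        rw [List.map_cons, List.map_cons, List.prod_cons, List.prod_cons, map_mul]
        exact mul_dvd_mul (h i List.mem_cons_self j
          (List.mem_cons_of_mem _ (hm j List.mem_cons_self)))
          (ihm fun x hx => hm x (List.mem_cons_of_mem _ hx))
    exact this l fun _ h => h

lemma LauOn.scaleChar {ι : Type*} {s : Set ι} {F : (ι → ℤ) → W} (h : LauOn s F) (T : Finset ι)
    (χ : ι → ℂˣ) : LauOn s fun k => NVA.scaleChar T χ k • F k := by
  obtain ⟨N, hN⟩ := h
  exact ⟨N, fun k hk => by simp only [hN k hk, smul_zero]⟩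

lemma opL_scale (χ : ℕ → ℂˣ) (L : List (ℕ × EW W)) (hn : (L.map Prod.fst).Nodup) (w : W)
    (k : ℕ → ℤ) : opL (L.map fun x => (x.1, RaE (χ x.1) x.2)) k w =
      scaleChar (L.map Prod.fst).toFinset χ k • opL L k w := by
  rw [scaleChar, List.prod_toFinset _ hn]
  clear hn
  induction L with
  | nil => simp [opL]
  | cons x L ih =>
    rw [List.map_cons, opL_cons, ih, List.map_cons, List.map_cons, List.prod_cons, opL_cons,
      mf_RaE, mf_smul, smul_smul, neg_sub, sub_neg_eq_add, add_sub_cancel_left]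

lemma scalePoly_pairR (χ : ℕ → ℂˣ) (p : MvPolynomial (Fin 2) ℂ) (i j : ℕ) :
    scalePoly χ (pairR p i j) = pairR (scalePoly ![χ i, χ j] p) i j := by
  have : (scalePoly χ).comp (MvPolynomial.rename ![i, j]) =
      (MvPolynomial.rename ![i, j]).comp (scalePoly ![χ i, χ j]) := by
    apply MvPolynomial.algHom_ext
    intro l
    fin_cases l <;> simp [scalePoly_X]
  exact DFunLike.congr_fun this p

lemma exists_scalePoly_ppL_dvd {p : MvPolynomial (Fin 2) ℂ} (hp : p ≠ 0) (χ : ℕ → ℂˣ)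
    (l : List ℕ) : ∃ q : MvPolynomial (Fin 2) ℂ, q ≠ 0 ∧ scalePoly χ (ppL p l) ∣ ppL q l := by
  let f : ℕ → ℕ → MvPolynomial (Fin 2) ℂ := fun i j => scalePoly ![χ i, χ j] p
  refine ⟨∏ i ∈ l.toFinset, ∏ j ∈ l.toFinset, f i j, Finset.prod_ne_zero_iff.mpr fun i _ =>
    Finset.prod_ne_zero_iff.mpr fun j _ => scalePoly_ne_zero _ hp,
    ppL_dvd (scalePoly χ) p _ l fun i hi j hj => ?_⟩
  rw [scalePoly_pairR, pairR, pairR]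
  refine map_dvd _ ?_
  exact (Finset.dvd_prod_of_mem (f i) (List.mem_toFinset.mpr hj)).trans
    (Finset.dvd_prod_of_mem (fun i => ∏ j ∈ l.toFinset, f i j) (List.mem_toFinset.mpr hi))

lemma LQC.scale {L : List (ℕ × EW W)} (h : LQC L) (hn : (L.map Prod.fst).Nodup)
    (χ : ℕ → ℂˣ) (hχ : ∀ l ∉ L.map Prod.fst, χ l = 1) :
    LQC (L.map fun x => (x.1, RaE (χ x.1) x.2)) := by
  obtain ⟨p, hp, hL⟩ := h
  obtain ⟨q, hq, c, hc⟩ := exists_scalePoly_ppL_dvd hp χ (L.map Prod.fst)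
  refine ⟨q, hq, fun w => ?_⟩
  have hnames : (L.map fun x => (x.1, RaE (χ x.1) x.2)).map Prod.fst = L.map Prod.fst := by
    rw [List.map_map]
    rfl
  rw [hnames, hc, mul_comm, act_mul]
  simp only [opL_scale χ L hn]
  rw [act_scalePoly _ χ fun l hl => hχ l (by simpa using hl)]
  exact ((hL w).scaleChar _ χ).act c

/-! ### Maximal quasi compatible sets -/

lemma QCSet.mono {S T : Set (EW W)} (h : QCSet T) (hST : S ⊆ T) : QCSet S :=
  fun r ψ hψ => h r ψ fun i => hST (hψ i)

lemma exists_maximal_qcSet {S : Set (EW W)} (hS : QCSet S) :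
    ∃ M, S ⊆ M ∧ Maximal QCSet M := by
  refine zorn_subset_nonempty {M | QCSet M} ?_ S hS
  intro c hc hchain ⟨s₀, hs₀⟩
  refine ⟨⋃₀ c, ?_, fun s hs => Set.subset_sUnion_of_mem hs⟩
  refine (qcSet_iff _).mpr fun L hn hL => ?_
  have : ∃ s ∈ c, ∀ x ∈ L, x.2 ∈ s := by
    clear hn
    induction L with
    | nil => exact ⟨s₀, hs₀, by simp⟩
    | cons x L ih =>
      obtain ⟨s, hs, hsL⟩ := ih fun y hy => hL y (List.mem_cons_of_mem _ hy)
      obtain ⟨t, ht, hxt⟩ := hL x List.mem_cons_self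
      rcases hchain.total hs ht with h | h
      · refine ⟨t, ht, fun y hy => ?_⟩
        rcases List.mem_cons.mp hy with rfl | hy
        · exact hxt
        · exact h (hsL y hy)
      · refine ⟨s, hs, fun y hy => ?_⟩
        rcases List.mem_cons.mp hy with rfl | hy
        · exact h hxt
        · exact hsL y hy
  obtain ⟨s, hs, hsL⟩ := this
  exact (qcSet_iff s).mp (hc hs) L hn hsL

/-- All extensions of the list to the left by entries in `M` are quasi compatible. -/
def ExtQC (M : Set (EW W)) (L : List (ℕ × EW W)) : Prop :=
  ∀ L₁ : List (ℕ × EW W), ((L₁ ++ L).map Prod.fst).Nodup → (∀ x ∈ L₁, x.2 ∈ M) → LQC (L₁ ++ L)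

lemma ExtQC.cons {M : Set (EW W)} {L : List (ℕ × EW W)} (h : ExtQC M L) {x : ℕ × EW W}
    (hx : x.2 ∈ M) : ExtQC M (x :: L) := by
  intro L₁ hn hL₁
  rw [List.append_cons] at hn ⊢
  refine h _ hn fun y hy => ?_
  rcases List.mem_append.mp hy with hy | hy
  · exact hL₁ y hy
  · rw [List.mem_singleton.mp hy]
    exact hx

lemma mem_of_extQC {M : Set (EW W)} (hM : Maximal QCSet M) {c : EW W}
    (hc : ∀ L j, ExtQC M L → ExtQC M ((j, c) :: L)) : c ∈ M := by
  have h : QCSet (insert c M) := by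
    refine (qcSet_iff _).mpr fun L hn hL => ?_
    have : ExtQC M L := by
      clear hn
      induction L with
      | nil =>
        intro L₁ hn hL₁
        rw [List.append_nil] at hn ⊢
        exact (qcSet_iff M).mp hM.prop L₁ hn hL₁
      | cons x L ih =>
        have ih' := ih fun y hy => hL y (List.mem_cons_of_mem _ hy)
        rcases hL x List.mem_cons_self with hx | hx
        · obtain ⟨j, d⟩ := x
          simp only at hx
          subst hx
          exact hc L j ih'
        · exact ih'.cons hx
    exact this [] (by simpa using hn) (by simp)
  exact hM.le_of_ge h (Set.subset_insert c M) (Set.mem_insert c M)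

lemma YE_mem_of_maximal {M : Set (EW W)} (hM : Maximal QCSet M) {a b : EW W} (ha : a ∈ M)
    (hb : b ∈ M) (n : ℤ) : YE a b n ∈ M := by
  refine mem_of_extQC hM fun L j h L₁ hn hL₁ => ?_
  obtain ⟨i, hi⟩ := Infinite.exists_notMem_finset ((L₁ ++ (j, YE a b n) :: L).map Prod.fst).toFinset
  rw [List.mem_toFinset] at hi
  have hn' : ((L₁ ++ (i, a) :: (j, b) :: L).map Prod.fst).Nodup := by
    rw [List.map_append, List.map_cons] at hn hi ⊢
    exact List.nodup_middle.mpr (List.nodup_cons.mpr ⟨hi, hn⟩)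
  exact ((h.cons (x := (j, b)) hb).cons (x := (i, a)) ha L₁ hn' hL₁).YE hn'
    (hM.prop.qcPair ha hb) n

lemma oneE_mem_of_maximal {M : Set (EW W)} (hM : Maximal QCSet M) : oneE ∈ M := by
  refine mem_of_extQC hM fun L j h L₁ hn hL₁ => ?_
  refine (h L₁ ?_ hL₁).oneE hn
  rw [List.map_append, List.map_cons] at hn
  rw [List.map_append]
  exact (List.nodup_cons.mp (List.nodup_middle.mp hn)).2

lemma add_mem_of_maximal {M : Set (EW W)} (hM : Maximal QCSet M) {a b : EW W} (ha : a ∈ M)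
    (hb : b ∈ M) : a + b ∈ M := by
  refine mem_of_extQC hM fun L j h L₁ hn hL₁ => ?_
  rw [List.map_append, List.map_cons] at hn
  exact (h.cons (x := (j, a)) ha L₁ (by rwa [List.map_append, List.map_cons]) hL₁).add
    (h.cons (x := (j, b)) hb L₁ (by rwa [List.map_append, List.map_cons]) hL₁)

lemma smul_mem_of_maximal {M : Set (EW W)} (hM : Maximal QCSet M) {a : EW W} (ha : a ∈ M)
    (c : ℂ) : c • a ∈ M := by
  refine mem_of_extQC hM fun L j h L₁ hn hL₁ => ?_
  rw [List.map_append, List.map_cons] at hn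
  exact (h.cons (x := (j, a)) ha L₁ (by rwa [List.map_append, List.map_cons]) hL₁).smul c

lemma exists_scale (L : List (ℕ × EW W)) (hn : (L.map Prod.fst).Nodup) (g : EW W → ℂˣ) :
    ∃ χ : ℕ → ℂˣ, (∀ l ∉ L.map Prod.fst, χ l = 1) ∧ ∀ x ∈ L, χ x.1 = g x.2 := by
  induction L with
  | nil => exact ⟨1, fun _ _ => rfl, by simp⟩
  | cons x L ih =>
    rw [List.map_cons] at hn
    obtain ⟨χ, h1, h2⟩ := ih (List.nodup_cons.mp hn).2
    refine ⟨Function.update χ x.1 (g x.2), fun l hl => ?_, fun y hy => ?_⟩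
    · rw [List.map_cons, List.mem_cons] at hl
      push Not at hl
      rw [Function.update_of_ne hl.1, h1 l hl.2]
    · rcases List.mem_cons.mp hy with rfl | hy
      · rw [Function.update_self]
      · rw [Function.update_of_ne, h2 y hy]
        intro he
        exact (List.nodup_cons.mp hn).1 (he ▸ List.mem_map_of_mem hy)

lemma QCSet.rGamma {M : Set (EW W)} (hM : QCSet M) (Γ : Subgroup ℂˣ) : QCSet (RGamma Γ M) := by
  refine (qcSet_iff _).mpr fun L hn hL => ?_
  have : ∀ c : EW W, ∃ α : ℂˣ, ∃ a : EW W, c ∈ RGamma Γ M → a ∈ M ∧ c = RaE α a := by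
    intro c
    by_cases hc : c ∈ RGamma Γ M
    · obtain ⟨α, -, a, ha, h⟩ := hc
      exact ⟨α, a, fun _ => ⟨ha, h⟩⟩
    · exact ⟨1, c, fun h => absurd h hc⟩
  choose g f hgf using this
  obtain ⟨χ, h1, h2⟩ := exists_scale L hn g
  have hn' : (L.map fun x => (x.1, f x.2)).map Prod.fst = L.map Prod.fst := by
    rw [List.map_map]
    rfl
  have h := ((qcSet_iff M).mp hM (L.map fun x => (x.1, f x.2)) (by rwa [hn']) (by
    intro y hy
    obtain ⟨x, hx, rfl⟩ := List.mem_map.mp hy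
    exact (hgf x.2 (hL x hx)).1)).scale (by rwa [hn']) χ (by rwa [hn'])
  rw [List.map_map] at h
  convert h
  conv_lhs => rw [← List.map_id L]
  refine List.map_congr_left fun x hx => ?_
  refine Prod.ext rfl ?_
  change x.2 = RaE (χ x.1) (f x.2)
  rw [h2 x hx]
  exact (hgf x.2 (hL x hx)).2

lemma RaE_one (a : EW W) : RaE 1 a = a := by
  refine EW.ext fun w n => ?_
  rw [mf_RaE, Units.val_one, one_zpow, one_smul]

lemma RaE_mem_of_maximal {M : Set (EW W)} (hM : Maximal QCSet M) {a : EW W} (ha : a ∈ M)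
    (α : ℂˣ) : RaE α a ∈ M :=
  hM.le_of_ge (hM.prop.rGamma ⊤) (fun c hc => ⟨1, trivial, c, hc, (RaE_one c).symm⟩)
    ⟨α, trivial, a, ha, rfl⟩

/-- The subspaces among which `⟨S⟩_Γ` is the smallest one. -/
def IsAdmissible (Γ : Subgroup ℂˣ) (S : Set (EW W)) (U : Submodule ℂ (EW W)) : Prop :=
  QCSet (U : Set (EW W)) ∧ (∀ a ∈ U, ∀ b ∈ U, ∀ n : ℤ, YE a b n ∈ U) ∧
    oneE ∈ U ∧ S ⊆ (U : Set (EW W)) ∧ (∀ α ∈ Γ, ∀ a ∈ U, RaE α a ∈ U)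

lemma exists_isAdmissible (Γ : Subgroup ℂˣ) {S : Set (EW W)} (hS : QCSet S) :
    ∃ U, IsAdmissible Γ S U := by
  obtain ⟨M, hSM, hM⟩ := exists_maximal_qcSet hS
  refine ⟨{ carrier := M
            add_mem' := add_mem_of_maximal hM
            zero_mem' := ?_
            smul_mem' := fun c a ha => smul_mem_of_maximal hM ha c }, hM.prop,
    fun a ha b hb n => YE_mem_of_maximal hM ha hb n, oneE_mem_of_maximal hM, hSM,
    fun α _ a ha => RaE_mem_of_maximal hM ha α⟩
  have := smul_mem_of_maximal hM (oneE_mem_of_maximal hM) 0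
  rwa [zero_smul] at this

lemma existsUnique_isGenGamma (Γ : Subgroup ℂˣ) {S : Set (EW W)} (hS : QCSet S) :
    ∃! U : Submodule ℂ (EW W), IsGenGamma Γ S U := by
  refine existsUnique_of_exists_of_unique ?_ fun U U' h h' =>
    le_antisymm (h.2 U' h'.1) (h'.2 U h.1)
  obtain ⟨U₀, h₀⟩ := exists_isAdmissible Γ hS
  refine ⟨sInf {U | IsAdmissible Γ S U}, ⟨?_, ?_, ?_, ?_, ?_⟩, fun U' hU' => sInf_le hU'⟩
  · exact h₀.1.mono fun a ha => (Submodule.mem_sInf.mp ha) U₀ h₀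
  · intro a ha b hb n
    rw [Submodule.mem_sInf] at ha hb ⊢
    exact fun U hU => hU.2.1 a (ha U hU) b (hb U hU) n
  · rw [Submodule.mem_sInf]
    exact fun U hU => hU.2.2.1
  · intro a ha
    rw [SetLike.mem_coe, Submodule.mem_sInf]
    exact fun U hU => hU.2.2.2.1 ha
  · intro α hα a ha
    rw [Submodule.mem_sInf] at ha ⊢
    exact fun U hU => hU.2.2.2.2 α hα a (ha U hU)

/-! ### Elementary properties of the products -/

lemma YEa_eq_of_rel2 {a b : EW W} (h : QCPair a b) (α : ℂˣ) (c : ℤ → EW W)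
    (hc : ∀ w, Rel2 (α : ℂ) (pairFam a b w) fun k => mf (c (-(k 0) - 1)) w (-(k 1) - 1))
    (n : ℤ) : YEa α a b n = c n := by
  refine EW.ext fun w m => ?_
  have := congrFun (Rel2.unique α.ne_zero (rel2_prodFam h α w) (hc w)) ![-n - 1, -m - 1]
  have e : ∀ x : ℤ, -(-x - 1) - 1 = x := fun x => by ring
  simpa [prodFam, e] using this

lemma prodFam_eq_subst {a b : EW W} (h : QCPair a b) (α : ℂˣ) {w : W}
    (hL : LauOn Set.univ (pairFam a b w)) :
    prodFam α a b w = subst (expL (α : ℂ)) 0 1 (pairFam a b w) :=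
  Rel2.unique α.ne_zero (rel2_prodFam h α w) (Rel2.of_lauOn hL)

lemma mf_YE_eq_subst {a b : EW W} (h : QCPair a b) {w : W}
    (hL : LauOn Set.univ (pairFam a b w)) (n m : ℤ) :
    mf (YE a b n) w m = subst (expL 1) 0 1 (pairFam a b w) ![-n - 1, -m - 1] := by
  have := congrFun (prodFam_eq_subst h 1 hL) ![-n - 1, -m - 1]
  have e : ∀ x : ℤ, -(-x - 1) - 1 = x := fun x => by ring
  change mf (YEa 1 a b n) w m = _
  simpa [prodFam, e] using this

lemma YE_add_left {a a' b : EW W} (h : QCPair a b) (h' : QCPair a' b) (h'' : QCPair (a + a') b)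
    (n : ℤ) : YE (a + a') b n = YE a b n + YE a' b n :=
  YEa_eq_of_rel2 h'' 1 (fun n => YE a b n + YE a' b n) (fun w =>
    (rel2_prodFam h 1 w).add (Units.ne_zero 1) (rel2_prodFam h' 1 w)) n

lemma YE_smul_left {a b : EW W} (h : QCPair a b) (c : ℂ) (h' : QCPair (c • a) b)
    (n : ℤ) : YE (c • a) b n = c • YE a b n :=
  YEa_eq_of_rel2 h' 1 (fun n => c • YE a b n) (fun w => (rel2_prodFam h 1 w).smul c) n

lemma YE_add_right {a b b' : EW W} (h : QCPair a b) (h' : QCPair a b') (h'' : QCPair a (b + b'))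
    (n : ℤ) : YE a (b + b') n = YE a b n + YE a b' n := by
  refine YEa_eq_of_rel2 h'' 1 (fun n => YE a b n + YE a b' n) (fun w => ?_) n
  convert (rel2_prodFam h 1 w).add (Units.ne_zero 1) (rel2_prodFam h' 1 w) using 1
  · funext k
    simp only [pairFam, mf_add_left, mf_add, Pi.add_apply]
  · funext k
    simp only [mf_add_left]
    rfl

lemma YE_smul_right {a b : EW W} (h : QCPair a b) (c : ℂ) (h' : QCPair a (c • b))
    (n : ℤ) : YE a (c • b) n = c • YE a b n := by
  refine YEa_eq_of_rel2 h' 1 (fun n => c • YE a b n) (fun w => ?_) n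
  convert (rel2_prodFam h 1 w).smul c using 1
  · funext k
    simp only [pairFam, mf_smul_left, mf_smul, Pi.smul_apply]
  · funext k
    simp only [mf_smul_left]
    rfl

lemma exists_mf_eq_zero (a : EW W) (w : W) : ∃ N : ℤ, ∀ n, N ≤ n → mf a w n = 0 := a.2 w

lemma lauOn_pairFam_oneE_left (b : EW W) (w : W) : LauOn Set.univ (pairFam oneE b w) := by
  obtain ⟨N, hN⟩ := exists_mf_eq_zero b w
  refine ⟨min 0 (-N), ?_⟩
  rintro k ⟨l, -, hl⟩
  rw [pairFam, mf_oneE]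
  fin_cases l
  · simp only [Fin.zero_eta] at hl
    rw [if_neg (by omega)]
  · simp only [Fin.mk_one] at hl
    rw [hN _ (by omega), ite_self]

lemma lauOn_pairFam_oneE_right (a : EW W) (w : W) : LauOn Set.univ (pairFam a oneE w) := by
  obtain ⟨N, hN⟩ := exists_mf_eq_zero a w
  refine ⟨min 0 (-N), ?_⟩
  rintro k ⟨l, -, hl⟩
  rw [pairFam, mf_oneE]
  fin_cases l
  · simp only [Fin.zero_eta] at hl
    split_ifs
    · exact hN _ (by omega)
    · exact mf_zero a _
  · simp only [Fin.mk_one] at hl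
    rw [if_neg (by omega), mf_zero]

lemma YE_oneE_left {b : EW W} (h : QCPair oneE b) (n : ℤ) :
    YE oneE b n = if n = -1 then b else 0 := by
  refine EW.ext fun w m => ?_
  rw [mf_YE_eq_subst h (lauOn_pairFam_oneE_left b w), subst, finsum_eq_single _ (n + 1)]
  · have e0 : (![-n - 1, -m - 1] + (n + 1) • quot (0 : Fin 2) 1) 0 = 0 := by
      rw [add_smul_quot_left (by decide)]
      simp
    have e1 : (![-n - 1, -m - 1] + (n + 1) • quot (0 : Fin 2) 1) 1 = -m - 1 - (n + 1) := by
      rw [add_smul_quot_right (by decide)]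
      simp
    rw [pairFam, e0, e1, mf_oneE, if_pos (by ring)]
    simp only [Matrix.cons_val_zero]
    have : -n - 1 + (n + 1) = 0 := by ring
    rw [this, expL_eq_expR _ _ le_rfl, expR]
    by_cases hn : n = -1
    · subst hn
      simp [binom_zero]
    · rw [if_neg hn, mf_zero_left]
      by_cases h0 : -n - 1 ≤ 0
      · obtain ⟨j, hj⟩ : ∃ j : ℕ, n = j := ⟨n.toNat, by omega⟩
        subst hj
        have : (0 - (-(j : ℤ) - 1)).toNat = j + 1 := by omega
        rw [if_pos h0, this]
        have := binom_natCast 0 (j + 1)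
        simp only [Nat.cast_zero] at this
        rw [this]
        simp
      · rw [if_neg h0, zero_smul]
  · intro x hx
    rw [pairFam, mf_oneE, add_smul_quot_left (by decide), if_neg, smul_zero]
    simp only [Matrix.cons_val_zero]
    omega

lemma mf_YE_oneE_right {a : EW W} (h : QCPair a oneE) (n : ℤ) (w : W) (m : ℤ) :
    mf (YE a oneE n) w m =
      expL 1 (-n - 1 + (-m - 1)) (-n - 1) • mf a w (-(-n - 1 + (-m - 1)) - 1) := by
  rw [mf_YE_eq_subst h (lauOn_pairFam_oneE_right a w), subst, finsum_eq_single _ (-m - 1)]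
  · rw [pairFam, add_smul_quot_left (by decide), add_smul_quot_right (by decide), mf_oneE,
      if_pos (by simp)]
    rfl
  · intro x hx
    rw [pairFam, mf_oneE, add_smul_quot_right (by decide), if_neg, mf_zero, smul_zero]
    simp only [Matrix.cons_val_one, Matrix.cons_val_zero]
    omega

lemma YE_oneE_right_of_nonneg {a : EW W} (h : QCPair a oneE) {n : ℤ} (hn : 0 ≤ n) :
    YE a oneE n = 0 := by
  refine EW.ext fun w m => ?_
  rw [mf_YE_oneE_right h, expL, if_neg (by omega), zero_smul, mf_zero_left]

lemma YE_oneE_right_neg_one {a : EW W} (h : QCPair a oneE) : YE a oneE (-1) = a := by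
  refine EW.ext fun w m => ?_
  rw [mf_YE_oneE_right h]
  have : -(- (-1) - 1 + (-m - 1)) - 1 = m := by ring
  rw [this, expL, if_pos (by omega)]
  simp [binom_zero]

/-! ### Scaling -/

lemma Rel2.scale {α α' : ℂ} (β γ : ℂˣ) (h : α' * β = α * γ) {F B : (Fin 2 → ℤ) → W}
    (hFB : Rel2 α F B) :
    Rel2 α' (fun k => ((β : ℂ) ^ k 0 * (γ : ℂ) ^ k 1) • F k)
      (fun k => ((β : ℂ) ^ k 0 * (γ : ℂ) ^ k 1) • B k) := by
  have hs : ∀ k : Fin 2 → ℤ, (β : ℂ) ^ k 0 * (γ : ℂ) ^ k 1 =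
      scaleChar Finset.univ ![β, γ] k := fun k => by
    simp [scaleChar, Fin.prod_univ_two]
  have hact := fun (P : MvPolynomial (Fin 2) ℂ) (F : (Fin 2 → ℤ) → W) =>
    act_scalePoly Finset.univ ![β, γ] (fun l hl => absurd (Finset.mem_univ l) hl) P F
  obtain ⟨⟨⟨N, hN⟩, h2⟩, p, hp, hL, he⟩ := hFB
  refine ⟨⟨⟨N, fun k hk => by simp only [hN k hk, smul_zero]⟩, fun m => ?_⟩, scalePoly ![β, γ] p,
    scalePoly_ne_zero _ hp, ?_, ?_⟩
  · obtain ⟨M, hM⟩ := h2 m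
    exact ⟨M, fun k hk hk' => by simp only [hM k hk hk', smul_zero]⟩
  · simp only [hs]
    rw [hact]
    exact hL.scaleChar _ _
  · have hc : substPoly α' 0 1 (scalePoly ![β, γ] p) =
        scalePoly ![β, γ] (substPoly α 0 1 p) := by
      have : (substPoly α' 0 1).comp (scalePoly ![β, γ]) =
          (scalePoly ![β, γ]).comp (substPoly α 0 1) := by
        apply MvPolynomial.algHom_ext
        intro l
        fin_cases l
        · simp only [Fin.zero_eta, AlgHom.comp_apply, scalePoly_X, substPoly_X_self, map_mul,
            map_add, MvPolynomial.algHom_C, MvPolynomial.algebraMap_eq]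
          simp only [Matrix.cons_val_zero, Matrix.cons_val_one, mul_add]
          rw [← mul_assoc, ← mul_assoc, ← MvPolynomial.C_mul, ← MvPolynomial.C_mul, ← h,
            mul_comm α']
        · simp only [Fin.mk_one, AlgHom.comp_apply, scalePoly_X, map_mul, substPoly_C,
            substPoly_X_of_ne _ (1 : Fin 2) (show (1 : Fin 2) ≠ 0 by decide)]
      exact DFunLike.congr_fun this p
    simp only [hs]
    rw [hc, hact, hact, he]
    funext k
    simp only [← hs, NVA.subst]
    rw [smul_finsum]
    congr 1
    funext n
    rw [add_smul_quot_left (by decide), add_smul_quot_right (by decide), smul_smul, smul_smul]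
    congr 1
    simp only [expL]
    split_ifs with h0
    · rw [add_sub_cancel_left, zpow_add₀ β.ne_zero, zpow_sub₀ γ.ne_zero]
      have e : α' ^ n * (β : ℂ) ^ n = α ^ n * (γ : ℂ) ^ n := by
        rw [← mul_zpow, h, mul_zpow]
      have hγ : (γ : ℂ) ^ n ≠ 0 := zpow_ne_zero _ γ.ne_zero
      field_simp
      linear_combination (-binom (k 0 + n) (k 0).toNat) * e
    · simp

lemma YEa_eq_smul_YE {a b : EW W} (h : QCPair a b) (α : ℂˣ) (h' : QCPair (RaE α a) b) (n : ℤ) :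
    YEa α a b n = ((α : ℂ) ^ (n + 1)) • YE (RaE α a) b n := by
  refine YEa_eq_of_rel2 h α (fun n => ((α : ℂ) ^ (n + 1)) • YE (RaE α a) b n) (fun w => ?_) n
  convert (rel2_prodFam h' 1 w).scale (α := ((1 : ℂˣ) : ℂ)) (α' := (α : ℂ)) α⁻¹ 1 (by simp) using 1
  · funext k
    simp only [pairFam, mf_RaE, smul_smul]
    have : -(-(k 0) - 1) - 1 = k 0 := by ring
    rw [this, Units.val_inv_eq_inv_val, inv_zpow, Units.val_one, one_zpow, mul_one,
      inv_mul_cancel₀ (zpow_ne_zero _ α.ne_zero), one_smul]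
  · funext k
    rw [mf_smul_left]
    have : -(k 0) - 1 + 1 = -(k 0) := by ring
    rw [this, Units.val_inv_eq_inv_val, inv_zpow, Units.val_one, one_zpow, mul_one, zpow_neg]
    rfl

lemma RaE_YE {a b : EW W} (h : QCPair a b) (α : ℂˣ) (h' : QCPair (RaE α a) (RaE α b)) (n : ℤ) :
    RaE α (YE a b n) = ((α : ℂ) ^ (n + 1)) • YE (RaE α a) (RaE α b) n := by
  have key : YE (RaE α a) (RaE α b) n = ((α : ℂ) ^ (-n - 1)) • RaE α (YE a b n) := by
    refine YEa_eq_of_rel2 h' 1 (fun n => ((α : ℂ) ^ (-n - 1)) • RaE α (YE a b n)) (fun w => ?_) n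
    convert (rel2_prodFam h 1 w).scale (α := ((1 : ℂˣ) : ℂ)) (α' := ((1 : ℂˣ) : ℂ)) α α rfl using 1
    · funext k
      simp only [pairFam, mf_RaE, mf_smul, smul_smul]
      have e : ∀ x : ℤ, -(-x - 1) - 1 = x := fun x => by ring
      rw [e, e, mul_comm]
    · funext k
      rw [mf_smul_left, mf_RaE, smul_smul]
      have e : ∀ x : ℤ, -(-x - 1) - 1 = x := fun x => by ring
      rw [e, e]
      rfl
  rw [key, smul_smul, ← zpow_add₀ α.ne_zero]
  have : n + 1 + (-n - 1) = 0 := by ring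
  rw [this, zpow_zero, one_smul]

lemma RaE_RaE (α β : ℂˣ) (a : EW W) : RaE α (RaE β a) = RaE (α * β) a := by
  refine EW.ext fun w n => ?_
  rw [mf_RaE, mf_RaE, mf_RaE, smul_smul, Units.val_mul, mul_zpow]

lemma RaE_add (α : ℂˣ) (a b : EW W) : RaE α (a + b) = RaE α a + RaE α b := by
  refine EW.ext fun w n => ?_
  simp only [mf_RaE, mf_add_left, smul_add]

lemma RaE_smul (α : ℂˣ) (c : ℂ) (a : EW W) : RaE α (c • a) = c • RaE α a := by
  refine EW.ext fun w n => ?_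
  simp only [mf_RaE, mf_smul_left]
  exact smul_comm _ _ _

lemma RaE_oneE (α : ℂˣ) : RaE α (oneE : EW W) = oneE := by
  refine EW.ext fun w n => ?_
  rw [mf_RaE, mf_oneE]
  split_ifs with h
  · subst h
    simp
  · rw [smul_zero]

/-! ### Substitutions on power series in three variables -/

section PowerSeries

variable {ι : Type*} [DecidableEq ι]

/-- Families supported on nonnegative exponents. -/
def IsPow (H : (ι → ℤ) → W) : Prop := ∀ k : ι → ℤ, (∃ l, k l < 0) → H k = 0

lemma IsPow.lauOn {H : (ι → ℤ) → W} (h : IsPow H) : LauOn Set.univ H :=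
  ⟨0, fun k ⟨l, _, hl⟩ => h k ⟨l, hl⟩⟩

lemma IsPow.substDom {H : (ι → ℤ) → W} (h : IsPow H) (c : ℤ → ℤ → ℂ) {i j : ι} (hij : i ≠ j) :
    SubstDom c i j H := h.lauOn.substDom c hij trivial trivial

lemma IsPow.act {H : (ι → ℤ) → W} (h : IsPow H) (P : MvPolynomial ι ℂ) : IsPow (act P H) :=
  fun k ⟨l, hl⟩ => act_eq_zero P H k fun d hd => h _ ⟨l, by have := hd l; omega⟩

lemma IsPow.subst_expR {H : (ι → ℤ) → W} (h : IsPow H) {i j : ι} (hij : i ≠ j) :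
    subst expR i j H = subst (expL 1) i j H := by
  funext k
  simp only [subst]
  congr 1
  funext n
  by_cases hn : 0 ≤ k i + n
  · rw [expL_eq_expR _ _ hn]
  · rw [h (k + n • quot i j) ⟨i, by rw [add_smul_quot_left hij]; omega⟩, smul_zero, smul_zero]

lemma IsPow.subst {H : (ι → ℤ) → W} (h : IsPow H) {i j : ι} (hij : i ≠ j) :
    IsPow (subst (expL 1) i j H) := by
  rintro k ⟨l, hl⟩
  refine finsum_eq_zero_of_forall_eq_zero fun n => ?_
  by_contra hne
  have hH : ∀ m, 0 ≤ (k + n • quot i j) m := by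
    intro m
    by_contra hm
    exact hne (by rw [h _ ⟨m, not_le.mp hm⟩, smul_zero])
  have hi := hH i
  have hj := hH j
  have hl' := hH l
  rw [add_smul_quot_left hij] at hi
  rw [add_smul_quot_right hij] at hj
  have hc : expL 1 (k i + n) (k i) ≠ 0 := fun hc => hne (by rw [hc, zero_smul])
  have h0 : 0 ≤ k i := by
    by_contra h0
    exact hc (by rw [expL, if_neg h0])
  rw [expL_eq_expR _ _ hi] at hc
  have h1 : k i ≤ k i + n := by
    by_contra h1
    exact hc (by rw [expR, if_neg h1])
  by_cases hli : l = i
  · subst hli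
    omega
  by_cases hlj : l = j
  · subst hlj
    omega
  rw [add_smul_quot_of_ne hli hlj] at hl'
  omega

/-- The constant power series. -/
def constPow (w : W) (k : ι → ℤ) : W := if k = 0 then w else 0

lemma isPow_constPow (w : W) : IsPow (constPow w : (ι → ℤ) → W) := by
  rintro k ⟨l, hl⟩
  rw [constPow, if_neg]
  rintro rfl
  exact absurd hl (lt_irrefl _)

lemma subst_constPow (w : W) {i j : ι} (hij : i ≠ j) :
    subst (expL 1) i j (constPow w) = constPow w := by
  funext k
  rw [subst, finsum_eq_single _ 0]
  · rw [zero_smul, add_zero, add_zero]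
    by_cases hk : k = 0
    · subst hk
      simp [expL, binom_zero]
    · rw [constPow, if_neg hk, smul_zero]
  · intro n hn
    by_cases hk : k + n • quot i j = 0
    · have hi := congrFun hk i
      have hj := congrFun hk j
      rw [add_smul_quot_left hij] at hi
      simp only [Pi.zero_apply] at hi
      rw [hi, expL_eq_expR _ _ le_rfl, expR]
      split_ifs with h0
      · obtain ⟨m, hm⟩ : ∃ m : ℕ, (0 - k i).toNat = m + 1 := ⟨(0 - k i).toNat - 1, by omega⟩
        have := binom_natCast 0 (m + 1)
        simp only [Nat.cast_zero] at this
        rw [hm, this]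
        simp
      · rw [zero_smul]
    · rw [constPow, if_neg hk, smul_zero]

end PowerSeries

/-- The composite of the substitutions `x₁ ↦ x₁ + x₂`, `x₀ ↦ x₀ + x₂`, `x₀ ↦ x₀ + x₁`. -/
def substThree (H : (Fin 3 → ℤ) → W) : (Fin 3 → ℤ) → W :=
  subst (expL 1) 0 1 (subst (expL 1) 0 2 (subst (expL 1) 1 2 H))

/-- The composite of the substitutions `x₀ ↦ x₀ + x₁`, `x₁ ↦ x₁ + x₂`. -/
def substTwo (H : (Fin 3 → ℤ) → W) : (Fin 3 → ℤ) → W :=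
  subst (expL 1) 1 2 (subst (expL 1) 0 1 H)

/-- The polynomial version of `substTwo`. -/
def polyTwo : MvPolynomial (Fin 3) ℂ →ₐ[ℂ] MvPolynomial (Fin 3) ℂ :=
  (substPoly 1 1 2).comp (substPoly 1 0 1)

lemma polyTwo_X_zero : polyTwo (MvPolynomial.X 0) =
    MvPolynomial.X 0 + (MvPolynomial.X 1 + MvPolynomial.X 2) := by
  simp [polyTwo, substPoly]

lemma polyTwo_X_one : polyTwo (MvPolynomial.X 1) = MvPolynomial.X 1 + MvPolynomial.X 2 := by
  simp [polyTwo, substPoly]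

lemma polyTwo_X_two : polyTwo (MvPolynomial.X 2) = MvPolynomial.X 2 := by
  simp [polyTwo, substPoly]

lemma substPoly_three (P : MvPolynomial (Fin 3) ℂ) :
    substPoly 1 0 1 (substPoly 1 0 2 (substPoly 1 1 2 P)) = polyTwo P := by
  have : ((substPoly 1 0 1).comp ((substPoly 1 0 2).comp (substPoly 1 1 2))) = polyTwo := by
    apply MvPolynomial.algHom_ext
    intro l
    fin_cases l
    · simp [substPoly, polyTwo, add_assoc]
    · simp [substPoly, polyTwo]
    · simp [substPoly, polyTwo]
  exact DFunLike.congr_fun this P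

lemma substThree_act {H : (Fin 3 → ℤ) → W} (h : IsPow H) (P : MvPolynomial (Fin 3) ℂ) :
    substThree (act P H) = act (polyTwo P) (substThree H) := by
  have e := isExpansion_expL 1 one_ne_zero
  rw [substThree, subst_act e (by decide) (h.substDom _ (by decide)),
    subst_act e (by decide) ((h.subst (by decide)).substDom _ (by decide)),
    subst_act e (by decide) (((h.subst (by decide)).subst (by decide)).substDom _ (by decide)),
    substPoly_three]
  rfl

lemma substTwo_act {H : (Fin 3 → ℤ) → W} (h : IsPow H) (P : MvPolynomial (Fin 3) ℂ) :
    substTwo (act P H) = act (polyTwo P) (substTwo H) := by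
  have e := isExpansion_expL 1 one_ne_zero
  rw [substTwo, subst_act e (by decide) (h.substDom _ (by decide)),
    subst_act e (by decide) ((h.subst (by decide)).substDom _ (by decide))]
  rfl

lemma substThree_add {H G : (Fin 3 → ℤ) → W} (h : IsPow H) (g : IsPow G) :
    substThree (H + G) = substThree H + substThree G := by
  rw [substThree, subst_add (h.substDom _ (by decide)) (g.substDom _ (by decide)),
    subst_add ((h.subst (by decide)).substDom _ (by decide))
      ((g.subst (by decide)).substDom _ (by decide)),
    subst_add (((h.subst (by decide)).subst (by decide)).substDom _ (by decide))
      (((g.subst (by decide)).subst (by decide)).substDom _ (by decide))]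
  rfl

lemma substTwo_add {H G : (Fin 3 → ℤ) → W} (h : IsPow H) (g : IsPow G) :
    substTwo (H + G) = substTwo H + substTwo G := by
  rw [substTwo, subst_add (h.substDom _ (by decide)) (g.substDom _ (by decide)),
    subst_add ((h.subst (by decide)).substDom _ (by decide))
      ((g.subst (by decide)).substDom _ (by decide))]
  rfl

lemma IsPow.exists_decomp {H : (Fin 3 → ℤ) → W} (h : IsPow H) :
    ∃ G : Fin 3 → (Fin 3 → ℤ) → W, (∀ l, IsPow (G l)) ∧
      H = constPow (H 0) + (NVA.act (MvPolynomial.X 0) (G 0) + (NVA.act (MvPolynomial.X 1) (G 1) +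
        NVA.act (MvPolynomial.X 2) (G 2))) := by
  refine ⟨![fun k => if 0 ≤ k 0 then H (k + Pi.single 0 1) else 0,
    fun k => if k 0 = 0 ∧ 0 ≤ k 1 then H (k + Pi.single 1 1) else 0,
    fun k => if k 0 = 0 ∧ k 1 = 0 ∧ 0 ≤ k 2 then H (k + Pi.single 2 1) else 0], ?_, ?_⟩
  · intro l
    fin_cases l <;>
    · rintro k ⟨m, hm⟩
      simp only [Fin.zero_eta, Fin.mk_one, Fin.reduceFinMk, Matrix.cons_val]
      split_ifs with hc
      · refine h _ ⟨m, ?_⟩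
        fin_cases m <;> simp at hm hc ⊢ <;> omega
      · rfl
  · funext k
    simp only [Pi.add_apply, act_X, Matrix.cons_val, constPow, sub_add_cancel, Pi.sub_apply]
    by_cases hneg : ∃ l, k l < 0
    · have hk0 : k ≠ 0 := by
        rintro rfl
        obtain ⟨l, hl⟩ := hneg
        exact lt_irrefl _ hl
      rw [h k hneg, if_neg hk0]
      simp
    · push Not at hneg
      have h0 := hneg 0
      have h1 := hneg 1
      have h2 := hneg 2
      have hk : k = 0 ↔ k 0 = 0 ∧ k 1 = 0 ∧ k 2 = 0 := by
        rw [funext_iff, Fin.forall_fin_succ, Fin.forall_fin_succ, Fin.forall_fin_succ]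
        simp
      have s00 : (Pi.single (0 : Fin 3) 1 : Fin 3 → ℤ) 0 = 1 := rfl
      have s10 : (Pi.single (1 : Fin 3) 1 : Fin 3 → ℤ) 0 = 0 := rfl
      have s11 : (Pi.single (1 : Fin 3) 1 : Fin 3 → ℤ) 1 = 1 := rfl
      have s20 : (Pi.single (2 : Fin 3) 1 : Fin 3 → ℤ) 0 = 0 := rfl
      have s21 : (Pi.single (2 : Fin 3) 1 : Fin 3 → ℤ) 1 = 0 := rfl
      have s22 : (Pi.single (2 : Fin 3) 1 : Fin 3 → ℤ) 2 = 1 := rfl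
      simp only [s00, s10, s11, s20, s21, s22]
      by_cases e0 : k 0 = 0
      · by_cases e1 : k 1 = 0
        · by_cases e2 : k 2 = 0
          · have : k = 0 := hk.mpr ⟨e0, e1, e2⟩
            rw [if_pos this, if_neg (by omega), if_neg (by omega), if_neg (by omega), this]
            simp
          · rw [if_neg (by rw [hk]; omega), if_neg (by omega), if_neg (by omega),
              if_pos (by omega)]
            simp
        · rw [if_neg (by rw [hk]; omega), if_neg (by omega), if_pos (by omega),
            if_neg (by omega)]
          simp
      · rw [if_neg (by rw [hk]; omega), if_pos (by omega), if_neg (by omega),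
          if_neg (by omega)]
        simp

lemma IsPow.substThree_eq {H : (Fin 3 → ℤ) → W} (h : IsPow H) : substThree H = substTwo H := by
  have key : ∀ s : ℕ, ∀ H : (Fin 3 → ℤ) → W, IsPow H → ∀ k : Fin 3 → ℤ, k 0 + k 1 + k 2 < s →
      substThree H k = substTwo H k := by
    intro s
    induction s with
    | zero =>
      intro H h k hk
      have hneg : ∃ l, k l < 0 := by
        by_contra hc
        push Not at hc
        have := hc 0
        have := hc 1
        have := hc 2
        push_cast at hk
        omega
      rw [substThree, substTwo,
        (((h.subst (by decide)).subst (by decide)).subst (by decide)) k hneg,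
        ((h.subst (by decide)).subst (by decide)) k hneg]
    | succ s ih =>
      intro H h k hk
      obtain ⟨G, hG, hH⟩ := h.exists_decomp
      have hc := isPow_constPow (ι := Fin 3) (H 0)
      have g0 := (hG 0).act (MvPolynomial.X 0)
      have g1 := (hG 1).act (MvPolynomial.X 1)
      have g2 := (hG 2).act (MvPolynomial.X 2)
      have hadd : ∀ {A B : (Fin 3 → ℤ) → W}, IsPow A → IsPow B → IsPow (A + B) :=
        fun hA hB k hk => by rw [Pi.add_apply, hA k hk, hB k hk, add_zero]
      have hs : ∀ l i : Fin 3, substThree (G l) (k - Pi.single i 1) =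
          substTwo (G l) (k - Pi.single i 1) := fun l i => ih _ (hG l) _ (by
        push_cast at hk
        fin_cases i <;> simp <;> omega)
      rw [hH, substThree_add hc (hadd g0 (hadd g1 g2)), substThree_add g0 (hadd g1 g2),
        substThree_add g1 g2, substTwo_add hc (hadd g0 (hadd g1 g2)),
        substTwo_add g0 (hadd g1 g2), substTwo_add g1 g2,
        substThree_act (hG 0), substThree_act (hG 1), substThree_act (hG 2),
        substTwo_act (hG 0), substTwo_act (hG 1), substTwo_act (hG 2),
        polyTwo_X_zero, polyTwo_X_one, polyTwo_X_two]
      have hcc : substThree (constPow (H 0)) = substTwo (constPow (H 0)) := by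
        simp only [substThree, substTwo]
        rw [subst_constPow _ (by decide), subst_constPow _ (by decide),
          subst_constPow _ (by decide), subst_constPow _ (by decide)]
      simp only [Pi.add_apply, act_add, act_X, hcc, hs]
  funext k
  exact key (k 0 + k 1 + k 2 + 1).toNat H h k (by omega)

/-! ### Weak associativity -/

lemma polyTwo_rename {p v : MvPolynomial (Fin 2) ℂ} {e : ℕ}
    (hv : substPoly 1 0 1 p = MvPolynomial.X 0 ^ e * v) {i j : Fin 3}
    (y z : MvPolynomial (Fin 3) ℂ) (hi : polyTwo (MvPolynomial.X i) = y + z)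
    (hj : polyTwo (MvPolynomial.X j) = z) :
    polyTwo (MvPolynomial.rename ![i, j] p) = y ^ e * MvPolynomial.aeval ![y, z] v := by
  have : polyTwo.comp (MvPolynomial.rename ![i, j]) =
      (MvPolynomial.aeval ![y, z]).comp (substPoly 1 0 1) := by
    apply MvPolynomial.algHom_ext
    intro l
    fin_cases l <;> simp [substPoly, hi, hj]
  have h := DFunLike.congr_fun this p
  simp only [AlgHom.comp_apply] at h
  rw [h, hv, map_mul, map_pow, MvPolynomial.aeval_X]
  rfl

lemma evalMain_two_aeval (v : MvPolynomial (Fin 2) ℂ) (y z : MvPolynomial (Fin 3) ℂ)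
    (hy : evalMain 2 y = 0) (hz : evalMain 2 z = Polynomial.X) :
    evalMain 2 (MvPolynomial.aeval ![y, z] v) = evalMain 1 v := by
  have : (evalMain (2 : Fin 3)).comp (MvPolynomial.aeval ![y, z]) = evalMain (1 : Fin 2) := by
    apply MvPolynomial.algHom_ext
    intro l
    fin_cases l
    · simp [hy, evalMain_X_of_ne]
    · simp [hz, evalMain_X_self]
  exact DFunLike.congr_fun this v

lemma pairPoly_three (p : MvPolynomial (Fin 2) ℂ) : pairPoly p 3 =
    MvPolynomial.rename ![0, 1] p * MvPolynomial.rename ![0, 2] p *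
      MvPolynomial.rename ![1, 2] p := by
  rw [pairPoly_succ, pairPoly_succ, pairPoly_succ]
  have h0 : pairPoly p 0 = 1 := by simp [pairPoly]
  have h1 : (Fin.succ ∘ ![0, Fin.succ 0] : Fin 2 → Fin 3) = ![1, 2] := by
    funext l
    fin_cases l <;> rfl
  rw [h0, Fin.prod_univ_two, Fin.prod_univ_one, Fin.prod_univ_zero, map_one, mul_one, map_one,
    mul_one, MvPolynomial.rename_rename, h1]
  rfl

lemma exists_polyTwo_pairPoly {p : MvPolynomial (Fin 2) ℂ} (hp : p ≠ 0) :
    ∃ (e : ℕ) (V : MvPolynomial (Fin 3) ℂ), evalMain 2 V ≠ 0 ∧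
      polyTwo (pairPoly p 3) = MvPolynomial.X 0 ^ e * (MvPolynomial.X 1 ^ e *
        (V * (MvPolynomial.X 0 + MvPolynomial.X 1) ^ e)) := by
  obtain ⟨e, v, hv, hv0⟩ :=
    exists_X_pow_mul (substPoly_ne_zero 1 (show (0 : Fin 2) ≠ 1 by decide) hp)
  have x0 : evalMain (2 : Fin 3) (MvPolynomial.X 0) = 0 := evalMain_X_of_ne (by decide)
  have x1 : evalMain (2 : Fin 3) (MvPolynomial.X 1) = 0 := evalMain_X_of_ne (by decide)
  have x2 : evalMain (2 : Fin 3) (MvPolynomial.X 2) = Polynomial.X := evalMain_X_self _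
  refine ⟨e, MvPolynomial.aeval ![MvPolynomial.X 0, MvPolynomial.X 1 + MvPolynomial.X 2] v *
    MvPolynomial.aeval ![MvPolynomial.X 0 + MvPolynomial.X 1, MvPolynomial.X 2] v *
    MvPolynomial.aeval ![MvPolynomial.X 1, MvPolynomial.X 2] v, ?_, ?_⟩
  · rw [map_mul, map_mul, evalMain_two_aeval v _ _ x0 (by rw [map_add, x1, x2, zero_add]),
      evalMain_two_aeval v _ _ (by rw [map_add, x0, x1, zero_add]) x2,
      evalMain_two_aeval v _ _ x1 x2]
    exact mul_ne_zero (mul_ne_zero hv0 hv0) hv0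
  · rw [pairPoly_three, map_mul, map_mul,
      polyTwo_rename hv _ _ polyTwo_X_zero polyTwo_X_one,
      polyTwo_rename hv (MvPolynomial.X 0 + MvPolynomial.X 1) _
        (by rw [polyTwo_X_zero, add_assoc]) polyTwo_X_two,
      polyTwo_rename hv _ _ polyTwo_X_one polyTwo_X_two]
    ring

/-- The coefficients of `a(x₀) b(x₁) c(x₂) w`. -/
def threeFam (a b c : EW W) (w : W) (k : Fin 3 → ℤ) : W :=
  mf a (mf b (mf c w (-(k 2) - 1)) (-(k 1) - 1)) (-(k 0) - 1)

/-- The coefficients of `(Y_ℰ(a, x₀) Y_ℰ(b, x₁) c)(x₂) w`. -/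
def rightFam (a b c : EW W) (w : W) (k : Fin 3 → ℤ) : W :=
  mf (YE a (YE b c (-(k 1) - 1)) (-(k 0) - 1)) w (-(k 2) - 1)

/-- The coefficients of `(Y_ℰ(Y_ℰ(a, x₀) b, x₁) c)(x₂) w`. -/
def leftFam (a b c : EW W) (w : W) (k : Fin 3 → ℤ) : W :=
  mf (YE (YE a b (-(k 0) - 1)) c (-(k 1) - 1)) w (-(k 2) - 1)

lemma act_rightFam {a b c : EW W} (hbc : QCPair b c) (ha : ∀ n, QCPair a (YE b c n)) (w : W)
    {P : MvPolynomial (Fin 3) ℂ} (hP : IsPow (act P (threeFam a b c w))) :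
    act (substPoly 1 0 2 (substPoly 1 1 2 P)) (rightFam a b c w) =
      subst (expL 1) 0 2 (subst (expL 1) 1 2 (act P (threeFam a b c w))) := by
  set G : (Fin 3 → ℤ) → W :=
    fun k => mf a (mf (YE b c (-(k 1) - 1)) w (-(k 2) - 1)) (-(k 0) - 1) with hG
  have r1 : Rel 1 1 2 (threeFam a b c w) G := by
    intro k
    have := (rel2_prodFam hbc 1 w).map (modeL a (-(k 0) - 1))
    rw [Units.val_one] at this
    exact this
  have r2 : Rel 1 0 2 G (rightFam a b c w) := by
    intro k
    have := rel2_prodFam (ha (-(k 1) - 1)) 1 w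
    rw [Units.val_one] at this
    exact this
  have e1 := (r1.act one_ne_zero (by decide) P).eq_subst one_ne_zero (by decide) hP.lauOn
    trivial trivial
  have r3 := r2.act one_ne_zero (by decide) (substPoly 1 1 2 P)
  rw [e1] at r3
  exact r3.eq_subst one_ne_zero (by decide) (hP.subst (by decide)).lauOn trivial trivial

lemma act_leftFam {a b c : EW W} (hab : QCPair a b) (hc : ∀ n, QCPair (YE a b n) c) (w : W)
    {P : MvPolynomial (Fin 3) ℂ} (hP : IsPow (act P (threeFam a b c w))) :
    act (polyTwo P) (leftFam a b c w) = substTwo (act P (threeFam a b c w)) := by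
  set G : (Fin 3 → ℤ) → W :=
    fun k => mf (YE a b (-(k 0) - 1)) (mf c w (-(k 2) - 1)) (-(k 1) - 1) with hG
  have r1 : Rel 1 0 1 (threeFam a b c w) G := by
    intro k
    have := rel2_prodFam hab 1 (mf c w (-(k 2) - 1))
    rw [Units.val_one] at this
    exact this
  have r2 : Rel 1 1 2 G (leftFam a b c w) := by
    intro k
    have := rel2_prodFam (hc (-(k 0) - 1)) 1 w
    rw [Units.val_one] at this
    exact this
  have e1 := (r1.act one_ne_zero (by decide) P).eq_subst one_ne_zero (by decide) hP.lauOn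
    trivial trivial
  have r3 := r2.act one_ne_zero (by decide) (substPoly 1 0 1 P)
  rw [e1] at r3
  exact r3.eq_subst one_ne_zero (by decide) (hP.subst (by decide)).lauOn trivial trivial

/-- The truncation conditions allowing cancellation of polynomials that do not vanish
on the `x₂`-axis. -/
def Summable3 (D : (Fin 3 → ℤ) → W) : Prop :=
  (∀ k : Fin 3 → ℤ, ∃ n : ℕ, ∀ d : Fin 3 →₀ ℕ, n ≤ d.degree → d 2 = 0 → ∀ t : ℤ,
      D (fun l => k l - d l + t * (Pi.single 2 1 : Fin 3 → ℤ) l) = 0) ∧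
    ∀ k : Fin 3 → ℤ, ∃ N : ℤ, ∀ t < N, D (fun l => k l + t * (Pi.single 2 1 : Fin 3 → ℤ) l) = 0

lemma Summable3.sub {D E : (Fin 3 → ℤ) → W} (hD : Summable3 D) (hE : Summable3 E) :
    Summable3 (D - E) := by
  refine ⟨fun k => ?_, fun k => ?_⟩
  · obtain ⟨n, hn⟩ := hD.1 k
    obtain ⟨m, hm⟩ := hE.1 k
    exact ⟨max n m, fun d hd h2 t => by
      rw [Pi.sub_apply, hn d (le_trans (le_max_left _ _) hd) h2,
        hm d (le_trans (le_max_right _ _) hd) h2, sub_zero]⟩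
  · obtain ⟨n, hn⟩ := hD.2 k
    obtain ⟨m, hm⟩ := hE.2 k
    exact ⟨min n m, fun t ht => by
      rw [Pi.sub_apply, hn t (by omega), hm t (by omega), sub_zero]⟩

lemma Summable3.act_X_add_pow {D : (Fin 3 → ℤ) → W} (hD : Summable3 D) (i j : Fin 3) (e : ℕ) :
    Summable3 (act ((MvPolynomial.X i + MvPolynomial.X j) ^ e) D) := by
  induction e with
  | zero => rwa [pow_zero, act_one]
  | succ e ih =>
    rw [pow_succ', act_mul, act_add]
    generalize act ((MvPolynomial.X i + MvPolynomial.X j) ^ e) D = E at ih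
    refine ⟨fun k => ?_, fun k => ?_⟩
    · obtain ⟨n, hn⟩ := ih.1 (k - Pi.single i 1)
      obtain ⟨m, hm⟩ := ih.1 (k - Pi.single j 1)
      refine ⟨max n m, fun d hd h2 t => ?_⟩
      rw [Pi.add_apply, act_X, act_X]
      convert add_zero (0 : W) using 2
      · rw [← hn d (le_trans (le_max_left _ _) hd) h2 t]
        congr 1
        funext l
        simp only [Pi.sub_apply]
        ring
      · rw [← hm d (le_trans (le_max_right _ _) hd) h2 t]
        congr 1
        funext l
        simp only [Pi.sub_apply]
        ring
    · obtain ⟨n, hn⟩ := ih.2 (k - Pi.single i 1)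
      obtain ⟨m, hm⟩ := ih.2 (k - Pi.single j 1)
      refine ⟨min n m, fun t ht => ?_⟩
      rw [Pi.add_apply, act_X, act_X]
      convert add_zero (0 : W) using 2
      · rw [← hn t (by omega)]
        congr 1
        funext l
        simp only [Pi.sub_apply]
        ring
      · rw [← hm t (by omega)]
        congr 1
        funext l
        simp only [Pi.sub_apply]
        ring

/-- Mode families truncated as `a_m (b_n c)`. -/
lemma exists_lower_bound_YE {a b c : EW W} (ha : ∀ n, QCPair a (YE b c n)) (m : ℤ) :
    ∀ j : ℕ, ∃ N : ℤ, ∀ n : ℤ, m ≤ n → n < m + j → ∀ s, N ≤ s → YE a (YE b c n) s = 0 := by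
  intro j
  induction j with
  | zero => exact ⟨0, fun n h1 h2 => by push_cast at h2; omega⟩
  | succ j ih =>
    obtain ⟨N, hN⟩ := ih
    obtain ⟨M, hM⟩ := YEa_eq_zero (ha (m + j)) 1
    refine ⟨max N M, fun n h1 h2 s hs => ?_⟩
    by_cases h : n < m + j
    · exact hN n h1 h s (le_trans (le_max_left _ _) hs)
    · have : n = m + j := by push_cast at h2; omega
      subst this
      exact hM s (le_trans (le_max_right _ _) hs)

lemma exists_upper_bound_YE {a b c : EW W} (hc : ∀ n, QCPair (YE a b n) c) (m : ℤ) :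
    ∀ j : ℕ, ∃ N : ℤ, ∀ n : ℤ, m ≤ n → n < m + j → ∀ s, N ≤ s → YE (YE a b n) c s = 0 := by
  intro j
  induction j with
  | zero => exact ⟨0, fun n h1 h2 => by push_cast at h2; omega⟩
  | succ j ih =>
    obtain ⟨N, hN⟩ := ih
    obtain ⟨M, hM⟩ := YEa_eq_zero (hc (m + j)) 1
    refine ⟨max N M, fun n h1 h2 s hs => ?_⟩
    by_cases h : n < m + j
    · exact hN n h1 h s (le_trans (le_max_left _ _) hs)
    · have : n = m + j := by push_cast at h2; omega
      subst this
      exact hM s (le_trans (le_max_right _ _) hs)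

lemma YE_zero_left (b : EW W) (n : ℤ) : YE 0 b n = 0 := by
  have h : QCPair (0 : EW W) b := (qcPair_iff _ _).2 ⟨1, one_ne_zero, fun w =>
    ⟨0, fun k _ => by rw [act_one, pairFam, mf_zero_left]⟩⟩
  have := YE_smul_left h 0 (by rwa [zero_smul]) n
  rwa [zero_smul, zero_smul] at this

lemma YE_zero_right (a : EW W) (n : ℤ) : YE a 0 n = 0 := by
  have h : QCPair a (0 : EW W) := (qcPair_iff _ _).2 ⟨1, one_ne_zero, fun w =>
    ⟨0, fun k _ => by rw [act_one, pairFam, mf_zero_left, mf_zero]⟩⟩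
  have := YE_smul_right h 0 (by rwa [zero_smul]) n
  rwa [zero_smul, zero_smul] at this

lemma degree_fin_three (d : Fin 3 →₀ ℕ) : d.degree = d 0 + d 1 + d 2 := by
  rw [Finsupp.degree_eq_sum, Fin.sum_univ_three]

lemma summable3_leftFam {a b c : EW W} (hab : QCPair a b) (hc : ∀ n, QCPair (YE a b n) c)
    (w : W) : Summable3 (leftFam a b c w) := by
  obtain ⟨N, hN⟩ := YEa_eq_zero hab 1
  refine ⟨fun k => ?_, fun k => ?_⟩
  · obtain ⟨M, hM⟩ := exists_upper_bound_YE hc (-(k 0) - 1) (N - (-(k 0) - 1)).toNat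
    refine ⟨(k 0 + 1 + N).toNat + (k 1 + 1 + M).toNat, fun d hd h2 t => ?_⟩
    rw [degree_fin_three, h2] at hd
    have e0 : (Pi.single 2 1 : Fin 3 → ℤ) 0 = 0 := rfl
    have e1 : (Pi.single 2 1 : Fin 3 → ℤ) 1 = 0 := rfl
    simp only [leftFam, e0, e1, mul_zero, add_zero]
    by_cases h : N ≤ -(k 0 - (d 0 : ℤ)) - 1
    · have : YE a b (-(k 0 - (d 0 : ℤ)) - 1) = 0 := hN _ h
      rw [this, YE_zero_left, mf_zero_left]
    · rw [hM _ (by omega) (by omega) _ (by omega), mf_zero_left]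
  · obtain ⟨M, hM⟩ := exists_mf_eq_zero (YE (YE a b (-(k 0) - 1)) c (-(k 1) - 1)) w
    refine ⟨-(k 2) - 1 - M, fun t ht => ?_⟩
    have e0 : (Pi.single 2 1 : Fin 3 → ℤ) 0 = 0 := rfl
    have e1 : (Pi.single 2 1 : Fin 3 → ℤ) 1 = 0 := rfl
    have e2 : (Pi.single 2 1 : Fin 3 → ℤ) 2 = 1 := rfl
    simp only [leftFam, e0, e1, e2, mul_zero, add_zero, mul_one]
    exact hM _ (by omega)

lemma rightFam_eq_zero {a b c : EW W} {N : ℤ} (hN : ∀ n, N ≤ n → YE b c n = 0) (w : W)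
    {k : Fin 3 → ℤ} (hk : N ≤ -(k 1) - 1) : rightFam a b c w k = 0 := by
  rw [rightFam, hN _ hk, YE_zero_right, mf_zero_left]

lemma substDom_rightFam {a b c : EW W} (hbc : QCPair b c) (w : W) :
    SubstDom expR 0 1 (rightFam a b c w) := by
  obtain ⟨N, hN⟩ := YEa_eq_zero hbc 1
  intro k m
  refine (Set.finite_Icc m (k 1 + N)).subset ?_
  rintro n ⟨h1, h2⟩
  constructor
  · by_contra h
    exact h1 (by rw [expR, if_neg h])
  · by_contra h
    exact h2 (rightFam_eq_zero hN w (by rw [add_smul_quot_right (by decide)]; omega))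

lemma summable3_subst_rightFam {a b c : EW W} (hbc : QCPair b c)
    (ha : ∀ n, QCPair a (YE b c n)) (w : W) :
    Summable3 (subst expR 0 1 (rightFam a b c w)) := by
  obtain ⟨N, hN⟩ := YEa_eq_zero hbc 1
  have hterm : ∀ (k : Fin 3 → ℤ) (n : ℤ),
      expR (k 0 + n) (k 0) • rightFam a b c w (k + n • quot 0 1) ≠ 0 → 0 ≤ n ∧ n ≤ k 1 + N := by
    intro k n hne
    constructor
    · by_contra h
      exact hne (by rw [expR, if_neg (by omega), zero_smul])
    · by_contra h
      exact hne (by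
        rw [rightFam_eq_zero hN w (by rw [add_smul_quot_right (by decide)]; omega), smul_zero])
  have e0 : (Pi.single 2 1 : Fin 3 → ℤ) 0 = 0 := rfl
  have e1 : (Pi.single 2 1 : Fin 3 → ℤ) 1 = 0 := rfl
  have e2 : (Pi.single 2 1 : Fin 3 → ℤ) 2 = 1 := rfl
  refine ⟨fun k => ?_, fun k => ?_⟩
  · obtain ⟨M, hM⟩ := exists_lower_bound_YE ha (-(k 1) - 1) (N - (-(k 1) - 1)).toNat
    refine ⟨(k 1 + 1 + N).toNat + (k 0 + (k 1 + N) + 1 + M).toNat + 1, fun d hd h2 t => ?_⟩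
    rw [degree_fin_three, h2] at hd
    refine finsum_eq_zero_of_forall_eq_zero fun n => ?_
    by_contra hne
    obtain ⟨h3, h4⟩ := hterm (fun l => k l - d l + t * (Pi.single 2 1 : Fin 3 → ℤ) l) n hne
    apply hne
    simp only [e1, mul_zero, add_zero] at h4
    rw [rightFam, add_smul_quot_left (by decide), add_smul_quot_right (by decide)]
    simp only [e0, e1, mul_zero, add_zero]
    rw [hM _ (by omega) (by omega) _ (by omega), mf_zero_left, smul_zero]
  · have hfin : ∀ j : ℕ, ∃ M : ℤ, ∀ n : ℕ, n < j → ∀ s, M ≤ s →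
        mf (YE a (YE b c (-(k 1 - n) - 1)) (-(k 0 + n) - 1)) w s = 0 := by
      intro j
      induction j with
      | zero => exact ⟨0, fun n hn => absurd hn (Nat.not_lt_zero n)⟩
      | succ j ih =>
        obtain ⟨M, hM⟩ := ih
        obtain ⟨M', hM'⟩ := exists_mf_eq_zero (YE a (YE b c (-(k 1 - j) - 1)) (-(k 0 + j) - 1)) w
        refine ⟨max M M', fun n hn s hs => ?_⟩
        rcases Nat.lt_succ_iff_lt_or_eq.mp hn with h | rfl
        · exact hM n h s (le_trans (le_max_left _ _) hs)
        · exact hM' s (le_trans (le_max_right _ _) hs)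
    obtain ⟨M, hM⟩ := hfin (k 1 + N + 1).toNat
    refine ⟨-(k 2) - 1 - M, fun t ht => ?_⟩
    refine finsum_eq_zero_of_forall_eq_zero fun n => ?_
    by_contra hne
    obtain ⟨h3, h4⟩ := hterm (fun l => k l + t * (Pi.single 2 1 : Fin 3 → ℤ) l) n hne
    apply hne
    simp only [e1, mul_zero, add_zero] at h4
    obtain ⟨n, rfl⟩ := Int.eq_ofNat_of_zero_le h3
    rw [rightFam, add_smul_quot_left (by decide), add_smul_quot_right (by decide),
      add_smul_quot_of_ne (by decide) (by decide)]
    simp only [e0, e1, e2, mul_zero, add_zero, mul_one]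
    rw [hM n (by omega) _ (by omega), smul_zero]

lemma exists_weakAssoc {a b c : EW W} (habc : QCSeq ![a, b, c]) (hab : QCPair a b)
    (hbc : QCPair b c) (ha : ∀ n, QCPair a (YE b c n)) (hc : ∀ n, QCPair (YE a b n) c) :
    ∃ e : ℕ, ∀ w, act ((MvPolynomial.X 0 + MvPolynomial.X 1) ^ e)
        (subst expR 0 1 (rightFam a b c w)) =
      act ((MvPolynomial.X 0 + MvPolynomial.X 1) ^ e) (leftFam a b c w) := by
  obtain ⟨p, hp, hL⟩ := habc
  obtain ⟨e, V, hV, hVe⟩ := exists_polyTwo_pairPoly hp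
  refine ⟨e, fun w => ?_⟩
  obtain ⟨N, hN⟩ := hL w
  have hF : ∀ k, mulPolyN (pairPoly p 3) (seqCoeff ![a, b, c] w) k =
      act (pairPoly p 3) (threeFam a b c w) k := fun k => by
    rw [act_apply]
    rfl
  let M : ℕ := (-N).toNat
  let m : MvPolynomial (Fin 3) ℂ :=
    MvPolynomial.X 0 ^ M * (MvPolynomial.X 1 ^ M * MvPolynomial.X 2 ^ M)
  have hP : IsPow (act (m * pairPoly p 3) (threeFam a b c w)) := by
    rintro k ⟨l, hl⟩
    rw [act_mul, act_mul, act_mul, act_X_pow, act_X_pow, act_X_pow, ← hF]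
    refine hN _ ⟨l, ?_⟩
    fin_cases l <;> simp [M] at hl ⊢ <;> omega
  have hr := act_rightFam hbc ha w hP
  have hl := act_leftFam hab hc w hP
  have h1 : act (polyTwo (m * pairPoly p 3)) (subst expR 0 1 (rightFam a b c w)) =
      substTwo (act (m * pairPoly p 3) (threeFam a b c w)) := by
    rw [← substPoly_three, ← subst_act isExpansion_expR (by decide) (substDom_rightFam hbc w), hr,
      IsPow.subst_expR ((hP.subst (by decide)).subst (by decide)) (by decide),
      ← hP.substThree_eq]
    rfl
  rw [← hl, map_mul, hVe, mul_left_comm, act_mul, act_mul _ _ (leftFam a b c w)] at h1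
  rw [← sub_eq_zero, ← act_sub_right] at h1
  have h2 := act_X_pow_injective _ _ _ h1
  rw [mul_left_comm, act_mul, act_mul _ _ (leftFam a b c w), ← act_sub_right] at h2
  have h3 := act_X_pow_injective _ _ _ h2
  rw [← mul_assoc, act_mul, act_mul _ _ (leftFam a b c w), ← act_sub_right] at h3
  rw [← sub_eq_zero]
  refine eq_zero_of_act_eq_zero 2 _ ?_ ?_ _ ?_ h3
  · exact (((summable3_subst_rightFam hbc ha w).act_X_add_pow 0 1 e).sub
      ((summable3_leftFam hab hc w).act_X_add_pow 0 1 e)).1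
  · exact (((summable3_subst_rightFam hbc ha w).act_X_add_pow 0 1 e).sub
      ((summable3_leftFam hab hc w).act_X_add_pow 0 1 e)).2
  · simp only [m, map_mul, map_pow, polyTwo_X_zero, polyTwo_X_one, polyTwo_X_two, map_add,
      evalMain_X_self, evalMain_X_of_ne (show (0 : Fin 3) ≠ 2 by decide),
      evalMain_X_of_ne (show (1 : Fin 3) ≠ 2 by decide), zero_add]
    have hX : (Polynomial.X : Polynomial ℂ) ^ M ≠ 0 := pow_ne_zero _ Polynomial.X_ne_zero
    exact mul_ne_zero (mul_ne_zero hX (mul_ne_zero hX hX)) hV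

lemma act_sum {ι κ : Type*} (s : Finset κ) (P : κ → MvPolynomial ι ℂ) (F : (ι → ℤ) → W) :
    act (∑ i ∈ s, P i) F = ∑ i ∈ s, act (P i) F := by
  induction s using Finset.induction_on with
  | empty => simp only [Finset.sum_empty, act_zero]
  | insert i s hi ih => rw [Finset.sum_insert hi, Finset.sum_insert hi, act_add, ih]

lemma act_X_add_X_pow (n : ℕ) (F : (Fin 2 → ℤ) → W) (k : Fin 2 → ℤ) :
    act ((MvPolynomial.X 0 + MvPolynomial.X 1) ^ n) F k =
      ∑ i ∈ Finset.range (n + 1), ((n.choose i : ℕ) : ℂ) •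
        F ![k 0 - ((n : ℤ) - i), k 1 - i] := by
  rw [add_comm, (Commute.all _ _).add_pow, act_sum, Finset.sum_apply]
  refine Finset.sum_congr rfl fun i hi => ?_
  have hc : ((n.choose i : ℕ) : MvPolynomial (Fin 2) ℂ) = MvPolynomial.C ((n.choose i : ℕ) : ℂ) := by
    simp
  have hi' : i ≤ n := Nat.lt_succ_iff.mp (Finset.mem_range.mp hi)
  rw [hc, act_mul, act_mul, act_X_pow, act_X_pow, act_C, Pi.smul_apply]
  congr 2
  ext l
  fin_cases l <;> simp [Nat.cast_sub hi']

lemma mulSubPoly_eq_act (f : MvPolynomial (Fin 2) ℂ) (A : ℤ → ℤ → W) (a b : ℤ) :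
    mulSubPoly f A a b =
      act (substPoly 1 0 1 f) (fun k : Fin 2 → ℤ => A (k 0) (k 1)) ![a, b] := by
  conv_rhs => rw [f.as_sum]
  rw [map_sum, act_sum, Finset.sum_apply]
  refine Finset.sum_congr rfl fun d _ => ?_
  have hd : substPoly 1 0 1 (MvPolynomial.monomial d (MvPolynomial.coeff d f)) =
      MvPolynomial.C (MvPolynomial.coeff d f) * (MvPolynomial.X 1 ^ d 1 *
        (MvPolynomial.X 0 + MvPolynomial.X 1 : MvPolynomial (Fin 2) ℂ) ^ d 0) := by
    rw [MvPolynomial.monomial_eq, Finsupp.prod_fintype _ _ (fun _ => pow_zero _),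
      Fin.prod_univ_two, map_mul, map_mul, map_pow, map_pow, substPoly_X_self,
      substPoly_X_of_ne _ _ (show (1 : Fin 2) ≠ 0 by decide), substPoly_C, map_one, one_mul,
      mul_comm (MvPolynomial.X 1 ^ d 1)]
  rw [hd, act_mul, act_C, act_mul, Pi.smul_apply, act_X_pow, act_X_add_X_pow, Finset.smul_sum]
  refine Finset.sum_congr rfl fun i _ => ?_
  rw [smul_smul]
  congr 2
  · simp
  · simp
    ring

lemma prodCE_eq_subst {V : Type*} (Y : V → EW W) (u v : V) (w : W) (k : Fin 2 → ℤ) :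
    prodCE (fun x => mf (Y x)) (fun x => mf (Y x)) u v w (k 0) (k 1) =
      subst expR 0 1 (pairFam (Y u) (Y v) w) k := by
  rw [prodCE, subst]
  refine (finsum_comp_equiv (Equiv.addLeft (k 0))).symm.trans (finsum_congr fun n => ?_)
  rw [pairFam, add_smul_quot_left (by decide), add_smul_quot_right (by decide), expR,
    Equiv.coe_addLeft, add_sub_cancel_left, ite_smul, zero_smul]

lemma substDom_expR {F : (Fin 2 → ℤ) → W} {N : ℤ} (hF : ∀ k : Fin 2 → ℤ, k 1 < N → F k = 0) :
    SubstDom expR 0 1 F := by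
  intro k m
  refine (Set.finite_Icc m (k 1 - N)).subset ?_
  rintro n ⟨h1, h2⟩
  constructor
  · by_contra h
    exact h1 (by rw [expR, if_neg h])
  · by_contra h
    exact h2 (hF _ (by rw [add_smul_quot_right (by decide)]; omega))

lemma substDom_pairFam (a b : EW W) (w : W) : SubstDom expR 0 1 (pairFam a b w) := by
  obtain ⟨N, hN⟩ := exists_mf_eq_zero b w
  exact substDom_expR (N := -N) fun k hk => by rw [pairFam, hN _ (by omega), mf_zero]

lemma Rel2.exists_act_subst_expR {F B : (Fin 2 → ℤ) → W} (h : Rel2 1 F B)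
    (hF : SubstDom expR 0 1 F) :
    ∃ f : MvPolynomial (Fin 2) ℂ, f ≠ 0 ∧
      NVA.act (substPoly 1 0 1 f) (NVA.subst expR 0 1 F) = NVA.act (substPoly 1 0 1 f) B := by
  obtain ⟨-, p, hp, hL, he⟩ := h
  obtain ⟨N, hN⟩ := id hL
  refine ⟨MvPolynomial.X 0 ^ (-N).toNat * p,
    mul_ne_zero (pow_ne_zero _ (MvPolynomial.X_ne_zero _)) hp, ?_⟩
  rw [← subst_act isExpansion_expR (by decide) hF, map_mul, act_mul, act_mul, he,
    ← hL.subst_act one_ne_zero]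
  funext k
  refine finsum_congr fun n => ?_
  by_cases h0 : 0 ≤ k 0 + n
  · rw [expL_eq_expR _ _ h0]
  · rw [act_X_pow, hN _ ⟨0, Set.mem_univ _, ?_⟩, smul_zero, smul_zero]
    rw [Pi.sub_apply, add_smul_quot_left (by decide), Pi.single_eq_same]
    omega

lemma exists_quasiAssoc {a b : EW W} (h : QCPair a b) (w : W) :
    ∃ f : MvPolynomial (Fin 2) ℂ, f ≠ 0 ∧
      act (substPoly 1 0 1 f) (subst expR 0 1 (pairFam a b w)) =
        act (substPoly 1 0 1 f) (prodFam 1 a b w) :=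
  Rel2.exists_act_subst_expR (by simpa using rel2_prodFam h 1 w) (substDom_pairFam a b w)

lemma slice_act_X_add_pow (k : Fin 3 → ℤ) (e : ℕ) (F : (Fin 3 → ℤ) → W) :
    slice 0 1 k (act ((MvPolynomial.X 0 + MvPolynomial.X 1) ^ e) F) =
      act ((MvPolynomial.X 0 + MvPolynomial.X 1) ^ e) (slice 0 1 k F) := by
  induction e generalizing F with
  | zero => rw [pow_zero, pow_zero, act_one, act_one]
  | succ e ih =>
    rw [pow_succ, act_mul, ih, pow_succ, act_mul, act_add, act_add,
      ← slice_act_X_left (show (0 : Fin 3) ≠ 1 by decide),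
      ← slice_act_X_right (show (0 : Fin 3) ≠ 1 by decide)]
    rfl

/-- The family of coefficients of `Y_ℰ(a, x₁) Y_ℰ(b, x₂) c`. -/
def rightFamE (a b c : EW W) : (Fin 2 → ℤ) → EW W :=
  fun k => YE a (YE b c (-(k 1) - 1)) (-(k 0) - 1)

/-- The family of coefficients of `Y_ℰ(Y_ℰ(a, x₀) b, x₂) c`. -/
def leftFamE (a b c : EW W) : (Fin 2 → ℤ) → EW W :=
  fun k => YE (YE a b (-(k 0) - 1)) c (-(k 1) - 1)

lemma substDom_rightFamE (a : EW W) {b c : EW W} (hbc : QCPair b c) :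
    SubstDom expR 0 1 (rightFamE a b c) := by
  obtain ⟨N, hN⟩ := YEa_eq_zero hbc 1
  refine substDom_expR (N := -N) fun k hk => ?_
  have : YE b c (-(k 1) - 1) = 0 := hN _ (by omega)
  rw [rightFamE, this, YE_zero_right]

/-- Evaluation of a fixed mode on a fixed vector. -/
def evalMode (w : W) (n : ℤ) : EW W →ₗ[ℂ] W where
  toFun a := mf a w n
  map_add' a b := mf_add_left a b w n
  map_smul' c a := mf_smul_left c a w n

lemma slice_rightFam (a b c : EW W) (w : W) (s : ℤ) :
    slice 0 1 ![0, 0, -s - 1] (rightFam a b c w) =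
      fun k => evalMode w s (rightFamE a b c k) := by
  funext k
  simp [slice, rightFam, rightFamE, evalMode, Function.update]

lemma slice_leftFam (a b c : EW W) (w : W) (s : ℤ) :
    slice 0 1 ![0, 0, -s - 1] (leftFam a b c w) =
      fun k => evalMode w s (leftFamE a b c k) := by
  funext k
  simp [slice, leftFam, leftFamE, evalMode, Function.update]

lemma exists_weakAssocE {U : Submodule ℂ (EW W)} (hU : QCSet (U : Set (EW W)))
    (hcl : ∀ a ∈ U, ∀ b ∈ U, ∀ n : ℤ, YE a b n ∈ U) {a b c : EW W}
    (ha : a ∈ U) (hb : b ∈ U) (hc : c ∈ U) :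
    ∃ e : ℕ, act ((MvPolynomial.X 0 + MvPolynomial.X 1) ^ e)
        (subst expR 0 1 (rightFamE a b c)) =
      act ((MvPolynomial.X 0 + MvPolynomial.X 1) ^ e) (leftFamE a b c) := by
  obtain ⟨e, he⟩ := exists_weakAssoc (a := a) (b := b) (c := c)
    (hU 3 _ (by intro i; fin_cases i <;> assumption))
    (hU.qcPair ha hb) (hU.qcPair hb hc) (fun n => hU.qcPair ha (hcl b hb c hc n))
    (fun n => hU.qcPair (hcl a ha b hb n) hc)
  refine ⟨e, funext fun k => EW.ext fun w s => ?_⟩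
  have h := congrFun (congrArg (slice 0 1 ![0, 0, -s - 1]) (he w)) k
  rw [slice_act_X_add_pow, slice_act_X_add_pow, slice_subst (by decide), slice_rightFam,
    slice_leftFam, subst_map _ (substDom_rightFamE a (hU.qcPair hb hc)),
    act_map (evalMode w s) _ (subst expR 0 1 (rightFamE a b c)),
    act_map (evalMode w s) _ (leftFamE a b c)] at h
  exact h

lemma exists_linearMap_eq_zero_iff_mem.{v} {M : Type v} [AddCommGroup M] [Module ℂ M]
    (T : Submodule ℂ M) :
    ∃ (Q : Type v) (_ : AddCommGroup Q) (_ : Module ℂ Q) (φ : M →ₗ[ℂ] Q),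
      ∀ x, φ x = 0 ↔ x ∈ T :=
  ⟨M ⧸ T, inferInstance, inferInstance, T.mkQ, fun x => by
    rw [← LinearMap.mem_ker, Submodule.ker_mkQ]⟩

lemma mem_of_leftFamE {U T : Submodule ℂ (EW W)} (hU : QCSet (U : Set (EW W)))
    (hcl : ∀ a ∈ U, ∀ b ∈ U, ∀ n : ℤ, YE a b n ∈ U) {a b c : EW W}
    (ha : a ∈ U) (hb : b ∈ U) (hc : c ∈ U) (hT : ∀ k, rightFamE a b c k ∈ T)
    (k : Fin 2 → ℤ) : leftFamE a b c k ∈ T := by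
  obtain ⟨e, he⟩ := exists_weakAssocE hU hcl ha hb hc
  obtain ⟨Q, _, _, φ, hmk⟩ := exists_linearMap_eq_zero_iff_mem (M := EW W) T
  have hR : (fun k => φ (rightFamE a b c k)) = (0 : (Fin 2 → ℤ) → Q) := by
    funext k
    rw [(hmk _).2 (hT k), Pi.zero_apply]
  have h0 : (fun k => φ (subst expR 0 1 (rightFamE a b c) k)) = 0 := by
    rw [← subst_map φ (substDom_rightFamE a (hU.qcPair hb hc)), hR]
    funext k
    exact finsum_eq_zero_of_forall_eq_zero fun n => smul_zero _
  have h1 : act ((MvPolynomial.X 0 + MvPolynomial.X 1) ^ e)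
      (fun k => φ (leftFamE a b c k)) = 0 := by
    rw [act_map φ _ (leftFamE a b c), ← he,
      ← act_map φ _ (subst expR 0 1 (rightFamE a b c)), h0, act_zero_right]
  refine (hmk _).1 (congrFun (eq_zero_of_act_eq_zero 1
    (fun k => φ (leftFamE a b c k)) ?_ ?_ _ ?_ h1) k)
  · obtain ⟨N, hN⟩ := YEa_eq_zero (hU.qcPair ha hb) 1
    intro k
    refine ⟨(k 0 + 1 + N).toNat, fun d hd h1 t => ?_⟩
    rw [Finsupp.degree_eq_sum, Fin.sum_univ_two, h1] at hd
    have e0 : (Pi.single 1 1 : Fin 2 → ℤ) 0 = 0 := rfl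
    have : YE a b (-(k 0 - (d 0 : ℤ) + t * (Pi.single 1 1 : Fin 2 → ℤ) 0) - 1) = 0 :=
      hN _ (by rw [e0]; omega)
    simp only [leftFamE]
    rw [this, YE_zero_left, map_zero]
  · intro k
    obtain ⟨N, hN⟩ := YEa_eq_zero (hU.qcPair (hcl a ha b hb (-(k 0) - 1)) hc) 1
    refine ⟨-(k 1) - 1 - N, fun t ht => ?_⟩
    have e0 : (Pi.single 1 1 : Fin 2 → ℤ) 0 = 0 := rfl
    have e1 : (Pi.single 1 1 : Fin 2 → ℤ) 1 = 1 := rfl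
    simp only [leftFamE, e0, e1, mul_zero, add_zero, mul_one]
    have : YE (YE a b (-(k 0) - 1)) c (-(k 1 + t) - 1) = 0 := hN _ (by omega)
    rw [this, map_zero]
  · rw [map_pow, map_add, evalMain_X_self,
      evalMain_X_of_ne (show (0 : Fin 2) ≠ 1 by decide), zero_add]
    exact pow_ne_zero _ Polynomial.X_ne_zero

/-- The span of the monomials in the elements of `S`. -/
def monomialSpan (S : Set (EW W)) : Submodule ℂ (EW W) :=
  Submodule.span ℂ {v : EW W | ∃ (r : ℕ) (a : Fin r → EW W) (n : Fin r → ℤ),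
    (∀ i, a i ∈ S) ∧ v = monomialE a n}

lemma monomialE_mem {S : Set (EW W)} {U : Submodule ℂ (EW W)}
    (hcl : ∀ a ∈ S, ∀ b ∈ U, ∀ n : ℤ, YE a b n ∈ U) (h1 : oneE ∈ U) {r : ℕ}
    {a : Fin r → EW W} (ha : ∀ i, a i ∈ S) (n : Fin r → ℤ) : monomialE a n ∈ U := by
  induction r with
  | zero => exact h1
  | succ r ih => exact hcl _ (ha 0) _ (ih (fun i => ha i.succ) _) _

lemma monomialSpan_le {S : Set (EW W)} {U : Submodule ℂ (EW W)}
    (hcl : ∀ a ∈ S, ∀ b ∈ U, ∀ n : ℤ, YE a b n ∈ U) (h1 : oneE ∈ U) :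
    monomialSpan S ≤ U := by
  refine Submodule.span_le.2 ?_
  rintro _ ⟨r, a, n, ha, rfl⟩
  exact monomialE_mem hcl h1 ha n

lemma oneE_mem_monomialSpan (S : Set (EW W)) : oneE ∈ monomialSpan S :=
  Submodule.subset_span ⟨0, Fin.elim0, Fin.elim0, fun i => i.elim0, rfl⟩

section

variable {S : Set (EW W)} {U : Submodule ℂ (EW W)} (hU : QCSet (U : Set (EW W)))
  (hcl : ∀ a ∈ U, ∀ b ∈ U, ∀ n : ℤ, YE a b n ∈ U) (h1 : oneE ∈ U)
  (hS : S ⊆ (U : Set (EW W)))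

include hU hcl h1 hS

lemma monomialSpan_le_of_subset : monomialSpan S ≤ U :=
  monomialSpan_le (fun a ha => hcl a (hS ha)) h1

lemma YE_mem_monomialSpan_of_mem {a t : EW W} (ha : a ∈ S) (ht : t ∈ monomialSpan S) (n : ℤ) :
    YE a t n ∈ monomialSpan S := by
  have hle := monomialSpan_le_of_subset hU hcl h1 hS
  induction ht using Submodule.span_induction with
  | mem x hx =>
    obtain ⟨r, b, m, hb, rfl⟩ := hx
    exact Submodule.subset_span ⟨r + 1, Fin.cons a b, Fin.cons n m,
      fun i => Fin.cases ha hb i, rfl⟩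
  | zero => rw [YE_zero_right]; exact zero_mem _
  | add x y hx hy ihx ihy =>
    rw [YE_add_right (hU.qcPair (hS ha) (hle hx)) (hU.qcPair (hS ha) (hle hy))
      (hU.qcPair (hS ha) (add_mem (hle hx) (hle hy)))]
    exact add_mem ihx ihy
  | smul c x hx ih =>
    rw [YE_smul_right (hU.qcPair (hS ha) (hle hx)) c
      (hU.qcPair (hS ha) (U.smul_mem c (hle hx)))]
    exact Submodule.smul_mem _ c ih

lemma YE_mem_monomialSpan {u t : EW W} (hu : u ∈ monomialSpan S) (ht : t ∈ monomialSpan S)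
    (n : ℤ) : YE u t n ∈ monomialSpan S := by
  have hle := monomialSpan_le_of_subset hU hcl h1 hS
  let K : Submodule ℂ (EW W) :=
    { carrier := {u | u ∈ U ∧ ∀ t ∈ monomialSpan S, ∀ n : ℤ, YE u t n ∈ monomialSpan S}
      add_mem' := by
        rintro x y ⟨hx, hx'⟩ ⟨hy, hy'⟩
        refine ⟨add_mem hx hy, fun t ht n => ?_⟩
        rw [YE_add_left (hU.qcPair hx (hle ht)) (hU.qcPair hy (hle ht))
          (hU.qcPair (add_mem hx hy) (hle ht))]
        exact add_mem (hx' t ht n) (hy' t ht n)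
      zero_mem' := ⟨zero_mem _, fun t _ n => by rw [YE_zero_left]; exact zero_mem _⟩
      smul_mem' := by
        rintro c x ⟨hx, hx'⟩
        refine ⟨U.smul_mem c hx, fun t ht n => ?_⟩
        rw [YE_smul_left (hU.qcPair hx (hle ht)) c (hU.qcPair (U.smul_mem c hx) (hle ht))]
        exact Submodule.smul_mem _ c (hx' t ht n) }
  have hSK : ∀ a ∈ S, a ∈ K := fun a ha =>
    ⟨hS ha, fun t ht n => YE_mem_monomialSpan_of_mem hU hcl h1 hS ha ht n⟩
  have hK1 : oneE ∈ K := ⟨h1, fun t ht n => by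
    rw [YE_oneE_left (hU.qcPair h1 (hle ht))]
    split_ifs
    exacts [ht, zero_mem _]⟩
  have hK : ∀ a ∈ K, ∀ b ∈ K, ∀ n : ℤ, YE a b n ∈ K := by
    rintro a ⟨ha, ha'⟩ b ⟨hb, hb'⟩ m
    refine ⟨hcl a ha b hb m, fun t ht n => ?_⟩
    have h := mem_of_leftFamE hU hcl ha hb (hle ht) (T := monomialSpan S)
      (fun k => ha' _ (hb' t ht _) _) ![-m - 1, -n - 1]
    simpa [leftFamE] using h
  exact (monomialSpan_le (fun a ha => hK a (hSK a ha)) hK1 hu).2 t ht n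

lemma subset_monomialSpan : S ⊆ (monomialSpan S : Set (EW W)) := fun a ha => by
  have h : YE a oneE (-1) = a := YE_oneE_right_neg_one (hU.qcPair (hS ha) h1)
  have := YE_mem_monomialSpan_of_mem hU hcl h1 hS ha (oneE_mem_monomialSpan S) (-1)
  rwa [h] at this

lemma RaE_mem_monomialSpan {α : ℂˣ} (hα : ∀ a ∈ U, RaE α a ∈ U) (hαS : ∀ a ∈ S, RaE α a ∈ S)
    {t : EW W} (ht : t ∈ monomialSpan S) : RaE α t ∈ monomialSpan S := by
  have hle := monomialSpan_le_of_subset hU hcl h1 hS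
  induction ht using Submodule.span_induction with
  | mem x hx =>
    obtain ⟨r, b, m, hb, rfl⟩ := hx
    induction r with
    | zero =>
      have : RaE α (monomialE b m) = oneE := RaE_oneE α
      rw [this]
      exact oneE_mem_monomialSpan S
    | succ r ih =>
      have hm : monomialE (Fin.tail b) (Fin.tail m) ∈ U :=
        monomialE_mem (fun a ha => hcl a (hS ha)) h1 (fun i => hb i.succ) _
      have := RaE_YE (hU.qcPair (hS (hb 0)) hm) α (hU.qcPair (hα _ (hS (hb 0))) (hα _ hm)) (m 0)
      rw [show monomialE b m = YE (b 0) (monomialE (Fin.tail b) (Fin.tail m)) (m 0) from rfl, this]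
      exact Submodule.smul_mem _ _ (YE_mem_monomialSpan_of_mem hU hcl h1 hS (hαS _ (hb 0))
        (ih _ _ fun i => hb i.succ) _)
  | zero =>
    have : RaE α (0 : EW W) = 0 := by
      have := RaE_smul α (0 : ℂ) (0 : EW W)
      rwa [zero_smul, zero_smul] at this
    rw [this]
    exact zero_mem _
  | add x y _ _ ihx ihy =>
    rw [RaE_add]
    exact add_mem ihx ihy
  | smul c x _ ih =>
    rw [RaE_smul]
    exact Submodule.smul_mem _ c ih

end

lemma IsGenGamma.eq_monomialSpan {Γ : Subgroup ℂˣ} {S : Set (EW W)} {U : Submodule ℂ (EW W)}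
    (h : IsGenGamma Γ S U) : U = monomialSpan (RGamma Γ S) := by
  obtain ⟨⟨hU, hcl, h1, hS, hΓ⟩, hmin⟩ := h
  have hSΓ : RGamma Γ S ⊆ (U : Set (EW W)) := by
    rintro _ ⟨α, hα, a, ha, rfl⟩
    exact hΓ α hα a (hS ha)
  have hle := monomialSpan_le_of_subset hU hcl h1 hSΓ
  refine le_antisymm (hmin _ ⟨hU.mono hle,
    fun a ha b hb n => YE_mem_monomialSpan hU hcl h1 hSΓ ha hb n, oneE_mem_monomialSpan _,
    fun a ha => subset_monomialSpan hU hcl h1 hSΓ ⟨1, Γ.one_mem, a, ha, (RaE_one a).symm⟩,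
    fun α hα a ha => RaE_mem_monomialSpan hU hcl h1 hSΓ (hΓ α hα) ?_ ha⟩) hle
  rintro _ ⟨β, hβ, a, ha, rfl⟩
  exact ⟨α * β, Γ.mul_mem hα hβ, a, ha, RaE_RaE α β a⟩

section

variable {U : Submodule ℂ (EW W)} (hU : QCSet (U : Set (EW W)))
  (hcl : ∀ a ∈ U, ∀ b ∈ U, ∀ n : ℤ, YE a b n ∈ U) (h1 : oneE ∈ U)

/-- The vertex operator map `Y_ℰ` of a closed quasi compatible subspace. -/
def closedY : ↥U →ₗ[ℂ] EW ↥U where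
  toFun u :=
    ⟨{ toFun := fun v n => ⟨YE (u : EW W) (v : EW W) n, hcl _ u.2 _ v.2 n⟩
       map_add' := fun v v' => funext fun n => Subtype.ext
         (YE_add_right (hU.qcPair u.2 v.2) (hU.qcPair u.2 v'.2) (hU.qcPair u.2 (v + v').2) n)
       map_smul' := fun c v => funext fun n => Subtype.ext
         (YE_smul_right (hU.qcPair u.2 v.2) c (hU.qcPair u.2 (c • v).2) n) },
     fun v => by
      obtain ⟨N, hN⟩ := YEa_eq_zero (hU.qcPair u.2 v.2) 1
      exact ⟨N, fun n hn => Subtype.ext (hN n hn)⟩⟩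
  map_add' u u' := EW.ext fun v n => Subtype.ext
    (YE_add_left (hU.qcPair u.2 v.2) (hU.qcPair u'.2 v.2) (hU.qcPair (u + u').2 v.2) n)
  map_smul' c u := EW.ext fun v n => Subtype.ext
    (YE_smul_left (hU.qcPair u.2 v.2) c (hU.qcPair (c • u).2 v.2) n)

lemma exists_weakAssoc_closedY (u v w : ↥U) : ∃ l : ℕ, ∀ a b : ℤ,
    mulSubPoly (MvPolynomial.X 0 ^ l)
      (prodCE (fun x => mf (closedY hU hcl x)) (fun x => mf (closedY hU hcl x)) u v w) a b =
    mulSubPoly (MvPolynomial.X 0 ^ l)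
      (assocCE (fun x y n => mf (closedY hU hcl x) y n)
        (fun x => mf (closedY hU hcl x)) u v w) a b := by
  obtain ⟨e, he⟩ := exists_weakAssocE hU hcl u.2 v.2 w.2
  refine ⟨e, fun a b => ?_⟩
  rw [mulSubPoly_eq_act, mulSubPoly_eq_act,
    funext (prodCE_eq_subst (closedY hU hcl) u v w), map_pow, substPoly_X_self, map_one, one_mul]
  apply Subtype.ext
  have hs := subst_map (W' := EW W) U.subtype
    (substDom_pairFam (closedY hU hcl u) (closedY hU hcl v) w)
  have hr := congrFun (act_map (W' := EW W) U.subtype ((MvPolynomial.X 0 + MvPolynomial.X 1) ^ e)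
    (subst expR 0 1 (pairFam (closedY hU hcl u) (closedY hU hcl v) w))) ![a, b]
  have hl := congrFun (act_map (W' := EW W) U.subtype ((MvPolynomial.X 0 + MvPolynomial.X 1) ^ e)
    (fun k : Fin 2 → ℤ => assocCE (fun x y n => mf (closedY hU hcl x) y n)
        (fun x => mf (closedY hU hcl x)) u v w (k 0) (k 1))) ![a, b]
  refine hr.symm.trans (Eq.trans ?_ hl)
  rw [← hs]
  exact congrFun he ![a, b]

/-- A closed quasi compatible subspace containing `1_W` is a nonlocal vertex algebra. -/
def closedNLVA : NLVA ↥U where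
  Y := closedY hU hcl
  one := ⟨oneE, h1⟩
  vac v n := Subtype.ext <| (YE_oneE_left (hU.qcPair h1 v.2) n).trans (by split_ifs <;> rfl)
  creation0 v n hn := Subtype.ext (YE_oneE_right_of_nonneg (hU.qcPair v.2 h1) hn)
  creation1 v := Subtype.ext (YE_oneE_right_neg_one (hU.qcPair v.2 h1))
  wassoc := exists_weakAssoc_closedY hU hcl

lemma isQuasiModule_closedNLVA : IsQuasiModule (closedNLVA hU hcl h1) U.subtype := by
  refine ⟨fun w n => rfl, fun u v w => ?_⟩
  obtain ⟨f, hf, h⟩ := exists_quasiAssoc (hU.qcPair u.2 v.2) w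
  refine ⟨f, hf, fun a b => ?_⟩
  rw [mulSubPoly_eq_act, mulSubPoly_eq_act]
  have hp : (fun k : Fin 2 → ℤ => prodCE (YWf U.subtype) (YWf U.subtype) u v w (k 0) (k 1)) =
      subst expR 0 1 (pairFam (u : EW W) (v : EW W) w) :=
    funext (prodCE_eq_subst U.subtype u v w)
  rw [hp, h]
  rfl

end

lemma YEa_mem_and_eq {Γ : Subgroup ℂˣ} {U : Submodule ℂ (EW W)} (hU : QCSet (U : Set (EW W)))
    (hcl : ∀ a ∈ U, ∀ b ∈ U, ∀ n : ℤ, YE a b n ∈ U) (hΓ : ∀ α ∈ Γ, ∀ a ∈ U, RaE α a ∈ U)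
    {a b : EW W} (ha : a ∈ U) (hb : b ∈ U) {α : ℂˣ} (hα : α ∈ Γ) (n : ℤ) :
    YEa α a b n ∈ U ∧ YEa α a b n = RaE α (YE a (RaE α⁻¹ b) n) ∧
      RaE α (YE a (RaE α⁻¹ b) n) = ((α : ℂ) ^ (n + 1)) • YE (RaE α a) b n := by
  have hαa := hΓ α hα a ha
  have hαb := hΓ α⁻¹ (Γ.inv_mem hα) b hb
  have hb' : RaE α (RaE α⁻¹ b) = b := by rw [RaE_RaE, mul_inv_cancel, RaE_one]
  have h1 := YEa_eq_smul_YE (hU.qcPair ha hb) α (hU.qcPair hαa hb) n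
  have h2 := RaE_YE (hU.qcPair ha hαb) α (by rw [hb']; exact hU.qcPair hαa hb) n
  rw [hb'] at h2
  refine ⟨?_, h1.trans h2.symm, h2⟩
  rw [h1]
  exact U.smul_mem _ (hcl _ hαa _ hb n)

/-- cf. Theorem 2.13.  For any quasi compatible subset `S` of
`ℰ(W)` and any subgroup `Γ ≤ ℂˣ` there is a unique smallest closed quasi compatible
subspace `⟨S⟩_Γ` containing `S ∪ {1_W}` and stable under the `R_α`, `α ∈ Γ`; it is a
nonlocal vertex algebra under `Y_ℰ` with `W` as a faithful quasi module, it is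
spanned by the monomials `a⁽¹⁾(x)_{n₁} ⋯ a⁽ʳ⁾(x)_{n_r} 1_W` with `a⁽ⁱ⁾(x) ∈ R_Γ(S)`,
and it is stable under the products `a(x)_{(α,n)} b(x)` for `α ∈ Γ`, which satisfy
`Y_ℰ^{(α)}(a(x),x₀)b(x) = R_α Y_ℰ(a(x),x₀) R_{α⁻¹} b(x) = Y_ℰ(R_α a(x), α⁻¹x₀)b(x)`. -/
theorem statement2 {W : Type*} [AddCommGroup W] [Module ℂ W]
    (S : Set (EW W)) (hS : QCSet S) (Γ : Subgroup ℂˣ) :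
    (∃! U : Submodule ℂ (EW W), IsGenGamma Γ S U) ∧
    ∀ U : Submodule ℂ (EW W), IsGenGamma Γ S U →
      ((∃ A : NLVA ↥U, (A.one : EW W) = oneE ∧
          (∀ (a b : ↥U) (n : ℤ),
            ((Yf A a b n : ↥U) : EW W) = YE (a : EW W) (b : EW W) n) ∧
          IsQuasiModule A U.subtype ∧ Function.Injective U.subtype) ∧
        U = Submodule.span ℂ {v : EW W | ∃ (r : ℕ) (a : Fin r → EW W) (n : Fin r → ℤ),
              (∀ i, a i ∈ RGamma Γ S) ∧ v = monomialE a n} ∧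
        (∀ a ∈ U, ∀ b ∈ U, ∀ α : ℂˣ, α ∈ Γ → ∀ n : ℤ,
          YEa α a b n ∈ U ∧
          YEa α a b n = RaE α (YE a (RaE α⁻¹ b) n) ∧
          RaE α (YE a (RaE α⁻¹ b) n) = ((α : ℂ) ^ (n + 1)) • YE (RaE α a) b n)) := by
  refine ⟨existsUnique_isGenGamma Γ hS, fun U hU => ?_⟩
  obtain ⟨hQ, hcl, h1, -, hΓ⟩ := hU.1
  exact ⟨⟨closedNLVA hQ hcl h1, rfl, fun a b n => rfl, isQuasiModule_closedNLVA hQ hcl h1,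
    Subtype.val_injective⟩, hU.eq_monomialSpan,
    fun a ha b hb α hα n => YEa_mem_and_eq hQ hcl hΓ ha hb hα n⟩

end NVA
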